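/- arXiv:1504.07727 — 4 statements merged into one kernel-verified Lean document; each statement's English description precedes it below -/
import Mathlib

section
/- Let c and q be odd positive integers with cq ≡ 1 (mod 4), and let m, n be integers. Then the complete character sum ∑_{a mod cq} S(m, a²; cq) · e(an/(cq)) equals √(cq) · ∑_{b ∈ (ℤ/cqℤ)ˣ} (b | cq) · e(b(4m − n²)/(cq)), where the last sum runs over reduced residues b modulo cq. -/
/-- `e(x) = exp(2πix)`. -/
noncomputable def eF (x : ℝ) : ℂ := Complex.exp (2 * Real.pi * Complex.I * x)

/-- The Kloosterman sum `S(m,n;c) = ∑_{x mod c, (x,c)=1} e((m x + n x⁻¹)/c)`. -/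
noncomputable def kloos (m n : ℤ) (c : ℕ) : ℂ :=
  ∑ x ∈ (Finset.range c).filter (fun x => Nat.Coprime x c),
    eF (((m * x + n * (((x : ZMod c)⁻¹).val : ℤ) : ℤ) : ℝ) / c)

open Filter Topology

theorem gs_summable {a : ℂ} (ha : 0 < a.re) :
    Summable fun n : ℤ => Complex.exp (-Real.pi * a * (n : ℂ) ^ 2) := by
  have := (hasSum_jacobiTheta₂_term 0 (τ := Complex.I * a) (by simpa using ha)).summable
  refine this.congr fun n => ?_
  rw [jacobiTheta₂_term]
  congr 1
  linear_combination (-Real.pi * a * (n : ℂ) ^ 2 : ℂ) * (-1 - Complex.I_sq)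

theorem gs_dual {α : Type*} {l : Filter α} (A : α → ℂ) (hA : Tendsto (fun t => (A t).re) l atTop)
    (b : ℂ) (hb : b.re = 0) :
    Tendsto (fun t => ∑' n : ℤ, Complex.exp (-Real.pi * A t * (n : ℂ) ^ 2 + 2 * Real.pi * b * n)) l
      (𝓝 1) := by
  have hnorm : ∀ t (n : ℤ),
      ‖Complex.exp (-Real.pi * A t * (n : ℂ) ^ 2 + 2 * Real.pi * b * n)‖
        = Real.exp (-Real.pi * (A t).re * (n : ℝ) ^ 2) := by
    intro t n
    rw [Complex.norm_exp]
    congr 1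
    have h1 : (-Real.pi * A t * (n : ℂ) ^ 2 + 2 * Real.pi * b * n : ℂ)
      = ((-Real.pi * (n:ℝ)^2 : ℝ) : ℂ) * A t + ((2 * Real.pi * n : ℝ) : ℂ) * b := by
      push_cast; ring
    rw [h1, Complex.add_re, Complex.re_ofReal_mul, Complex.re_ofReal_mul, hb]
    ring
  have hs : (1 : ℂ) = ∑' n : ℤ, (if n = 0 then (1 : ℂ) else 0) := by simp
  rw [hs]
  refine tendsto_tsum_of_dominated_convergence
    (bound := fun n : ℤ => ‖Complex.exp (-Real.pi * (1:ℂ) * (n : ℂ) ^ 2)‖)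
    (gs_summable (by simp)).norm ?_ ?_
  · intro n
    by_cases hn : n = 0
    · simpa [hn] using tendsto_const_nhds
    · simp only [hn, if_false]
      rw [tendsto_zero_iff_norm_tendsto_zero]
      simp_rw [hnorm]
      refine Real.tendsto_exp_atBot.comp ?_
      have hpos : 0 < Real.pi * (n : ℝ) ^ 2 := by
        have : (n : ℝ) ≠ 0 := by exact_mod_cast hn
        positivity
      have := (tendsto_neg_atTop_atBot.comp (hA.const_mul_atTop hpos))
      refine this.congr fun t => ?_
      simp only [Function.comp]; ring
  · filter_upwards [hA.eventually_ge_atTop 1] with t ht n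
    rw [hnorm, Complex.norm_exp]
    apply Real.exp_le_exp.2
    have h1 : (-Real.pi * (1:ℂ) * (n : ℂ) ^ 2 : ℂ) = ((-Real.pi * (n:ℝ)^2 : ℝ) : ℂ) := by
      push_cast; ring
    rw [h1, Complex.ofReal_re]
    have : 0 ≤ Real.pi * (n:ℝ)^2 := by positivity
    nlinarith

theorem gs_real_mul_cpow {r : ℝ} (hr : 0 < r) {z : ℂ} (hz : z ≠ 0) :
    ((r : ℂ) * z) ^ (1 / 2 : ℂ) = (Real.sqrt r : ℂ) * z ^ (1 / 2 : ℂ) := by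
  have hr' : (r : ℂ) ≠ 0 := by exact_mod_cast hr.ne'
  rw [Complex.cpow_def_of_ne_zero (mul_ne_zero hr' hz), Complex.cpow_def_of_ne_zero hz,
    Complex.log_ofReal_mul hr hz, add_mul, Complex.exp_add, Real.sqrt_eq_rpow,
    Complex.ofReal_cpow hr.le, Complex.cpow_def_of_ne_zero hr', Complex.ofReal_log hr.le]
  norm_num

theorem gs_residue (w : ℝ → ℂ) (w0 : ℂ) (hw0 : 0 < w0.re) (hw : Tendsto w (𝓝[>] 0) (𝓝 w0))
    (M : ℕ) (hM : 0 < M) (r : ℤ) :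
    Tendsto (fun t : ℝ => (Real.sqrt t : ℂ) *
      ∑' k : ℤ, Complex.exp (-Real.pi * (t * w t) * ((k * M + r : ℤ) : ℂ) ^ 2)) (𝓝[>] 0)
      (𝓝 ((w0⁻¹) ^ (1 / 2 : ℂ) / M)) := by
  have hw0' : w0 ≠ 0 := by rintro rfl; simp at hw0
  have hMR : (0 : ℝ) < M := by exact_mod_cast hM
  have hMC : (M : ℂ) ≠ 0 := by exact_mod_cast hM.ne'
  have hinv : Tendsto (fun t => (w t)⁻¹) (𝓝[>] 0) (𝓝 w0⁻¹) := hw.inv₀ hw0'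
  have hinvre : 0 < (w0⁻¹).re := by
    rw [Complex.inv_re]; exact div_pos hw0 (Complex.normSq_pos.2 hw0')
  have hre : Tendsto (fun t => ((w t)⁻¹).re) (𝓝[>] 0) (𝓝 (w0⁻¹).re) :=
    (Complex.continuous_re.tendsto _).comp hinv
  have hA : Tendsto (fun t : ℝ => (((1 / (t * M ^ 2) : ℝ) : ℂ) * (w t)⁻¹).re) (𝓝[>] 0) atTop := by
    simp_rw [Complex.re_ofReal_mul]
    refine Tendsto.atTop_mul_pos hinvre ?_ hre
    have h1 : Tendsto (fun t : ℝ => t⁻¹) (𝓝[>] 0) atTop := tendsto_inv_nhdsGT_zero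
    have := h1.const_mul_atTop (r := (1 / (M:ℝ)^2)) (by positivity)
    refine this.congr fun t => ?_
    field_simp
  have hdual := gs_dual _ hA (-Complex.I * r / M) (by
    have : (-Complex.I * r / M : ℂ) = ((-r / M : ℝ) : ℂ) * Complex.I := by push_cast; ring
    rw [this, Complex.re_ofReal_mul]; simp)
  have hcp : Tendsto (fun t => ((w t)⁻¹) ^ (1 / 2 : ℂ)) (𝓝[>] 0) (𝓝 ((w0⁻¹) ^ (1 / 2 : ℂ))) :=
    hinv.cpow tendsto_const_nhds (Or.inl hinvre)
  have := (hcp.div_const (M : ℂ)).mul hdual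
  rw [mul_one] at this
  refine this.congr' ?_
  filter_upwards [self_mem_nhdsWithin, hre.eventually_const_lt hinvre] with t ht hwt
  have ht : 0 < t := ht
  have hwne : w t ≠ 0 := by intro h; simp [h] at hwt
  have htC : (t : ℂ) ≠ 0 := by exact_mod_cast ht.ne'
  have hs : (Real.sqrt t : ℂ) ≠ 0 := by exact_mod_cast (Real.sqrt_pos.2 ht).ne'
  have hc0 : ((w t)⁻¹) ^ (1 / 2 : ℂ) ≠ 0 := by
    rw [Complex.cpow_def_of_ne_zero (inv_ne_zero hwne)]; exact Complex.exp_ne_zero _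
  rw [Complex.tsum_exp_neg_quadratic (by rw [Complex.re_ofReal_mul]; positivity),
    gs_real_mul_cpow (by positivity) (inv_ne_zero hwne)]
  have e1 : (Real.sqrt (1 / (t * M ^ 2)) : ℂ) = 1 / (Real.sqrt t * M) := by
    rw [Real.sqrt_div zero_le_one, Real.sqrt_mul ht.le, Real.sqrt_sq hMR.le]
    simp
  rw [e1, ← mul_assoc]
  congr 1
  · generalize ((w t)⁻¹) ^ (1 / 2 : ℂ) = z at hc0
    field_simp
  · refine tsum_congr fun k => ?_
    congr 1
    push_cast
    have : (k + Complex.I * (-Complex.I * r / M) : ℂ) = (k * M + r) / M := by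
      field_simp
      linear_combination (-r : ℂ) * Complex.I_sq
    rw [this]
    field_simp

theorem gs_periodic (w : ℝ → ℂ) (w0 : ℂ) (hw0 : 0 < w0.re) (hw : Tendsto w (𝓝[>] 0) (𝓝 w0))
    (M : ℕ) [NeZero M] (f : ℤ → ℂ) (hf : ∀ k r : ℤ, f (k * M + r) = f r) :
    Tendsto (fun t : ℝ => (Real.sqrt t : ℂ) *
      ∑' n : ℤ, f n * Complex.exp (-Real.pi * (t * w t) * (n : ℂ) ^ 2)) (𝓝[>] 0)
      (𝓝 ((w0⁻¹) ^ (1 / 2 : ℂ) / M * ∑ r : Fin M, f (r : ℕ))) := by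
  have h := tendsto_finsetSum (Finset.univ : Finset (Fin M)) fun r _ =>
    (gs_residue w w0 hw0 hw M (Nat.pos_of_ne_zero (NeZero.ne M)) ((r : ℕ) : ℤ)).mul_const
      (f (r : ℕ))
  rw [← Finset.mul_sum] at h
  refine h.congr' ?_
  have hre : Tendsto (fun t => (w t).re) (𝓝[>] 0) (𝓝 w0.re) :=
    (Complex.continuous_re.tendsto _).comp hw
  filter_upwards [self_mem_nhdsWithin, hre.eventually_const_lt hw0] with t ht hwt
  have ht : 0 < t := ht
  have hsum := gs_summable (a := t * w t) (by rw [Complex.re_ofReal_mul]; positivity)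
  have hinj : ∀ r : Fin M, Function.Injective (fun k : ℤ => k * (M : ℤ) + ((r : ℕ) : ℤ)) := by
    intro r a b hab
    have hM : (M : ℤ) ≠ 0 := by exact_mod_cast NeZero.ne M
    exact mul_right_cancel₀ hM (add_right_cancel hab)
  have hS : ∀ r : Fin M, Summable fun k : ℤ => f (r : ℕ) *
      Complex.exp (-Real.pi * (t * w t) * ((k * M + (r : ℕ) : ℤ) : ℂ) ^ 2) := fun r =>
    (hsum.comp_injective (hinj r)).mul_left _
  rw [← (Int.divModEquiv M).symm.tsum_eq]
  have e : ∀ p : ℤ × Fin M, f ((Int.divModEquiv M).symm p) * Complex.exp (-Real.pi * (t * w t) *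
      (((Int.divModEquiv M).symm p : ℤ) : ℂ) ^ 2) = f (p.2 : ℕ) *
      Complex.exp (-Real.pi * (t * w t) * ((p.1 * M + (p.2 : ℕ) : ℤ) : ℂ) ^ 2) := by
    intro p
    have : (Int.divModEquiv M).symm p = p.1 * M + (p.2 : ℕ) := rfl
    rw [this, hf]
  simp_rw [e]
  have hbd : HasSum (fun p : Fin M × ℤ => f (p.1 : ℕ) *
      Complex.exp (-Real.pi * (t * w t) * ((p.2 * M + (p.1 : ℕ) : ℤ) : ℂ) ^ 2))
      (∑ r : Fin M, ∑' k : ℤ, f (r : ℕ) *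
      Complex.exp (-Real.pi * (t * w t) * ((k * M + (r : ℕ) : ℤ) : ℂ) ^ 2)) := by
    have hsm : Summable (fun p : Fin M × ℤ => f (p.1 : ℕ) *
      Complex.exp (-Real.pi * (t * w t) * ((p.2 * M + (p.1 : ℕ) : ℤ) : ℂ) ^ 2)) := by
      apply Summable.of_norm
      rw [summable_prod_of_nonneg (fun _ => norm_nonneg _)]
      exact ⟨fun r => (hS r).norm, (hasSum_fintype _).summable⟩
    have := hsm.hasSum
    rwa [hsm.tsum_prod, tsum_fintype] at this
  have h2 := (Equiv.prodComm ℤ (Fin M)).hasSum_iff.2 hbd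
  have h3 : ∑' p : ℤ × Fin M, f (p.2 : ℕ) *
      Complex.exp (-Real.pi * (t * w t) * ((p.1 * M + (p.2 : ℕ) : ℤ) : ℂ) ^ 2) = _ := h2.tsum_eq
  rw [h3, Finset.mul_sum]
  refine Finset.sum_congr rfl fun r _ => ?_
  rw [tsum_mul_left]
  ring

theorem gs_one (N : ℕ) (hN : N % 4 = 1) :
    ∑ r : Fin N, Complex.exp (2 * Real.pi * Complex.I * ((r : ℕ) : ℂ) ^ 2 / N) = Real.sqrt N := by
  have hNpos : 0 < N := by omega
  have : NeZero N := ⟨hNpos.ne'⟩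
  have hNR : (0 : ℝ) < N := by exact_mod_cast hNpos
  have hNC : (N : ℂ) ≠ 0 := by exact_mod_cast hNpos.ne'
  have L := gs_periodic (fun _ => 1) 1 (by simp) tendsto_const_nhds N
    (fun n => Complex.exp (2 * Real.pi * Complex.I * (n : ℂ) ^ 2 / N)) (by
      intro k r
      rw [Complex.exp_eq_exp_iff_exists_int]
      refine ⟨k ^ 2 * N + 2 * k * r, ?_⟩
      push_cast
      field_simp
      ring)
  have hden : Tendsto (fun t : ℝ => (1 + Complex.I * N * t / 2 : ℂ)) (𝓝[>] 0) (𝓝 1) := by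
    have : Continuous (fun t : ℝ => (1 + Complex.I * N * t / 2 : ℂ)) := by fun_prop
    have := (this.tendsto 0).mono_left (nhdsWithin_le_nhds (s := Set.Ioi 0))
    simpa using this
  have hwR : Tendsto (fun t : ℝ => ((N : ℂ) ^ 2 / 4) / (1 + Complex.I * N * t / 2)) (𝓝[>] 0)
      (𝓝 ((N : ℂ) ^ 2 / 4)) := by
    have := (tendsto_const_nhds (x := ((N : ℂ) ^ 2 / 4))).div hden one_ne_zero
    rw [div_one] at this
    exact this
  have hw0 : ((N : ℂ) ^ 2 / 4) = (((N : ℝ) ^ 2 / 4 : ℝ) : ℂ) := by push_cast; rfl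
  have R := gs_periodic _ ((N : ℂ) ^ 2 / 4) (by rw [hw0, Complex.ofReal_re]; positivity) hwR 2
    (fun n => Complex.exp (-Real.pi * Complex.I * N * (n : ℂ) ^ 2 / 2)) (by
      intro k r
      rw [Complex.exp_eq_exp_iff_exists_int]
      refine ⟨-(k ^ 2 + k * r) * N, ?_⟩
      push_cast
      ring)
  have ha : Tendsto (fun t : ℝ => (t - 2 * Complex.I / N : ℂ)) (𝓝[>] 0)
      (𝓝 (-2 * Complex.I / N)) := by
    have : Continuous (fun t : ℝ => (t - 2 * Complex.I / N : ℂ)) := by fun_prop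
    have := (this.tendsto 0).mono_left (nhdsWithin_le_nhds (s := Set.Ioi 0))
    convert this using 2
    push_cast; ring
  have ha0 : (-2 * Complex.I / N : ℂ) = ((2 / N : ℝ) : ℂ) * (-Complex.I) := by push_cast; ring
  have hcp : Tendsto (fun t : ℝ => 1 / (t - 2 * Complex.I / N : ℂ) ^ (1 / 2 : ℂ)) (𝓝[>] 0)
      (𝓝 (1 / (-2 * Complex.I / N) ^ (1 / 2 : ℂ))) := by
    refine tendsto_const_nhds.div (ha.cpow tendsto_const_nhds (Or.inr ?_)) ?_
    · rw [ha0, Complex.im_ofReal_mul]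
      simpa using hNpos.ne'
    · rw [Complex.cpow_def_of_ne_zero]
      · exact Complex.exp_ne_zero _
      · simp [hNC]
  have R2 := hcp.mul R
  have key := tendsto_nhds_unique_of_eventuallyEq L R2 (by
    filter_upwards [self_mem_nhdsWithin] with t ht
    have ht : 0 < t := ht
    have hre : (t - 2 * Complex.I / N : ℂ).re = t := by
      have : (t - 2 * Complex.I / N : ℂ) = t - ((2 / N : ℝ) : ℂ) * Complex.I := by
        push_cast; ring
      rw [this, Complex.sub_re, Complex.re_ofReal_mul]; simp
    have h := Complex.tsum_exp_neg_quadratic (a := (t - 2 * Complex.I / N : ℂ))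
      (by rw [hre]; exact ht) 0
    have hane : (t - 2 * Complex.I / N : ℂ) ≠ 0 := by
      intro h0; rw [h0] at hre; simp at hre; exact ht.ne hre
    have hdne : (1 + Complex.I * N * t / 2 : ℂ) ≠ 0 := by
      intro h0
      have := congrArg Complex.re h0
      have e : (1 + Complex.I * N * t / 2 : ℂ) = 1 + ((N * t / 2 : ℝ) : ℂ) * Complex.I := by
        push_cast; ring
      rw [e, Complex.add_re, Complex.re_ofReal_mul] at this
      simp at this
    have hl : ∀ n : ℤ, Complex.exp (2 * Real.pi * Complex.I * (n : ℂ) ^ 2 / N) *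
        Complex.exp (-Real.pi * (t * 1) * (n : ℂ) ^ 2) =
        Complex.exp (-Real.pi * (t - 2 * Complex.I / N : ℂ) * (n : ℂ) ^ 2 +
          2 * Real.pi * 0 * n) := by
      intro n
      rw [← Complex.exp_add]
      congr 1
      ring
    have hinv : (1 : ℂ) / (t - 2 * Complex.I / N : ℂ) = Complex.I * N / 2 +
        t * (((N : ℂ) ^ 2 / 4) / (1 + Complex.I * N * t / 2)) := by
      have e1 : (t - 2 * Complex.I / N : ℂ) =
          -2 * Complex.I / N * (1 + Complex.I * N * t / 2) := by
        field_simp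
        linear_combination (t * N : ℂ) * Complex.I_sq
      rw [e1]
      have e2 : (1 : ℂ) / (-2 * Complex.I / N * (1 + Complex.I * N * t / 2)) =
          (Complex.I * N / 2) / (1 + Complex.I * N * t / 2) := by
        rw [div_eq_div_iff (by simp [hNC, hdne]) hdne]
        field_simp
        linear_combination Complex.I_sq * (2 + Complex.I * N * t)
      rw [e2, div_eq_iff hdne, add_mul, mul_assoc (t : ℂ), div_mul_cancel₀ _ hdne]
      linear_combination (-(N : ℂ) ^ 2 * t / 4) * Complex.I_sq
    have hr : ∀ n : ℤ, Complex.exp (-Real.pi / (t - 2 * Complex.I / N : ℂ) *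
        ((n : ℂ) + Complex.I * 0) ^ 2) =
        Complex.exp (-Real.pi * Complex.I * N * (n : ℂ) ^ 2 / 2) *
        Complex.exp (-Real.pi * (t * (((N : ℂ) ^ 2 / 4) / (1 + Complex.I * N * t / 2))) *
          (n : ℂ) ^ 2) := by
      intro n
      rw [← Complex.exp_add]
      congr 1
      rw [div_eq_mul_one_div, hinv]
      ring
    simp_rw [hl, h, hr]
    ring)
  have hsum2 : ∑ r : Fin 2, Complex.exp (-Real.pi * Complex.I * N * (((r : ℕ) : ℤ) : ℂ) ^ 2 / 2)
      = 1 - Complex.I := by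
    rw [Fin.sum_univ_two]
    have h1 : Complex.exp (-Real.pi * Complex.I * N * ((((1 : Fin 2) : ℕ) : ℤ) : ℂ) ^ 2 / 2)
        = Complex.exp (-(Real.pi / 2 * Complex.I)) := by
      rw [Complex.exp_eq_exp_iff_exists_int]
      obtain ⟨j, rfl⟩ : ∃ j, N = 4 * j + 1 := ⟨N / 4, by omega⟩
      refine ⟨-(j : ℤ), ?_⟩
      push_cast
      simp
      ring
    rw [h1, Complex.exp_neg, Complex.exp_pi_div_two_mul_I, Complex.inv_I]
    simp
    ring
  rw [hsum2] at key
  have hc1 : (-2 * Complex.I / N : ℂ) ^ (1 / 2 : ℂ) =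
      (Real.sqrt (2 / N) : ℂ) * (-Complex.I) ^ (1 / 2 : ℂ) := by
    rw [ha0, gs_real_mul_cpow (by positivity) (by simp)]
  have hc2 : (-Complex.I) ^ (1 / 2 : ℂ) = (Real.sqrt 2 / 2 : ℝ) * (1 - Complex.I) := by
    rw [Complex.cpow_def_of_ne_zero (by simp), Complex.log_neg_I]
    have : (-(Real.pi / 2 : ℂ) * Complex.I * (1 / 2)) = ((-(Real.pi / 4) : ℝ) : ℂ) * Complex.I := by
      push_cast; ring
    rw [this, Complex.exp_mul_I, ← Complex.ofReal_cos, ← Complex.ofReal_sin, Real.cos_neg,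
      Real.sin_neg, Real.cos_pi_div_four, Real.sin_pi_div_four]
    push_cast; ring
  have hc3 : (((N : ℂ) ^ 2 / 4)⁻¹) ^ (1 / 2 : ℂ) = (2 / (N : ℂ) : ℂ) := by
    have : ((N : ℂ) ^ 2 / 4)⁻¹ = (((2 / N : ℝ) ^ 2 : ℝ) : ℂ) * 1 := by
      push_cast; field_simp; norm_num
    rw [this, gs_real_mul_cpow (by positivity) one_ne_zero, Real.sqrt_sq (by positivity)]
    simp
  rw [hc1, hc2, hc3] at key
  have hI : (1 - Complex.I) ≠ 0 := by
    intro h0; have := congrArg Complex.re h0; simp at this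
  have hs2 : (Real.sqrt 2 : ℂ) ^ 2 = 2 := by
    exact_mod_cast congrArg Complex.ofReal (Real.sq_sqrt (by norm_num : (0:ℝ) ≤ 2))
  have hsN : (Real.sqrt N : ℂ) ^ 2 = N := by
    exact_mod_cast congrArg Complex.ofReal (Real.sq_sqrt hNR.le)
  have hsN0 : (Real.sqrt N : ℂ) ≠ 0 := by exact_mod_cast (Real.sqrt_pos.2 hNR).ne'
  have hs20 : (Real.sqrt 2 : ℂ) ≠ 0 := by
    exact_mod_cast (Real.sqrt_pos.2 (by norm_num : (0:ℝ) < 2)).ne'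
  rw [Real.sqrt_div (by norm_num)] at key
  have hfin : (1 : ℂ) / (((Real.sqrt 2 / Real.sqrt N : ℝ) : ℂ) *
      (((Real.sqrt 2 / 2 : ℝ) : ℂ) * (1 - Complex.I))) * (2 / (N : ℂ) / ((2 : ℕ) : ℂ) * (1 - Complex.I))
      = Real.sqrt N / N := by
    push_cast
    field_simp
    linear_combination -hs2
  rw [hfin] at key
  simp only [inv_one, Complex.one_cpow] at key
  push_cast at key ⊢
  field_simp at key
  simpa using key

theorem gs_eF (N : ℕ) [NeZero N] (z : ℤ) :
    eF ((z : ℝ) / (N : ℝ)) = ZMod.stdAddChar (z : ZMod N) := by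
  rw [ZMod.stdAddChar_coe, eF]
  congr 1
  push_cast
  ring

theorem gs_sum_range (N : ℕ) [NeZero N] (F : ZMod N → ℂ) :
    ∑ a ∈ Finset.range N, F (a : ZMod N) = ∑ a : ZMod N, F a := by
  refine Finset.sum_bij' (fun a _ => (a : ZMod N)) (fun a _ => a.val) ?_ ?_ ?_ ?_ ?_
  · simp
  · intro a _; simpa using ZMod.val_lt a
  · intro a ha; exact ZMod.val_cast_of_lt (by simpa using ha)
  · intro a _; simp
  · simp

theorem gs_sum_units (N : ℕ) [NeZero N] (F : ZMod N → ℂ) :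
    ∑ a ∈ (Finset.range N).filter (fun a => Nat.Coprime a N), F (a : ZMod N)
      = ∑ u : (ZMod N)ˣ, F u := by
  refine Finset.sum_bij' (fun a ha => ZMod.unitOfCoprime a (Finset.mem_filter.1 ha).2)
    (fun u _ => (u : ZMod N).val) ?_ ?_ ?_ ?_ ?_
  · simp
  · intro u _
    simp only [Finset.mem_filter, Finset.mem_range]
    exact ⟨ZMod.val_lt _, ZMod.val_coe_unit_coprime u⟩
  · intro a ha
    simp only [ZMod.coe_unitOfCoprime]
    exact ZMod.val_cast_of_lt (by simpa using (Finset.mem_filter.1 ha).1)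
  · intro u _; ext; simp
  · simp

/-- The quadratic Gauss sum. -/
noncomputable def gsG (N : ℕ) [NeZero N] (x : ZMod N) : ℂ :=
  ∑ a : ZMod N, ZMod.stdAddChar (x * a ^ 2)

theorem gsG_one (N : ℕ) [NeZero N] (hN : N % 4 = 1) : gsG N 1 = Real.sqrt N := by
  rw [← gs_one N hN, gsG, ← gs_sum_range, ← Fin.sum_univ_eq_sum_range
    (fun a => (ZMod.stdAddChar (1 * (a : ZMod N) ^ 2) : ℂ))]
  refine Finset.sum_congr rfl fun r _ => ?_
  have := ZMod.stdAddChar_coe (N := N) (((r : ℕ) : ℤ) ^ 2)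
  push_cast at this
  rw [one_mul, this]

theorem gsG_mul (M N : ℕ) [NeZero M] [NeZero N] [NeZero (M * N)] (h : Nat.Coprime M N) :
    gsG (M * N) 1 = gsG M (N : ZMod M) * gsG N (M : ZMod N) := by
  have hN : IsUnit (N : ZMod M) := (ZMod.isUnit_iff_coprime N M).2 h.symm
  have hM : IsUnit (M : ZMod N) := (ZMod.isUnit_iff_coprime M N).2 h
  have hMC : (M : ℂ) ≠ 0 := by exact_mod_cast NeZero.ne M
  have hNC : (N : ℂ) ≠ 0 := by exact_mod_cast NeZero.ne N
  let φ : ZMod M × ZMod N → ZMod (M * N) := fun p =>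
    (N : ZMod (M * N)) * (p.1.val : ZMod (M * N)) + (M : ZMod (M * N)) * (p.2.val : ZMod (M * N))
  have hφ : Function.Bijective φ := by
    rw [Fintype.bijective_iff_injective_and_card]
    refine ⟨?_, by simp [ZMod.card]⟩
    rintro ⟨u, v⟩ ⟨u', v'⟩ he
    have h1 := congrArg (ZMod.castHom (dvd_mul_right M N) (ZMod M)) he
    have h2 := congrArg (ZMod.castHom (dvd_mul_left N M) (ZMod N)) he
    simp only [φ, map_add, map_mul, map_natCast, ZMod.natCast_self, ZMod.natCast_zmod_val,
      zero_mul, add_zero, zero_add] at h1 h2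
    rw [hN.mul_right_inj] at h1
    rw [hM.mul_right_inj] at h2
    rw [h1, h2]
  rw [gsG, gsG, gsG, Finset.sum_mul_sum, ← Fintype.sum_prod_type']
  symm
  refine Fintype.sum_bijective φ hφ _ _ ?_
  rintro ⟨u, v⟩
  have e1 := ZMod.stdAddChar_coe (N := M) ((N : ℤ) * (u.val : ℤ) ^ 2)
  have e2 := ZMod.stdAddChar_coe (N := N) ((M : ℤ) * (v.val : ℤ) ^ 2)
  have e3 := ZMod.stdAddChar_coe (N := M * N)
    (((N : ℤ) * (u.val : ℤ) + (M : ℤ) * (v.val : ℤ)) ^ 2)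
  push_cast [ZMod.natCast_zmod_val] at e1 e2 e3
  simp only [φ, one_mul]
  rw [e1, e2, e3, ← Complex.exp_add, Complex.exp_eq_exp_iff_exists_int]
  refine ⟨-(2 * (u.val : ℤ) * (v.val : ℤ)), ?_⟩
  push_cast
  field_simp
  ring

theorem gsG_prime (p : ℕ) [Fact p.Prime] (hp : p ≠ 2) (x : (ZMod p)ˣ) :
    gsG p x = (quadraticChar (ZMod p) x : ℂ) * gsG p 1 := by
  classical
  set χ : MulChar (ZMod p) ℂ := (quadraticChar (ZMod p)).ringHomComp (Int.castRingHom ℂ) with hχ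
  have key : ∀ y : (ZMod p)ˣ, gsG p y = gaussSum χ (AddChar.mulShift ZMod.stdAddChar (y : ZMod p)) := by
    intro y
    have hc : ringChar (ZMod p) ≠ 2 := by rwa [ZMod.ringChar_zmod_n]
    have h0 : ∑ b : ZMod p, (ZMod.stdAddChar ((y : ZMod p) * b) : ℂ) = 0 := by
      have := AddChar.sum_mulShift (y : ZMod p) (ZMod.isPrimitive_stdAddChar p)
      simp only [Units.ne_zero, if_false, Nat.cast_zero] at this
      rw [← this]
      exact Finset.sum_congr rfl fun b _ => by rw [mul_comm]
    have h1 : gsG p y = ∑ b : ZMod p, ((quadraticChar (ZMod p) b + 1 : ℤ) : ℂ) *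
        ZMod.stdAddChar ((y : ZMod p) * b) := by
      rw [gsG, ← Finset.sum_fiberwise (Finset.univ) (fun a : ZMod p => a ^ 2)]
      refine Finset.sum_congr rfl fun b _ => ?_
      rw [← quadraticChar_card_sqrts hc b]
      rw [Finset.sum_congr rfl (g := fun _ => (ZMod.stdAddChar ((y : ZMod p) * b) : ℂ))]
      · rw [Finset.sum_const, nsmul_eq_mul]
        congr 2
        congr 1
        ext; simp
      · intro a ha
        rw [(Finset.mem_filter.1 ha).2]
    rw [h1, gaussSum]
    push_cast
    simp_rw [add_mul, one_mul, Finset.sum_add_distrib]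
    rw [h0, add_zero]
    simp [hχ, AddChar.mulShift_apply, MulChar.ringHomComp_apply]
  have k1 := key 1
  rw [Units.val_one] at k1
  rw [key, k1]
  have g := gaussSum_mulShift χ ZMod.stdAddChar x
  rw [AddChar.mulShift_one, ← g, ← mul_assoc]
  have : (quadraticChar (ZMod p) x : ℂ) * χ x = 1 := by
    have := quadraticChar_sq_one (F := ZMod p) (a := x) x.ne_zero
    rw [hχ, MulChar.ringHomComp_apply]
    simp only [eq_intCast]
    rw [← sq]
    exact_mod_cast this
  rw [this, one_mul]

theorem gsG_eq (N : ℕ) [NeZero N] (hN : N % 4 = 1) (b : ℕ) (hb : Nat.Coprime b N) :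
    gsG N (b : ZMod N) = (jacobiSym (b : ℤ) N : ℂ) * Real.sqrt N := by
  have h4 : Nat.Coprime N 4 := by
    have : Nat.Coprime N 2 := (Nat.coprime_two_right (n := N)).2 (Nat.odd_iff.2 (by omega))
    exact this.pow_right 2
  obtain ⟨k, hk1, hk2⟩ := Nat.chineseRemainder h4 b 1
  have hkN : Nat.Coprime k (N * 4) := by
    refine Nat.Coprime.mul_right ?_ ?_
    · rw [Nat.Coprime, hk1.gcd_eq]; exact hb
    · rw [Nat.Coprime, hk2.gcd_eq]; simp
  obtain ⟨p, hpN, hp, hpk⟩ := Nat.forall_exists_prime_gt_and_modEq (N + 2)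
    (q := N * 4) (by have := NeZero.ne N; positivity) hkN
  have hpb : p ≡ b [MOD N] := (hpk.of_mul_right 4).trans hk1
  have hp4 : p % 4 = 1 := (hpk.of_mul_left N).trans hk2
  have : Fact p.Prime := ⟨hp⟩
  have hcop : Nat.Coprime p N := by rw [Nat.Coprime, hpb.gcd_eq]; exact hb
  have : NeZero (p * N) := ⟨mul_ne_zero hp.ne_zero (NeZero.ne N)⟩
  have h1 := gsG_mul p N hcop
  rw [gsG_one (p * N) (by rw [Nat.mul_mod, hp4, hN]),
    ← ZMod.coe_unitOfCoprime N hcop.symm, gsG_prime p (by omega), ZMod.coe_unitOfCoprime,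
    gsG_one p hp4, (ZMod.natCast_eq_natCast_iff p b N).2 hpb] at h1
  have h2 : quadraticChar (ZMod p) (N : ZMod p) = jacobiSym (b : ℤ) N := by
    have : quadraticChar (ZMod p) (N : ZMod p) = legendreSym p (N : ℤ) := by
      simp [legendreSym]
    rw [this, jacobiSym.legendreSym.to_jacobiSym,
      jacobiSym.quadratic_reciprocity_one_mod_four hN (Nat.odd_iff.2 (by omega))]
    refine jacobiSym.mod_left' ?_
    exact_mod_cast hpb
  rw [h2] at h1
  have hsq : (jacobiSym (b : ℤ) N : ℂ) * (jacobiSym (b : ℤ) N : ℂ) = 1 := by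
    have := jacobiSym.sq_one (a := (b : ℤ)) (b := N) (by simpa using hb)
    rw [← sq]; exact_mod_cast this
  have hp0 : (Real.sqrt p : ℂ) ≠ 0 := by
    have : (0 : ℝ) < p := by exact_mod_cast hp.pos
    exact_mod_cast (Real.sqrt_pos.2 this).ne'
  push_cast at h1
  rw [Real.sqrt_mul (by positivity)] at h1
  push_cast at h1
  have h3 : (Real.sqrt N : ℂ) = jacobiSym (b : ℤ) N * gsG N (b : ZMod N) := by
    apply mul_left_cancel₀ hp0
    rw [h1]; ring
  rw [h3, ← mul_assoc, hsq, one_mul]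

theorem gs_main (N : ℕ) [NeZero N] (hN : N % 4 = 1) (m n : ℤ) :
    ∑ a ∈ Finset.range N, kloos m ((a : ℤ) ^ 2) N * eF ((((a : ℤ) * n : ℤ) : ℝ) / (N : ℝ))
      = (Real.sqrt N : ℂ) *
        ∑ b ∈ (Finset.range N).filter (fun b => Nat.Coprime b N),
          (jacobiSym (b : ℤ) N : ℂ) *
            eF ((((b : ℤ) * (4 * m - n ^ 2) : ℤ) : ℝ) / (N : ℝ)) := by
  have hk : ∀ a : ℕ, kloos m ((a : ℤ) ^ 2) N =
      ∑ u : (ZMod N)ˣ, (ZMod.stdAddChar ((m : ZMod N) * (u : ZMod N) +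
        (a : ZMod N) ^ 2 * (u : ZMod N)⁻¹) : ℂ) := by
    intro a
    rw [kloos, ← gs_sum_units N (fun u : ZMod N => (ZMod.stdAddChar ((m : ZMod N) * (u : ZMod N) +
      (a : ZMod N) ^ 2 * u⁻¹) : ℂ))]
    refine Finset.sum_congr rfl fun x _ => ?_
    rw [gs_eF]
    push_cast [ZMod.natCast_zmod_val]
    rfl
  have hL : ∀ a : ℕ, kloos m ((a : ℤ) ^ 2) N * eF ((((a : ℤ) * n : ℤ) : ℝ) / (N : ℝ)) =
      (fun a : ZMod N => ∑ u : (ZMod N)ˣ, (ZMod.stdAddChar ((m : ZMod N) * (u : ZMod N) +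
        a ^ 2 * (u : ZMod N)⁻¹ + a * (n : ZMod N)) : ℂ)) (a : ZMod N) := by
    intro a
    rw [hk, gs_eF, Finset.sum_mul]
    refine Finset.sum_congr rfl fun u _ => ?_
    push_cast
    rw [AddChar.map_add_eq_mul _ _ ((a : ZMod N) * (n : ZMod N))]
  rw [Finset.sum_congr rfl fun a _ => hL a, gs_sum_range N (fun a : ZMod N => ∑ u : (ZMod N)ˣ,
    (ZMod.stdAddChar ((m : ZMod N) * (u : ZMod N) +
        a ^ 2 * (u : ZMod N)⁻¹ + a * (n : ZMod N)) : ℂ)), Finset.sum_comm]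
  have hR : ∀ b ∈ (Finset.range N).filter (fun b => Nat.Coprime b N),
      (jacobiSym (b : ℤ) N : ℂ) * eF ((((b : ℤ) * (4 * m - n ^ 2) : ℤ) : ℝ) / (N : ℝ)) =
      (fun b : ZMod N => (jacobiSym (b.val : ℤ) N : ℂ) *
        ZMod.stdAddChar (b * (4 * (m : ZMod N) - (n : ZMod N) ^ 2))) (b : ZMod N) := by
    intro b hb
    rw [gs_eF]
    simp only
    rw [ZMod.val_cast_of_lt (by simpa using (Finset.mem_filter.1 hb).1)]
    push_cast
    rfl
  rw [Finset.sum_congr rfl hR, gs_sum_units N (fun b : ZMod N => (jacobiSym (b.val : ℤ) N : ℂ) *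
        ZMod.stdAddChar (b * (4 * (m : ZMod N) - (n : ZMod N) ^ 2))), Finset.mul_sum]
  have h2 : Nat.Coprime 2 N := (Nat.coprime_two_left (n := N)).2 (Nat.odd_iff.2 (by omega))
  let two : (ZMod N)ˣ := ZMod.unitOfCoprime 2 h2
  have htwo : (two : ZMod N) = 2 := by simp [two, ZMod.coe_unitOfCoprime]
  rw [← Equiv.sum_comp (Equiv.mulLeft (two * two))]
  refine Finset.sum_congr rfl fun b _ => ?_
  have hG := gsG_eq N hN (b : ZMod N).val (ZMod.val_coe_unit_coprime b)
  rw [ZMod.natCast_zmod_val] at hG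
  -- substitute a = 2 b (d) and shift
  have hbij : Function.Bijective (fun d : ZMod N => (two * b : (ZMod N)ˣ) * (d - (n : ZMod N))) := by
    have h1 : Function.Bijective (fun d : ZMod N => d - (n : ZMod N)) :=
      (Equiv.subRight (n : ZMod N)).bijective
    exact (Units.mulLeft_bijective (two * b)).comp h1
  rw [← Fintype.sum_bijective _ hbij (fun d => (ZMod.stdAddChar ((b : ZMod N) * d ^ 2) : ℂ) *
    ZMod.stdAddChar ((b : ZMod N) * (4 * (m : ZMod N) - (n : ZMod N) ^ 2)))]
  · rw [← Finset.sum_mul]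
    change gsG N b * _ = _
    rw [hG]; ring
  · intro d
    rw [← AddChar.map_add_eq_mul]
    congr 1
    have hinv : (((two * two * b : (ZMod N)ˣ)) : ZMod N)⁻¹ * (two * two * b : (ZMod N)ˣ) = 1 := by
      exact ZMod.inv_mul_of_unit _ (Units.isUnit _)
    simp only [Equiv.coe_mulLeft]
    push_cast at hinv ⊢
    rw [htwo] at hinv ⊢
    linear_combination (-(b : ZMod N) * (d - (n : ZMod N)) ^ 2) * hinv

/-- For odd positive `c`, `q` with `cq ≡ 1 (mod 4)` and integers `m`, `n`,
`∑_{a mod cq} S(m, a²; cq) e(an/(cq)) = √(cq) ∑_{b ∈ (ℤ/cqℤ)ˣ} (b|cq) e(b(4m−n²)/(cq))`. -/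
theorem statement0 (c q : ℕ) (hc : 0 < c) (hq : 0 < q) (hcodd : Odd c) (hqodd : Odd q)
    (hmod : (c * q) % 4 = 1) (m n : ℤ) :
    ∑ a ∈ Finset.range (c * q),
        kloos m ((a : ℤ) ^ 2) (c * q) * eF ((((a : ℤ) * n : ℤ) : ℝ) / ((c * q : ℕ) : ℝ))
      = (Real.sqrt (c * q) : ℂ) *
        ∑ b ∈ (Finset.range (c * q)).filter (fun b => Nat.Coprime b (c * q)),
          (jacobiSym (b : ℤ) (c * q) : ℂ) *
            eF ((((b : ℤ) * (4 * m - n ^ 2) : ℤ) : ℝ) / ((c * q : ℕ) : ℝ)) := by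
  have : NeZero (c * q) := ⟨(Nat.mul_pos hc hq).ne'⟩
  have h := gs_main (c * q) hmod m n
  rw [h, Nat.cast_mul]
end

section
/- Let q be an odd prime and c a positive integer with gcd(c, q) = 1 and cq ≡ 1 (mod 4). Let m, n be integers and set D = 4m − n². Let c₁ be the largest divisor of c coprime to D (so c₁ = 1 when D = 0) and c₂ = c/c₁. If c₁ is not squarefree, or c₂ is not powerful (i.e., some prime p divides c₂ with p² ∤ c₂), then ∑_{a mod cq} S(m, a²; cq) · e(an/(cq)) = 0. -/
open Finset

/-- The completed double sum over a finite commutative ring. -/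
noncomputable def FF (R : Type) [CommRing R] [Fintype R] [DecidableEq R] (ψ : AddChar R ℂ) (d : R) : ℂ :=
  ∑ x : Rˣ, ∑ b : R, ψ (d * x + (↑x⁻¹ : R) * b ^ 2)

lemma eF_eq (N : ℕ) [NeZero N] (k : ℤ) : eF ((k : ℝ) / (N : ℝ)) = ZMod.stdAddChar (k : ZMod N) := by
  rw [ZMod.stdAddChar_coe, eF]
  push_cast
  congr 1
  ring

lemma kloos_eq (m n : ℤ) (N : ℕ) [NeZero N] :
    kloos m n N = ∑ x : (ZMod N)ˣ, ZMod.stdAddChar ((m : ZMod N) * (x : ZMod N) + (n : ZMod N) * (↑x⁻¹ : ZMod N)) := by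
  unfold kloos
  symm
  refine Finset.sum_bij (fun x _ => (x : ZMod N).val) ?_ ?_ ?_ ?_
  · intro x _
    simp only [mem_filter, mem_range]
    exact ⟨ZMod.val_lt _, ZMod.val_coe_unit_coprime x⟩
  · intro x _ y _ h
    exact Units.ext (ZMod.val_injective N h)
  · intro b hb
    simp only [mem_filter, mem_range] at hb
    refine ⟨ZMod.unitOfCoprime b hb.2, mem_univ _, ?_⟩
    simp [ZMod.val_natCast, Nat.mod_eq_of_lt hb.1]
  · intro x _
    rw [eF_eq]
    congr 1
    push_cast
    simp

lemma main_eq (m n : ℤ) (N : ℕ) [NeZero N] (h : ZMod N) (hh : 2 * h = 1) :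
    ∑ a ∈ Finset.range N, kloos m ((a : ℤ) ^ 2) N * eF ((((a : ℤ) * n : ℤ) : ℝ) / (N : ℝ))
      = FF (ZMod N) ZMod.stdAddChar ((m : ZMod N) - n ^ 2 * h ^ 2) := by
  have h1 : ∑ a ∈ Finset.range N, kloos m ((a : ℤ) ^ 2) N * eF ((((a : ℤ) * n : ℤ) : ℝ) / (N : ℝ))
      = ∑ a : ZMod N, ∑ x : (ZMod N)ˣ,
        ZMod.stdAddChar ((m : ZMod N) * (x : ZMod N) + a ^ 2 * (↑x⁻¹ : ZMod N) + a * (n : ZMod N)) := by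
    symm
    refine Finset.sum_bij (fun a _ => a.val) ?_ ?_ ?_ ?_
    · intro a _
      simpa using ZMod.val_lt a
    · intro a _ b _ hab
      exact ZMod.val_injective N hab
    · intro b hb
      refine ⟨(b : ZMod N), mem_univ _, ?_⟩
      simp at hb
      simp [ZMod.val_natCast, Nat.mod_eq_of_lt hb]
    · intro a _
      rw [kloos_eq, eF_eq, Finset.sum_mul]
      refine Finset.sum_congr rfl fun x _ => ?_
      rw [← AddChar.map_add_eq_mul]
      congr 1
      push_cast
      simp
  rw [h1, Finset.sum_comm, FF]
  refine Finset.sum_congr rfl fun x _ => ?_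
  rw [← Equiv.sum_comp (Equiv.addRight ((n : ZMod N) * h * (x : ZMod N)))
    (fun b : ZMod N => ZMod.stdAddChar (((m : ZMod N) - (n : ZMod N) ^ 2 * h ^ 2) * (x : ZMod N) + (↑x⁻¹ : ZMod N) * b ^ 2))]
  refine Finset.sum_congr rfl fun a _ => ?_
  congr 1
  have hx : (↑x⁻¹ : ZMod N) * x = 1 := by simp
  simp only [Equiv.coe_addRight]
  linear_combination (-(n : ZMod N) * a) * hh - ((n:ZMod N) ^ 2 * h ^ 2 * x + 2 * a * n * h) * hx

lemma FF_case1 (R : Type) [CommRing R] [Fintype R] [DecidableEq R] (ψ : AddChar R ℂ)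
    (hψ : ψ.IsPrimitive) (d M : R) (hM : M ^ 2 = 0) (hd : 2 * d * M ≠ 0) : FF R ψ d = 0 := by
  have key : ∀ s : R, FF R ψ d =
      ∑ x : Rˣ, ∑ b : R, ψ (d * x + (↑x⁻¹ : R) * b ^ 2) * ψ (2 * d * M * x * s) := by
    intro s
    let w : Rˣ := ⟨1 + M * s, 1 - M * s, by linear_combination (-s ^ 2) * hM,
      by linear_combination (-s ^ 2) * hM⟩
    have hw : (w : R) = 1 + M * s := rfl
    unfold FF
    rw [← Equiv.sum_comp (Equiv.mulRight (w ^ 2))]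
    refine Finset.sum_congr rfl fun x _ => ?_
    rw [← Equiv.sum_comp (Units.mulRight w)]
    refine Finset.sum_congr rfl fun b _ => ?_
    rw [← AddChar.map_add_eq_mul]
    congr 1
    have hww : (↑w⁻¹ : R) * w = 1 := by simp
    have h2 : (↑w⁻¹ : R) ^ 2 * w ^ 2 = 1 := by rw [← mul_pow, hww, one_pow]
    simp only [Equiv.coe_mulRight, Units.mulRight_apply, mul_inv, Units.val_mul, Units.val_pow_eq_pow_val]
    rw [← inv_pow, Units.val_pow_eq_pow_val]
    have h3 : (w : R) ^ 2 = 1 + 2 * M * s := by rw [hw]; linear_combination s ^ 2 * hM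
    linear_combination (↑x⁻¹ * b ^ 2) * h2 + d * x * h3
  have h1 : ∑ s : R, FF R ψ d = 0 := by
    rw [Finset.sum_congr rfl fun s _ => key s, Finset.sum_comm]
    refine Finset.sum_eq_zero fun x _ => ?_
    rw [Finset.sum_comm]
    refine Finset.sum_eq_zero fun b _ => ?_
    rw [← Finset.mul_sum]
    have : ∑ s : R, ψ (2 * d * M * x * s) = 0 := by
      have hne : 2 * d * M * (x : R) ≠ 0 := by
        intro h0
        exact hd ((Units.mul_left_eq_zero x).1 h0)
      have := AddChar.sum_eq_zero_of_ne_one (hψ hne)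
      simpa [AddChar.mulShift_apply] using this
    rw [this, mul_zero]
  rw [Finset.sum_const, nsmul_eq_mul] at h1
  rcases mul_eq_zero.1 h1 with h | h
  · exfalso
    have : (Fintype.card R : ℂ) ≠ 0 := by
      exact_mod_cast Fintype.card_ne_zero
    exact this h
  · exact h

lemma FF_field (K : Type) [Field K] [Fintype K] [DecidableEq K] (ψ : AddChar K ℂ)
    (hψ : ψ ≠ 1) : FF K ψ 0 = 0 := by
  unfold FF
  have hu : ∀ f : K → ℂ, ∑ x : Kˣ, f x = ∑ y : K, f y - f 0 := by
    intro f
    rw [← Finset.sum_erase_eq_sub (mem_univ 0)]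
    refine Finset.sum_bij (fun x _ => (x : K)) ?_ ?_ ?_ ?_
    · intro x _
      simp
    · intro x _ y _ h
      exact Units.ext h
    · intro b hb
      exact ⟨Units.mk0 b (by simpa using hb), mem_univ _, rfl⟩
    · intro x _
      rfl
  have hp : ψ.IsPrimitive := AddChar.IsPrimitive.of_ne_one hψ
  rw [Finset.sum_comm]
  have h1 : ∀ b : K, ∑ x : Kˣ, ψ (0 * (x : K) + (↑x⁻¹ : K) * b ^ 2)
      = (if b = 0 then (Fintype.card K : ℂ) else 0) - 1 := by
    intro b
    rw [← Equiv.sum_comp (Equiv.inv Kˣ)]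
    simp only [Equiv.inv_apply, inv_inv, zero_mul, zero_add]
    rw [hu (fun y => ψ (y * b ^ 2)), AddChar.sum_mulShift _ hp]
    simp
  rw [Finset.sum_congr rfl fun b _ => h1 b]
  simp

lemma FF_prod (A B : Type) [CommRing A] [Fintype A] [DecidableEq A] [CommRing B] [Fintype B]
    [DecidableEq B] (ψ : AddChar (A × B) ℂ) (φ : AddChar A ℂ) (χ : AddChar B ℂ)
    (h : ∀ a b, ψ (a, b) = φ a * χ b) (d : A × B) :
    FF (A × B) ψ d = FF A φ d.1 * FF B χ d.2 := by
  unfold FF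
  rw [← (MulEquiv.prodUnits (M := A) (N := B)).symm.toEquiv.sum_comp, Fintype.sum_prod_type,
    Finset.sum_mul_sum]
  refine Finset.sum_congr rfl fun x _ => Finset.sum_congr rfl fun y _ => ?_
  rw [Fintype.sum_prod_type, Finset.sum_mul_sum]
  refine Finset.sum_congr rfl fun a _ => Finset.sum_congr rfl fun b _ => ?_
  rw [← h]
  rfl

lemma FF_equiv (R S : Type) [CommRing R] [Fintype R] [DecidableEq R] [CommRing S] [Fintype S]
    [DecidableEq S] (e : S ≃+* R) (ψ : AddChar R ℂ) (d : S) :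
    FF S (ψ.compAddMonoidHom e.toAddMonoidHom) d = FF R ψ (e d) := by
  unfold FF
  rw [← (Units.mapEquiv e.toMulEquiv).toEquiv.sum_comp]
  refine Finset.sum_congr rfl fun x _ => ?_
  rw [← e.toEquiv.sum_comp]
  refine Finset.sum_congr rfl fun b _ => ?_
  simp [← map_inv]

lemma FF_case2 (p M : ℕ) [NeZero (p * M)] [Fact p.Prime] [NeZero M] (hpM : Nat.Coprime p M)
    (d : ZMod (p * M)) (hd : (ZMod.chineseRemainder hpM d).1 = 0) :
    FF (ZMod (p * M)) ZMod.stdAddChar d = 0 := by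
  let e := ZMod.chineseRemainder hpM
  let ψ' : AddChar (ZMod p × ZMod M) ℂ := (ZMod.stdAddChar (N := p * M)).compAddMonoidHom e.symm.toAddMonoidHom
  have h0 : FF (ZMod (p * M)) ZMod.stdAddChar d = FF (ZMod p × ZMod M) ψ' (e d) := by
    rw [FF_equiv]; simp
  rw [h0, FF_prod _ _ ψ' (ψ'.compAddMonoidHom (AddMonoidHom.inl _ _))
    (ψ'.compAddMonoidHom (AddMonoidHom.inr _ _))]
  · have : (e d).1 = 0 := hd
    rw [this, FF_field, zero_mul]
    intro h1
    have h2 := DFunLike.congr_fun h1 1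
    have h3 : ZMod.stdAddChar (e.symm (1, 0)) = (1 : ℂ) := by
      simpa [ψ'] using h2
    have h4 : e.symm (1, 0) = 0 := by
      apply ZMod.injective_stdAddChar
      rw [h3]; simp
    rw [map_eq_zero_iff _ e.symm.injective] at h4
    simp at h4
  · intro a b
    simp only [AddChar.compAddMonoidHom_apply]
    rw [← AddChar.map_add_eq_mul]
    simp

/-- With `D = 4m − n²`, `c₁` the largest divisor of `c` coprime to `D` and
`c₂ = c/c₁`, if `c₁` is not squarefree or `c₂` is not powerful, then
`∑_{a mod cq} S(m, a²; cq) e(an/(cq)) = 0`. -/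
theorem statement2 (q : ℕ) (hq : q.Prime) (hqodd : Odd q) (c : ℕ) (hc : 0 < c)
    (hcq : Nat.Coprime c q) (hmod : (c * q) % 4 = 1) (m n : ℤ) (D : ℤ) (hD : D = 4 * m - n ^ 2)
    (c₁ c₂ : ℕ) (hc₁div : c₁ ∣ c) (hc₁cop : IsCoprime (c₁ : ℤ) D)
    (hc₁max : ∀ d : ℕ, d ∣ c → IsCoprime (d : ℤ) D → d ≤ c₁)
    (hc₂ : c₂ = c / c₁)
    (hbad : ¬ Squarefree c₁ ∨ ∃ p : ℕ, p.Prime ∧ p ∣ c₂ ∧ ¬ p ^ 2 ∣ c₂) :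
    ∑ a ∈ Finset.range (c * q),
        kloos m ((a : ℤ) ^ 2) (c * q) * eF ((((a : ℤ) * n : ℤ) : ℝ) / ((c * q : ℕ) : ℝ))
      = 0 := by
  subst hD
  have hq0 : 0 < q := hq.pos
  have hN0 : 0 < c * q := Nat.mul_pos hc hq0
  generalize hN : c * q = N at *
  haveI : NeZero N := ⟨hN0.ne'⟩
  have hh : 2 * (((N + 1) / 2 : ℕ) : ZMod N) = 1 := by
    have h1 : 2 * ((N + 1) / 2) = N + 1 := by omega
    have h2 := congrArg (Nat.cast : ℕ → ZMod N) h1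
    push_cast at h2
    simpa using h2
  rw [main_eq m n N _ hh]
  generalize (((N + 1) / 2 : ℕ) : ZMod N) = h at hh
  have h4 : 4 * ((m : ZMod N) - n ^ 2 * h ^ 2) = ((4 * m - n ^ 2 : ℤ) : ZMod N) := by
    push_cast
    linear_combination (-(n : ZMod N) ^ 2 * (2 * h + 1)) * hh
  generalize (m : ZMod N) - n ^ 2 * h ^ 2 = d at h4
  generalize 4 * m - n ^ 2 = D at *
  rcases hbad with hsq | ⟨p, hp, hpc, hpc2⟩
  · rw [Nat.squarefree_iff_prime_squarefree] at hsq
    push Not at hsq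
    obtain ⟨p, hp, hpp⟩ := hsq
    have hpD : ¬ (p : ℤ) ∣ D := by
      intro hdvd
      have h1 : (p : ℤ) ∣ c₁ := by exact_mod_cast (Dvd.intro p rfl).trans hpp
      have := hc₁cop.isUnit_of_dvd' h1 hdvd
      rw [Int.isUnit_iff] at this
      have := hp.two_le
      omega
    obtain ⟨k, hk⟩ : p * p ∣ N := (hpp.trans hc₁div).trans ⟨q, hN.symm⟩
    apply FF_case1 _ _ (ZMod.isPrimitive_stdAddChar N) d ((p * k : ℕ) : ZMod N)
    · rw [← Nat.cast_pow, ZMod.natCast_eq_zero_iff]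
      exact ⟨k, by rw [hk]; ring⟩
    · intro h0
      have h5 : ((D * (p * k : ℕ) : ℤ) : ZMod N) = 0 := by
        push_cast at h0 ⊢
        rw [← h4]
        linear_combination 2 * h0
      rw [ZMod.intCast_zmod_eq_zero_iff_dvd] at h5
      have hpk : ((p * k : ℕ) : ℤ) ≠ 0 := by
        intro h6
        have : p * k = 0 := by exact_mod_cast h6
        rw [mul_assoc, this] at hk
        omega
      apply hpD
      apply Int.dvd_of_mul_dvd_mul_right hpk
      rw [hk] at h5
      rw [mul_assoc] at h5
      push_cast at h5 ⊢
      exact h5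
  · have hcc : c = c₁ * c₂ := by rw [hc₂, Nat.mul_div_cancel' hc₁div]
    have hc₁pos : 0 < c₁ := Nat.pos_of_dvd_of_pos hc₁div hc
    have hpD : (p : ℤ) ∣ D := by
      by_contra hnd
      have h1 : IsCoprime (p : ℤ) D :=
        (Prime.coprime_iff_not_dvd (Nat.prime_iff_prime_int.1 hp)).2 hnd
      have h2 := hc₁max (c₁ * p) (by rw [hcc]; exact Nat.mul_dvd_mul_left _ hpc)
        (by push_cast; exact hc₁cop.mul_left h1)
      have := hp.two_le
      nlinarith
    have hpc₁ : ¬ p ∣ c₁ := by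
      intro hdvd
      have h1 : (p : ℤ) ∣ c₁ := by exact_mod_cast hdvd
      have := hc₁cop.isUnit_of_dvd' h1 hpD
      rw [Int.isUnit_iff] at this
      have := hp.two_le
      omega
    obtain ⟨k, hk⟩ := hpc
    have hpk : ¬ p ∣ k := by
      rintro ⟨j, rfl⟩
      exact hpc2 ⟨j, by rw [hk]; ring⟩
    have hpq : ¬ p ∣ q := by
      intro hdvd
      have h1 : p ∣ c := by rw [hcc, hk]; exact ⟨c₁ * k, by ring⟩
      have := Nat.dvd_gcd h1 hdvd
      rw [hcq] at this
      exact hp.one_lt.ne' (Nat.dvd_one.1 this)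
    have hNM : N = p * (c₁ * k * q) := by rw [← hN, hcc, hk]; ring
    have hpM : ¬ p ∣ c₁ * k * q := by
      rw [hp.dvd_mul, hp.dvd_mul]
      tauto
    generalize c₁ * k * q = M at hNM hpM
    subst hNM
    haveI : Fact p.Prime := ⟨hp⟩
    haveI : NeZero M := ⟨by rintro rfl; simp at hpM⟩
    have hcop : Nat.Coprime p M := (Nat.Prime.coprime_iff_not_dvd hp).2 hpM
    apply FF_case2 p M hcop
    have h5 := congrArg (fun z => (ZMod.chineseRemainder hcop z).1) h4
    have h6 := congrArg (fun z => (ZMod.chineseRemainder hcop z).1) hh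
    simp only [map_mul, map_intCast, map_ofNat, map_one, Prod.fst_mul, Prod.fst_intCast,
      Prod.fst_ofNat, Prod.fst_one] at h5 h6
    rw [(ZMod.intCast_zmod_eq_zero_iff_dvd D p).2 hpD] at h5
    generalize (ZMod.chineseRemainder hcop d).1 = u at *
    generalize (ZMod.chineseRemainder hcop h).1 = v at *
    linear_combination v ^ 2 * h5 - u * (2 * v + 1) * h6
end

section
/- Fix an even integer k ≥ 4. There exists a complex constant c_k ≠ 0 depending only on k, and a constant C = C(k), such that for every y > 0 one has |W(y) − c_k| ≤ C · y^{1/4}. -/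
/-- `γ(s) = (2π)^{−s} Γ(s + (k−1)/2)`. -/
noncomputable def gammaW (k : ℕ) (s : ℂ) : ℂ :=
  (2 * Real.pi : ℂ) ^ (-s) * Complex.Gamma (s + ((k : ℂ) - 1) / 2)

/-- `W(y)`, the contour integral over `Re(s) = 2` of `γ(1/2+s)/γ(1/2) y^{−s} ds/(2πis)`. -/
noncomputable def Wfun (k : ℕ) (y : ℝ) : ℂ :=
  (1 / (2 * Real.pi)) *
    ∫ t : ℝ,
      (gammaW k (5 / 2 + t * Complex.I) / gammaW k (1 / 2)) *
        (y : ℂ) ^ (-(2 + t * Complex.I)) / (2 + t * Complex.I)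

open Complex MeasureTheory Set in
theorem hasMellin_pow_exp (n : ℕ) (s : ℂ) (hs : 0 < s.re) :
    HasMellin (fun t : ℝ => (t : ℂ) ^ (n : ℂ) • ((Real.exp (-t) : ℝ) : ℂ)) s
      (Complex.Gamma (s + n)) := by
  have hs' : 0 < (s + n).re := by
    simp only [add_re, natCast_re]; positivity
  refine ⟨?_, ?_⟩
  · rw [MellinConvergent.cpow_smul]
    have := Complex.GammaIntegral_convergent hs'
    unfold MellinConvergent
    refine this.congr_fun (fun t _ => ?_) measurableSet_Ioi
    simp [mul_comm]
  · rw [mellin_cpow_smul, Complex.Gamma_eq_integral hs', Complex.GammaIntegral, mellin]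
    refine setIntegral_congr_fun measurableSet_Ioi (fun t _ => ?_)
    simp [mul_comm]

/-- `gq n t = n! e^{-t} ∑_{j ≤ n} t^j / j!`, defined recursively. -/
noncomputable def gq : ℕ → ℝ → ℂ
  | 0 => fun t => (t : ℂ) ^ ((0 : ℕ) : ℂ) • ((Real.exp (-t) : ℝ) : ℂ)
  | (n + 1) => fun t => ((n + 1 : ℕ) : ℂ) • gq n t +
      (t : ℂ) ^ ((n + 1 : ℕ) : ℂ) • ((Real.exp (-t) : ℝ) : ℂ)

theorem hasMellin_gq (n : ℕ) (s : ℂ) (hs : 0 < s.re) :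
    HasMellin (gq n) s (Complex.Gamma (s + n + 1) / s) := by
  have hs0 : s ≠ 0 := by rintro rfl; simp at hs
  induction n with
  | zero =>
    have h := hasMellin_pow_exp 0 s hs
    have e : Complex.Gamma (s + (0 : ℕ) + 1) / s = Complex.Gamma (s + (0 : ℕ)) := by
      simp [Complex.Gamma_add_one s hs0, hs0]
    rw [e]; exact h
  | succ n ih =>
    have h := hasMellin_pow_exp (n + 1) s hs
    have h2 := hasMellin_const_smul ih.1 (((n + 1 : ℕ) : ℂ))
    have h3 := hasMellin_add h2.1 h.1
    refine ⟨h3.1, ?_⟩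
    refine h3.2.trans ?_
    rw [h2.2, h.2, ih.2]
    have hne : s + (n + 1 : ℕ) ≠ 0 := by
      intro h0
      have := congrArg Complex.re h0
      simp only [Complex.add_re, Complex.natCast_re, Complex.zero_re] at this
      have : (0 : ℝ) < s.re + (n + 1 : ℕ) := by positivity
      linarith
    rw [Complex.Gamma_add_one _ hne]
    push_cast
    rw [show s + (n : ℂ) + 1 = s + (n + 1) by ring]
    simp only [smul_eq_mul]
    field_simp
    ring

theorem gq_eq (n : ℕ) (t : ℝ) :
    gq n t = (((n.factorial : ℝ) * (Real.exp (-t) *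
      ∑ j ∈ Finset.range (n + 1), t ^ j / (j.factorial : ℝ)) : ℝ) : ℂ) := by
  induction n with
  | zero => simp [gq]
  | succ n ih =>
    rw [Finset.sum_range_succ]
    simp only [gq, ih, Complex.cpow_natCast, smul_eq_mul]
    have : ((n + 1).factorial : ℂ) ≠ 0 := by exact_mod_cast (n + 1).factorial_ne_zero
    push_cast
    rw [mul_add, mul_add]
    congr 1
    · rw [Nat.factorial_succ]; push_cast; ring
    · field_simp

theorem gq_cont (n : ℕ) : Continuous (gq n) := by
  rw [show gq n = _ from funext (gq_eq n)]
  fun_prop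

theorem norm_Gamma_le_aux (z : ℂ) (hz : 0 < z.re) :
    ‖Complex.Gamma z‖ ≤ Real.Gamma z.re := by
  rw [Complex.Gamma_eq_integral hz, Real.Gamma_eq_integral hz, Complex.GammaIntegral]
  refine (MeasureTheory.norm_integral_le_integral_norm _).trans (le_of_eq ?_)
  refine MeasureTheory.setIntegral_congr_fun measurableSet_Ioi (fun t ht => ?_)
  have ht : 0 < t := ht
  simp only [norm_mul]
  rw [Complex.norm_cpow_eq_rpow_re_of_pos ht, Complex.norm_of_nonneg (Real.exp_pos _).le]
  simp

theorem vert_gq (n : ℕ) : Complex.VerticalIntegrable (mellin (gq n)) 2 := by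
  unfold Complex.VerticalIntegrable
  have e : (fun y : ℝ => mellin (gq n) (((2 : ℝ) : ℂ) + y * Complex.I)) =
      fun y : ℝ => Complex.Gamma (((2 : ℝ) : ℂ) + y * Complex.I + n + 1) /
        (((2 : ℝ) : ℂ) + y * Complex.I) := by
    funext y
    exact (hasMellin_gq n _ (by simp)).2
  rw [e]
  refine MeasureTheory.Integrable.mono' (integrable_inv_one_add_sq.const_mul
    (Real.Gamma (n + 4))) ?_ ?_
  · refine Continuous.aestronglyMeasurable ?_
    rw [continuous_iff_continuousAt]
    intro y
    refine ContinuousAt.div ?_ (by fun_prop) ?_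
    · refine ContinuousAt.comp (f := fun y : ℝ => ((2 : ℝ) : ℂ) + y * Complex.I + n + 1)
        (g := Complex.Gamma) ?_ (by fun_prop)
      refine (Complex.differentiableAt_Gamma _ ?_).continuousAt
      intro m h
      have := congrArg Complex.re h
      simp at this
      have h1 : (0 : ℝ) ≤ n := by positivity
      have h2 : (0 : ℝ) ≤ m := by positivity
      linarith
    · intro h
      have := congrArg Complex.re h
      simp at this
  · refine Filter.Eventually.of_forall (fun y => ?_)
    set z : ℂ := ((2 : ℝ) : ℂ) + y * Complex.I + n + 1 with hz
    set w : ℂ := ((2 : ℝ) : ℂ) + y * Complex.I with hw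
    have hzre : z.re = n + 3 := by simp [hz, hw]; ring
    have hzim : z.im = y := by simp [hz, hw]
    have hwre : w.re = 2 := by simp [hw]
    have hwim : w.im = y := by simp [hw]
    have hn : (0 : ℝ) ≤ n := by positivity
    have hz0 : z ≠ 0 := by
      intro h; rw [h] at hzre; simp at hzre; linarith
    have hG := norm_Gamma_le_aux (z + 1) (by simp [hzre]; positivity)
    rw [Complex.Gamma_add_one z hz0, norm_mul] at hG
    have hre : (z + 1).re = n + 4 := by simp [hzre]; ring
    rw [hre] at hG
    have hb : ∀ u : ℂ, 1 ≤ u.re → u.im = y → Real.sqrt (1 + y ^ 2) ≤ ‖u‖ := by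
      intro u h1 h2
      rw [← Real.sqrt_sq (norm_nonneg u), Complex.sq_norm, Complex.normSq_apply, h2]
      apply Real.sqrt_le_sqrt
      nlinarith
    have b1 := hb z (by linarith) hzim
    have b2 := hb w (by linarith) hwim
    have hpos : 0 < Real.sqrt (1 + y ^ 2) := by positivity
    have hsq : Real.sqrt (1 + y ^ 2) * Real.sqrt (1 + y ^ 2) = 1 + y ^ 2 :=
      Real.mul_self_sqrt (by positivity)
    rw [norm_div, ← div_eq_mul_inv, div_le_div_iff₀ (hpos.trans_le b2) (by positivity), ← hsq]
    calc ‖Complex.Gamma z‖ * (Real.sqrt (1 + y ^ 2) * Real.sqrt (1 + y ^ 2))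
        ≤ ‖Complex.Gamma z‖ * (‖z‖ * ‖w‖) := by gcongr
      _ = (‖z‖ * ‖Complex.Gamma z‖) * ‖w‖ := by ring
      _ ≤ _ := by gcongr

theorem Wfun_eq (n : ℕ) (y : ℝ) (hy : 0 < y) :
    Wfun (2 * (n + 1)) y = gq n (2 * Real.pi * y) / (n.factorial : ℂ) := by
  have hx : 0 < 2 * Real.pi * y := by positivity
  have h := mellinInv_mellin_eq 2 (gq n) hx
    (hasMellin_gq n _ (by simp)).1 (vert_gq n) (gq_cont n).continuousAt
  rw [← h, mellinInv, Wfun, Complex.real_smul, mul_div_assoc, ← MeasureTheory.integral_div]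
  push_cast
  congr 1
  congr 1
  funext t
  have hm := (hasMellin_gq n (2 + t * Complex.I) (by simp)).2
  rw [hm]
  simp only [gammaW, smul_eq_mul]
  have hp : (2 * Real.pi : ℂ) ≠ 0 := by
    simp [Real.pi_ne_zero]
  have e1 : ((2 : ℂ) * Real.pi * y) ^ (-(2 + t * Complex.I)) =
      (2 * Real.pi : ℂ) ^ (-(2 + t * Complex.I)) * (y : ℂ) ^ (-(2 + t * Complex.I)) := by
    have := Complex.mul_cpow_ofReal_nonneg (a := 2 * Real.pi) (b := y) (by positivity) hy.le
      (-(2 + t * Complex.I))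
    push_cast at this
    exact this
  have e2 : (2 * Real.pi : ℂ) ^ (-(5 / 2 + t * Complex.I)) =
      (2 * Real.pi : ℂ) ^ (-(2 + t * Complex.I)) * (2 * Real.pi : ℂ) ^ (-(1 / 2 : ℂ)) := by
    rw [← Complex.cpow_add _ _ hp]; congr 1; ring
  have e3 : (1 / 2 : ℂ) + (((2 * (n + 1) : ℕ) : ℂ) - 1) / 2 = (n : ℂ) + 1 := by
    push_cast; ring
  have e4 : (5 / 2 + t * Complex.I : ℂ) + (((2 * (n + 1) : ℕ) : ℂ) - 1) / 2 =
      2 + t * Complex.I + n + 1 := by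
    push_cast; ring
  rw [e1, e2, e3, e4, Complex.Gamma_nat_eq_factorial]
  have hp2 : (2 * Real.pi : ℂ) ^ (-(1 / 2 : ℂ)) ≠ 0 := by
    rw [Complex.cpow_ne_zero_iff]; exact Or.inl hp
  have hf : (n.factorial : ℂ) ≠ 0 := by exact_mod_cast n.factorial_ne_zero
  have hs0 : (2 + t * Complex.I : ℂ) ≠ 0 := by
    intro h
    have := congrArg Complex.re h
    simp at this
  field_simp

theorem tail_bound (n : ℕ) (x : ℝ) (hx : 0 < x) :
    |Real.exp (-x) * ∑ j ∈ Finset.range (n + 1), x ^ j / (j.factorial : ℝ) - 1|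
      ≤ x ^ ((1 : ℝ) / 4) := by
  set S := ∑ j ∈ Finset.range (n + 1), x ^ j / (j.factorial : ℝ) with hS
  have h1 : S ≤ Real.exp x := Real.sum_le_exp_of_nonneg hx.le _
  have h2 : 1 ≤ S := by
    rw [hS, Finset.sum_range_succ']
    have : 0 ≤ ∑ j ∈ Finset.range n, x ^ (j + 1) / ((j + 1).factorial : ℝ) :=
      Finset.sum_nonneg (fun j _ => by positivity)
    simp; exact this
  have he : 0 < Real.exp (-x) := Real.exp_pos _
  have h3 : Real.exp (-x) * S ≤ 1 := by
    calc _ ≤ Real.exp (-x) * Real.exp x := by gcongr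
      _ = 1 := by rw [← Real.exp_add]; simp
  have h4 : Real.exp (-x) ≤ Real.exp (-x) * S := le_mul_of_one_le_right he.le h2
  have h5 : 1 - x ≤ Real.exp (-x) := Real.one_sub_le_exp_neg x
  rw [abs_of_nonpos (by linarith)]
  rcases le_total x 1 with h | h
  · have := Real.rpow_le_rpow_of_exponent_ge hx h (show (1 : ℝ) / 4 ≤ 1 by norm_num)
    rw [Real.rpow_one] at this
    linarith
  · have := Real.one_le_rpow h (show (0 : ℝ) ≤ 1 / 4 by norm_num)
    linarith

/-- There is a constant `c_k ≠ 0` depending only on `k` with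
`W(y) = c_k + O_k(y^{1/4})`. -/
theorem statement8 (k : ℕ) (hk : Even k) (hk4 : 4 ≤ k) :
    ∃ c : ℂ, c ≠ 0 ∧
      ∃ C : ℝ, ∀ y : ℝ, 0 < y →
        ‖Wfun k y - c‖ ≤ C * y ^ ((1 : ℝ) / 4) := by
  obtain ⟨n, rfl⟩ : ∃ n, k = 2 * (n + 1) := by
    obtain ⟨m, hm⟩ := hk
    exact ⟨m - 1, by omega⟩
  refine ⟨1, one_ne_zero, (2 * Real.pi) ^ ((1 : ℝ) / 4), fun y hy => ?_⟩
  rw [← Real.mul_rpow (by positivity) hy.le, Wfun_eq n y hy, gq_eq]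
  refine le_trans (le_of_eq ?_) (tail_bound n (2 * Real.pi * y) (by positivity))
  have hf : (n.factorial : ℂ) ≠ 0 := by exact_mod_cast n.factorial_ne_zero
  rw [← Real.norm_eq_abs, ← Complex.norm_real]
  congr 1
  rw [Complex.ofReal_mul, Complex.ofReal_natCast, mul_div_cancel_left₀ _ hf]
  push_cast
  rfl
end

section
/- Fix an even integer k > 1000, a real ε > 0, and smooth functions 𝒱, 𝒲 : ℝ → ℝ supported in [1,2]. There exists a constant C = C(k, ε, 𝒱, 𝒲) such that for every prime q and all reals N, M ≥ 1, (NM)^{−1/2} · |∑_{n=1}^∞ ∑_{m=1}^∞ 𝒱(n/N) 𝒲(m/M) ∑_{c=1}^∞ [S(m, n²; cq)/(cq)] · J_{k−1}(4πn√m/(cq))| ≤ C · q^ε · N M^{3/4} / q, the triple sum converging absolutely. -/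
/-- Bessel function of the first kind of integer order:
`J_ν(x) = (1/π) ∫₀^π cos(νθ − x sin θ) dθ`. -/
noncomputable def besselJ (ν : ℕ) (x : ℝ) : ℝ :=
  (1 / Real.pi) * ∫ θ in (0 : ℝ)..Real.pi, Real.cos (ν * θ - x * Real.sin θ)




open MeasureTheory in
/-- The complex Bessel integral. -/
noncomputable def bE (ν : ℤ) (x : ℝ) : ℂ :=
  ∫ θ in (-Real.pi)..Real.pi, Complex.exp (Complex.I * (ν * θ)) *
    Complex.exp (-(Complex.I * (x * Real.sin θ)))

lemma besselJ_eq_bE (ν : ℕ) (x : ℝ) : (besselJ ν x : ℂ) = (1 / (2 * Real.pi)) * bE ν x := by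
  unfold besselJ bE
  have hc : Continuous fun θ : ℝ => Complex.exp (Complex.I * (((ν:ℤ):ℂ) * θ)) *
    Complex.exp (-(Complex.I * (x * Real.sin θ))) := by fun_prop
  rw [← intervalIntegral.integral_add_adjacent_intervals (b := 0)
    (hc.intervalIntegrable _ _) (hc.intervalIntegrable _ _)]
  have h1 := intervalIntegral.integral_comp_neg (a := 0) (b := Real.pi)
    (fun θ : ℝ => Complex.exp (Complex.I * (((ν:ℤ):ℂ) * θ)) *
    Complex.exp (-(Complex.I * (x * Real.sin θ))))
  rw [neg_zero] at h1
  rw [← h1, ← intervalIntegral.integral_add]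
  · push_cast
    rw [← intervalIntegral.integral_ofReal]
    have : ∀ θ : ℝ, Complex.exp (Complex.I * ((ν:ℂ) * -(θ:ℂ))) *
        Complex.exp (-(Complex.I * (x * Complex.sin (-(θ:ℂ))))) +
        Complex.exp (Complex.I * ((ν:ℂ) * (θ:ℂ))) *
        Complex.exp (-(Complex.I * (x * Complex.sin ((θ:ℂ))))) =
        2 * ((Real.cos (ν * θ - x * Real.sin θ) : ℝ) : ℂ) := by
      intro θ
      push_cast
      rw [Complex.cos, ← Complex.exp_add, ← Complex.exp_add, Complex.sin_neg]
      rw [mul_div_cancel₀ _ (two_ne_zero), add_comm]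
      congr 2 <;> ring
    simp_rw [this]
    rw [intervalIntegral.integral_const_mul]
    have : (Real.pi : ℂ) ≠ 0 := by exact_mod_cast Real.pi_ne_zero
    field_simp
  · exact (hc.comp continuous_neg).intervalIntegrable _ _
  · exact hc.intervalIntegrable _ _

lemma bE_rec (ν : ℤ) (hν : ν ≠ 0) (x : ℝ) :
    bE ν x = (x / (2 * ν)) * (bE (ν + 1) x + bE (ν - 1) x) := by
  unfold bE
  have hcont : ∀ μ : ℤ, Continuous fun θ : ℝ => Complex.exp (Complex.I * ((μ:ℂ) * θ)) *
    Complex.exp (-(Complex.I * (x * Real.sin θ))) := fun μ => by fun_prop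
  rw [← intervalIntegral.integral_add ((hcont _).intervalIntegrable _ _)
    ((hcont _).intervalIntegrable _ _), ← intervalIntegral.integral_const_mul, ← sub_eq_zero,
    ← intervalIntegral.integral_sub ((hcont _).intervalIntegrable _ _)]
  swap
  · apply Continuous.intervalIntegrable; fun_prop
  have hνc : (ν : ℂ) ≠ 0 := by exact_mod_cast hν
  set G : ℝ → ℂ := fun θ => (1 / (Complex.I * ν)) * (Complex.exp (Complex.I * ((ν:ℂ) * θ)) *
    Complex.exp (-(Complex.I * (x * Real.sin θ)))) with hG
  have hd : ∀ θ : ℝ, HasDerivAt G (Complex.exp (Complex.I * (ν * θ)) *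
    Complex.exp (-(Complex.I * (x * Real.sin θ))) - x / (2 * ν) *
      (Complex.exp (Complex.I * ((ν + 1 : ℤ) * θ)) *
    Complex.exp (-(Complex.I * (x * Real.sin θ))) + Complex.exp (Complex.I * ((ν - 1 : ℤ) * θ)) *
    Complex.exp (-(Complex.I * (x * Real.sin θ))))) θ := by
    intro θ
    have h1 : HasDerivAt (fun θ : ℝ => Complex.I * ((ν:ℂ) * θ)) (Complex.I * (ν * 1)) θ :=
      ((Complex.ofRealCLM.hasDerivAt (x := θ)).const_mul _).const_mul _
    have h2 : HasDerivAt (fun θ : ℝ => -(Complex.I * (x * (Real.sin θ : ℝ))))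
        (-(Complex.I * ((x:ℂ) * (Real.cos θ : ℝ)))) θ :=
      (((Real.hasDerivAt_sin θ).ofReal_comp.const_mul _).const_mul _).neg
    have h3 := ((h1.cexp.mul h2.cexp).const_mul (1 / (Complex.I * ν)))
    refine h3.congr_deriv ?_
    have e1 : Complex.exp (Complex.I * ((ν + 1 : ℤ) * θ)) =
      Complex.exp (Complex.I * (ν * θ)) * Complex.exp (θ * Complex.I) := by
      rw [← Complex.exp_add]; congr 1; push_cast; ring
    have e2 : Complex.exp (Complex.I * ((ν - 1 : ℤ) * θ)) =
      Complex.exp (Complex.I * (ν * θ)) * Complex.exp (-θ * Complex.I) := by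
      rw [← Complex.exp_add]; congr 1; push_cast; ring
    rw [e1, e2, Complex.ofReal_cos, Complex.cos]
    have hI := Complex.I_ne_zero
    field_simp
    ring
  rw [intervalIntegral.integral_eq_sub_of_hasDerivAt (f := G) (fun θ _ => hd θ)]
  · simp only [hG]
    rw [sub_eq_zero]
    congr 1
    simp only [Real.sin_pi, Real.sin_neg, neg_zero]
    congr 1
    rw [Complex.exp_eq_exp_iff_exists_int]
    refine ⟨ν, ?_⟩
    push_cast; ring
  · apply Continuous.intervalIntegrable; fun_prop

lemma bE_rep (A : ℕ) : ∀ ν : ℤ, (A : ℤ) ≤ ν → ∃ g : ℝ → ℂ, Continuous g ∧ ∀ x : ℝ,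
    bE ν x = x ^ A * ∫ θ in (-Real.pi)..Real.pi, g θ *
      Complex.exp (-(Complex.I * (x * Real.sin θ))) := by
  induction A with
  | zero =>
    intro ν _
    exact ⟨fun θ => Complex.exp (Complex.I * (ν * θ)), by fun_prop, fun x => by simp [bE]⟩
  | succ A ih =>
    intro ν hν
    obtain ⟨g1, hg1, h1⟩ := ih (ν + 1) (by push_cast at hν; omega)
    obtain ⟨g2, hg2, h2⟩ := ih (ν - 1) (by push_cast at hν; omega)
    refine ⟨fun θ => (1 / (2 * ν)) * (g1 θ + g2 θ), by fun_prop, fun x => ?_⟩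
    rw [bE_rec ν (by push_cast at hν; omega), h1, h2, ← mul_add,
      ← intervalIntegral.integral_add]
    · have : ∀ θ : ℝ, (1 / (2 * ν)) * (g1 θ + g2 θ) *
          Complex.exp (-(Complex.I * (x * Real.sin θ))) = (1 / (2 * ν)) *
          (g1 θ * Complex.exp (-(Complex.I * (x * Real.sin θ))) + g2 θ *
            Complex.exp (-(Complex.I * (x * Real.sin θ)))) := fun θ => by ring
      simp_rw [this]
      rw [intervalIntegral.integral_const_mul]
      ring
    · apply Continuous.intervalIntegrable; fun_prop
    · apply Continuous.intervalIntegrable; fun_prop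

/-- Transfer: bounds for exponential sums give bounds for Bessel sums. -/
lemma bessel_transfer (A ν : ℕ) (h : A ≤ ν) : ∃ K : ℝ, 0 ≤ K ∧
    ∀ (ι : Type) (s : Finset ι) (a : ι → ℂ) (x : ι → ℝ) (B : ℝ),
      (∀ σ : ℝ, |σ| ≤ 1 → ‖∑ i ∈ s, a i * ((x i : ℂ) ^ A *
        Complex.exp (-(Complex.I * (x i * σ))))‖ ≤ B) →
      ‖∑ i ∈ s, a i * (besselJ ν (x i) : ℂ)‖ ≤ K * B := by
  obtain ⟨g, hg, hrep⟩ := bE_rep A ν (by exact_mod_cast h)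
  refine ⟨‖(1 / (2 * Real.pi) : ℂ)‖ * |∫ θ in (-Real.pi)..Real.pi, ‖g θ‖|, by positivity, ?_⟩
  intro ι s a x B hB
  have e : ∑ i ∈ s, a i * (besselJ ν (x i) : ℂ) = (1 / (2 * Real.pi)) *
      ∫ θ in (-Real.pi)..Real.pi, g θ * ∑ i ∈ s, a i * ((x i : ℂ) ^ A *
        Complex.exp (-(Complex.I * (x i * Real.sin θ)))) := by
    simp_rw [Finset.mul_sum]
    rw [intervalIntegral.integral_finsetSum, Finset.mul_sum]
    · refine Finset.sum_congr rfl fun i _ => ?_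
      rw [besselJ_eq_bE, hrep]
      rw [← intervalIntegral.integral_const_mul, ← intervalIntegral.integral_const_mul,
        ← intervalIntegral.integral_const_mul, ← intervalIntegral.integral_const_mul]
      congr 1
      ext θ
      ring
    · intro i _
      apply Continuous.intervalIntegrable; fun_prop
  rw [e, norm_mul, mul_assoc]
  gcongr
  have hBn : 0 ≤ B := (norm_nonneg _).trans (hB 0 (by simp))
  calc _ ≤ |∫ θ in (-Real.pi)..Real.pi, ‖g θ‖ * B| := by
        apply intervalIntegral.norm_integral_le_abs_of_norm_le
        · refine Filter.Eventually.of_forall fun θ => ?_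
          rw [norm_mul]
          gcongr
          exact hB _ (Real.abs_sin_le_one θ)
        · apply Continuous.intervalIntegrable; fun_prop
    _ = _ := by
        rw [intervalIntegral.integral_mul_const, abs_mul, abs_of_nonneg hBn]

open scoped FourierTransform ContDiff

lemma sum_zmod_range (c : ℕ) [NeZero c] (f : ZMod c → ℂ) :
    ∑ x : ZMod c, f x = ∑ i ∈ Finset.range c, f (i : ZMod c) := by
  refine Finset.sum_nbij' (fun x => x.val) (fun i => (i : ZMod c)) ?_ ?_ ?_ ?_ ?_
  · intro x _; simpa using ZMod.val_lt x
  · simp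
  · intro x _; simp
  · intro i hi; exact ZMod.val_cast_of_lt (by simpa using hi)
  · intro x _; simp

lemma sum_zmod_fin (c : ℕ) [NeZero c] (f : ZMod c → ℂ) :
    ∑ x : ZMod c, f x = ∑ i : Fin c, f ((i : ℕ) : ZMod c) := by
  rw [sum_zmod_range, Fin.sum_univ_eq_sum_range (fun i => f (i : ZMod c))]

lemma char_orth (c : ℕ) [NeZero c] (a : ZMod c) :
    ∑ x : ZMod c, ZMod.stdAddChar (x * a) = if a = 0 then (c : ℂ) else 0 := by
  rw [AddChar.sum_mulShift a (ZMod.isPrimitive_stdAddChar c)]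
  simp [ZMod.card]

lemma stdAddChar_norm (c : ℕ) [NeZero c] (a : ZMod c) : ‖ZMod.stdAddChar a‖ = 1 := by
  rw [ZMod.stdAddChar_apply]; exact Circle.norm_coe _

lemma cs_of_supp {F : ℝ → ℂ} (hs : Function.support F ⊆ Set.Icc 1 2) : HasCompactSupport F :=
  HasCompactSupport.of_support_subset_isCompact isCompact_Icc hs

lemma fourier_scale (F : ℝ → ℂ) (a : ℝ) (ha : 0 < a) (h : ℝ) :
    𝓕 (fun t => F (a * t)) h = (a : ℂ)⁻¹ * 𝓕 F (h / a) := by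
  rw [Real.fourier_eq', Real.fourier_eq']
  have := MeasureTheory.Measure.integral_comp_mul_left
    (fun t => Complex.exp ((-2 * Real.pi * (t * (h / a)) : ℝ) * Complex.I) • F t) a
  rw [abs_of_pos (by positivity)] at this
  have h2 : ∀ t : ℝ, a * t * (h / a) = t * h := fun t => by field_simp
  simp only [h2] at this
  simp only [RCLike.inner_apply', conj_trivial]
  rw [this]
  simp

lemma poisson_bound (F : ℝ → ℂ) (hF : ContDiff ℝ ∞ F) (hs : Function.support F ⊆ Set.Icc 1 2)
    (c : ℕ) [NeZero c] (b : ZMod c → ℂ) (P : ℝ) (hP : 0 < P) (g : ℤ → ℝ) (hg : Summable g)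
    (h : ∀ y : ℤ, ‖b (-(y : ZMod c))‖ * ‖𝓕 F (P * y / c)‖ ≤ g y) :
    ‖∑ n ∈ Finset.Icc 1 ⌊2 * P⌋₊, F (n / P) *
      ∑ x : ZMod c, b x * ZMod.stdAddChar ((n : ZMod c) * x)‖ ≤ P * ∑' y, g y := by
  have hc0 : (0 : ℝ) < c := by exact_mod_cast Nat.pos_of_ne_zero (NeZero.ne c)
  set a : ZMod c → ℂ := fun n => ∑ x : ZMod c, b x * ZMod.stdAddChar (n * x) with ha
  have hzero : ∀ t : ℝ, t ∉ Set.Icc (1:ℝ) 2 → F t = 0 := fun t ht => by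
    by_contra h0; exact ht (hs h0)
  -- the scaled function
  set H : ℝ → ℂ := fun t => F ((c / P) * t) with hH
  have hHs : HasCompactSupport H := (cs_of_supp hs).comp_homeomorph
    (Homeomorph.mulLeft₀ ((c:ℝ) / P) (by positivity))
  have hHc : ContDiff ℝ ∞ H := by fun_prop
  set S := hHs.toSchwartzMap hHc with hS
  have step1 : ∑ n ∈ Finset.Icc 1 ⌊2 * P⌋₊, F (n / P) * a n =
      ∑' n : ℤ, F (n / P) * a n := by
    rw [tsum_eq_sum (s := (Finset.Icc 1 ⌊2 * P⌋₊).map Nat.castEmbedding)]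
    · simp
    · intro n hn
      rw [hzero, zero_mul]
      intro hmem
      apply hn
      have h1 : (P : ℝ) ≤ n := by have := hmem.1; rwa [le_div_iff₀ hP, one_mul] at this
      have h2 : (n : ℝ) ≤ 2 * P := by have := hmem.2; rwa [div_le_iff₀ hP] at this
      have h3 : (0:ℝ) < n := by linarith
      have h3' : 0 < n := by exact_mod_cast h3
      lift n to ℕ using h3'.le
      simp only [Finset.mem_map, Finset.mem_Icc, Nat.castEmbedding_apply]
      refine ⟨n, ⟨by omega, Nat.le_floor (by exact_mod_cast h2)⟩, rfl⟩
  have hfin : (Function.support fun n : ℤ => F (n / P) * a n).Finite := by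
    refine (Set.finite_Icc (0:ℤ) ⌈2 * P⌉).subset ?_
    intro n hn
    have hmem : (n / P : ℝ) ∈ Set.Icc (1:ℝ) 2 := by
      by_contra h0; exact hn (by simp [hzero _ h0])
    have h1 : (P : ℝ) ≤ n := by have := hmem.1; rwa [le_div_iff₀ hP, one_mul] at this
    have h2 : (n : ℝ) ≤ 2 * P := by have := hmem.2; rwa [div_le_iff₀ hP] at this
    have h3 : (0:ℝ) ≤ n := by linarith
    exact ⟨by exact_mod_cast h3, by exact_mod_cast h2.trans (Int.le_ceil _)⟩
  have hsum1 : Summable fun n : ℤ => F (n / P) * a n := summable_of_hasFiniteSupport hfin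
  have step2 : ∑' n : ℤ, F (n / P) * a n = ∑ r : Fin c, a ((r : ℕ) : ZMod c) *
      ∑' j : ℤ, S (((r:ℕ):ℝ) / c + j) := by
    rw [← (Int.divModEquiv c).symm.tsum_eq]
    have hsum2 := (Int.divModEquiv c).symm.summable_iff.mpr hsum1
    rw [← (Equiv.prodComm (Fin c) ℤ).tsum_eq]
    have hsum3 := (Equiv.prodComm (Fin c) ℤ).summable_iff.mpr hsum2
    simp only [Function.comp_def] at hsum3
    rw [Summable.tsum_prod hsum3, tsum_fintype]
    refine Finset.sum_congr rfl fun r _ => ?_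
    rw [← tsum_mul_left]
    refine tsum_congr fun j => ?_
    simp only [Equiv.prodComm_apply, Prod.swap_prod_mk, Int.divModEquiv_symm_apply]
    have : S (((r:ℕ):ℝ) / c + j) = F ((c / P) * (((r:ℕ):ℝ) / c + j)) := rfl
    rw [this, mul_comm]
    push_cast
    congr 2
    · simp
    · field_simp
      ring
  have step3 : ∑ r : Fin c, a ((r : ℕ) : ZMod c) * ∑' j : ℤ, S (((r:ℕ):ℝ) / c + j) =
      ∑' y : ℤ, 𝓕 H y * (c * b (-(y : ZMod c))) := by
    have hsF : Summable fun y : ℤ => 𝓕 S (y : ℝ) := by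
      refine summable_of_isBigO (Real.summable_abs_int_rpow (b := 2) one_lt_two)
        (((𝓕 S).isBigO_cocompact_rpow (-2)).comp_tendsto Int.tendsto_coe_cofinite)
    have hSF : ∀ y : ℤ, 𝓕 S (y : ℝ) = 𝓕 H (y : ℝ) := by
      intro y; rfl
    have key : ∀ r : Fin c, ∀ y : ℤ, (fourier y (((((r:ℕ):ℝ) / c : ℝ)) : UnitAddCircle) : ℂ) =
        ZMod.stdAddChar (((r:ℕ) : ZMod c) * (y : ZMod c)) := by
      intro r y
      have : (((r:ℕ) : ZMod c) * (y : ZMod c)) = (((r:ℕ) * y : ℤ) : ZMod c) := by push_cast; rfl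
      rw [this, ZMod.stdAddChar_coe, fourier_coe_apply]
      congr 1
      push_cast
      field_simp
    simp_rw [S.tsum_eq_tsum_fourier, key, ← tsum_mul_left]
    rw [← Summable.tsum_finsetSum]
    · refine tsum_congr fun y => ?_
      have : ∀ r : Fin c, a ((r:ℕ):ZMod c) * (𝓕 S (y:ℝ) * ZMod.stdAddChar (((r:ℕ) : ZMod c) * (y : ZMod c))) =
        𝓕 S (y:ℝ) * (a ((r:ℕ):ZMod c) * ZMod.stdAddChar (((r:ℕ) : ZMod c) * (y : ZMod c))) := fun r => by ring
      simp_rw [this]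
      rw [← Finset.mul_sum, hSF, ← sum_zmod_fin c (fun r => a r * ZMod.stdAddChar (r * (y : ZMod c)))]
      congr 1
      simp only [ha, Finset.sum_mul]
      rw [Finset.sum_comm]
      have : ∀ x r : ZMod c, b x * ZMod.stdAddChar (r * x) * ZMod.stdAddChar (r * (y : ZMod c)) =
          b x * ZMod.stdAddChar (r * (x + (y : ZMod c))) := by
        intro x r
        rw [mul_add, AddChar.map_add_eq_mul]; ring
      simp_rw [this, ← Finset.mul_sum, char_orth]
      rw [Finset.sum_eq_single (-(y : ZMod c))]
      · simp [mul_comm]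
      · intro x _ hx
        rw [if_neg, mul_zero]
        intro h0; exact hx (eq_neg_of_add_eq_zero_left h0)
      · simp
    · intro r _
      refine Summable.mul_left _ ?_
      refine Summable.of_norm_bounded hsF.norm fun y => ?_
      rw [norm_mul, stdAddChar_norm, mul_one]
  have hgn : ∀ y : ℤ, ‖𝓕 H y * (c * b (-(y : ZMod c)))‖ ≤ P * g y := by
    intro y
    have : 𝓕 H (y:ℝ) = (((c / P : ℝ)) : ℂ)⁻¹ * 𝓕 F ((y:ℝ) / (c / P)) :=
      fourier_scale F (c / P) (by positivity) y
    rw [this]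
    have e : (y:ℝ) / (c / P) = P * y / c := by field_simp
    rw [e]
    simp only [norm_mul, norm_inv, Complex.norm_real, Complex.norm_natCast]
    rw [Real.norm_of_nonneg (by positivity)]
    calc _ = P * (‖b (-(y : ZMod c))‖ * ‖𝓕 F (P * y / c)‖) := by field_simp
      _ ≤ _ := by gcongr; exact h y
  change ‖∑ n ∈ Finset.Icc 1 ⌊2 * P⌋₊, F (n / P) * a n‖ ≤ _
  rw [step1, step2, step3, ← tsum_mul_left]
  exact tsum_of_norm_bounded (hg.mul_left P).hasSum hgn


open Classical in
lemma kloos_eq_zmod (m n : ℤ) (c : ℕ) [NeZero c] : kloos m n c =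
    ∑ x : ZMod c, (if IsUnit x then ZMod.stdAddChar ((n : ZMod c) * x⁻¹) else 0) *
      ZMod.stdAddChar ((m : ZMod c) * x) := by
  rw [sum_zmod_range, kloos, Finset.sum_filter]
  refine Finset.sum_congr rfl fun x _ => ?_
  simp only [ZMod.isUnit_iff_coprime]
  split_ifs with h
  · rw [← AddChar.map_add_eq_mul]
    have : ((n : ZMod c) * (x : ZMod c)⁻¹ + (m : ZMod c) * (x : ZMod c)) =
        ((m * x + n * (((x : ZMod c)⁻¹).val : ℤ) : ℤ) : ZMod c) := by
      push_cast
      rw [ZMod.natCast_val, ZMod.cast_id', id_eq]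
      ring
    rw [this, ZMod.stdAddChar_coe, eF]
    congr 1
    push_cast
    ring
  · simp

lemma kloos_norm_le (m n : ℤ) (c : ℕ) : ‖kloos m n c‖ ≤ c := by
  unfold kloos
  refine (norm_sum_le _ _).trans ?_
  have : ∀ x : ℝ, ‖eF x‖ = 1 := by
    intro x
    rw [eF, show (2 * Real.pi * Complex.I * x : ℂ) = ((2 * Real.pi * x : ℝ) : ℂ) * Complex.I by
      push_cast; ring]
    exact Complex.norm_exp_ofReal_mul_I _
  simp only [this]
  simp only [Finset.sum_const, nsmul_eq_mul, mul_one, Nat.cast_le]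
  exact (Finset.card_filter_le _ _).trans (by simp)

lemma card_modEq_le (c L : ℕ) (hd : L ∣ c) (T : Finset ℕ) (hT : T ⊆ Finset.range c)
    (h : ∀ x ∈ T, ∀ y ∈ T, x ≡ y [MOD L]) : T.card ≤ c / L := by
  rw [← Finset.card_range (c / L)]
  refine Finset.card_le_card_of_injOn (fun x => x / L) ?_ ?_
  · intro x hx
    have := Finset.mem_range.mp (hT hx)
    simpa using Nat.div_lt_div_of_lt_of_dvd hd this
  · intro x hx y hy hxy
    have h1 := h x hx y hy
    simp only at hxy
    rw [← Nat.div_add_mod x L, ← Nat.div_add_mod y L, hxy, h1]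

open Classical in
/-- Bound for Ramanujan sums. -/
lemma ramanujan_bound (c : ℕ) [NeZero c] (a : ZMod c) :
    ‖∑ x : ZMod c, (if IsUnit x then ZMod.stdAddChar (x * a) else 0)‖ ≤
      ∑ e ∈ c.divisors, if (e : ZMod c) * a = 0 then ((c / e : ℕ) : ℝ) else 0 := by
  have hc := NeZero.ne c
  have hind : ∀ x : ZMod c, (if IsUnit x then ZMod.stdAddChar (x * a) else (0:ℂ)) =
      ∑ e ∈ c.divisors, if e ∣ x.val then
        (ArithmeticFunction.moebius e : ℂ) * ZMod.stdAddChar (x * a) else 0 := by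
    intro x
    have h1 : IsUnit x ↔ Nat.gcd x.val c = 1 := by
      conv_lhs => rw [← ZMod.natCast_zmod_val x]
      rw [ZMod.isUnit_iff_coprime]
    rw [← Finset.sum_filter, ← Finset.sum_mul]
    have h2 : c.divisors.filter (fun e => e ∣ x.val) = (Nat.gcd x.val c).divisors := by
      ext e
      simp only [Finset.mem_filter, Nat.mem_divisors, Nat.dvd_gcd_iff]
      constructor
      · rintro ⟨⟨h, _⟩, h'⟩
        exact ⟨⟨h', h⟩, fun h0 => hc (Nat.eq_zero_of_gcd_eq_zero_right h0)⟩
      · rintro ⟨⟨h, h'⟩, _⟩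
        exact ⟨⟨h', hc⟩, h⟩
    rw [h2]
    have h3 := congrFun (congrArg DFunLike.coe ArithmeticFunction.coe_zeta_mul_moebius)
      (Nat.gcd x.val c)
    rw [ArithmeticFunction.coe_zeta_mul_apply, ArithmeticFunction.one_apply] at h3
    rw [← Int.cast_sum, h3]
    by_cases hx : IsUnit x
    · rw [if_pos hx, if_pos (h1.mp hx)]; simp
    · rw [if_neg hx, if_neg (fun h => hx (h1.mpr h))]; simp
  simp_rw [hind]
  rw [Finset.sum_comm]
  refine (norm_sum_le _ _).trans (Finset.sum_le_sum fun e he => ?_)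
  have hec := Nat.dvd_of_mem_divisors he
  have he0 : 0 < e := Nat.pos_of_mem_divisors he
  have hcond : ∀ x : ZMod c, e ∣ x.val ↔ ZMod.castHom hec (ZMod e) x = 0 := by
    intro x
    conv_rhs => rw [← ZMod.natCast_zmod_val x, map_natCast, ZMod.natCast_eq_zero_iff]
  split_ifs with hea
  · refine (norm_sum_le _ _).trans ?_
    calc _ ≤ ∑ x : ZMod c, if e ∣ x.val then (1:ℝ) else 0 := by
          refine Finset.sum_le_sum fun x _ => ?_
          split_ifs
          · rw [norm_mul, stdAddChar_norm, mul_one, Complex.norm_intCast]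
            exact_mod_cast ArithmeticFunction.abs_moebius_le_one
          · simp
      _ = ((Finset.univ.filter (fun x : ZMod c => e ∣ x.val)).card : ℝ) := by
          rw [Finset.sum_boole]
      _ = (((Finset.univ.filter (fun x : ZMod c => e ∣ x.val)).image ZMod.val).card : ℝ) := by
          rw [Finset.card_image_of_injective _ (ZMod.val_injective c)]
      _ ≤ _ := by
          norm_cast
          refine card_modEq_le c e hec _ ?_ ?_
          · intro y hy
            obtain ⟨x, _, rfl⟩ := Finset.mem_image.mp hy
            exact Finset.mem_range.mpr (ZMod.val_lt x)
          · intro y hy z hz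
            obtain ⟨x, hx, rfl⟩ := Finset.mem_image.mp hy
            obtain ⟨w, hw, rfl⟩ := Finset.mem_image.mp hz
            have h1 := (Finset.mem_filter.mp hx).2
            have h2 := (Finset.mem_filter.mp hw).2
            exact ((Nat.modEq_zero_iff_dvd).mpr h1).trans ((Nat.modEq_zero_iff_dvd).mpr h2).symm
  · rw [norm_le_zero_iff]
    set S := ∑ x : ZMod c, (if e ∣ x.val then
        (ArithmeticFunction.moebius e : ℂ) * ZMod.stdAddChar (x * a) else 0) with hS
    have hshift : S = ZMod.stdAddChar ((e : ZMod c) * a) * S := by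
      conv_lhs => rw [hS, ← Equiv.sum_comp (Equiv.addLeft (e : ZMod c))]
      rw [hS, Finset.mul_sum]
      refine Finset.sum_congr rfl fun x _ => ?_
      simp only [hcond, Equiv.coe_addLeft, map_add, map_natCast, CharP.cast_eq_zero, zero_add]
      split_ifs
      · rw [add_mul, AddChar.map_add_eq_mul]; ring
      · simp
    have hne : ZMod.stdAddChar ((e : ZMod c) * a) ≠ 1 := by
      intro h1
      apply hea
      apply ZMod.injective_stdAddChar
      rw [h1, AddChar.map_zero_eq_one]
    have : (1 - ZMod.stdAddChar ((e : ZMod c) * a)) * S = 0 := by linear_combination hshift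
    rcases mul_eq_zero.mp this with h | h
    · exact absurd (sub_eq_zero.mp h).symm hne
    · exact h

/-- Sum of all `δ` with `δ² ∣ D`. -/
def sqDiv (D : ℤ) : ℕ := ∑ δ ∈ (Finset.range (D.natAbs + 1)).filter (fun δ : ℕ => (δ : ℤ) ^ 2 ∣ D), δ

lemma le_sqDiv (D : ℤ) (hD : D ≠ 0) (δ : ℕ) (h : (δ : ℤ) ^ 2 ∣ D) : δ ≤ sqDiv D := by
  unfold sqDiv
  refine Finset.single_le_sum (f := fun δ => δ) (fun _ _ => Nat.zero_le _) ?_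
  rw [Finset.mem_filter, Finset.mem_range]
  refine ⟨?_, h⟩
  have h1 : δ ^ 2 ∣ D.natAbs := by
    have := Int.natAbs_dvd_natAbs.mpr h
    simpa [Int.natAbs_pow] using this
  have h2 := Nat.le_of_dvd (Int.natAbs_pos.mpr hD) h1
  nlinarith [Nat.zero_le δ]

/-- Root count of a quadratic congruence. -/
lemma root_count (c d : ℕ) (hc : 0 < c) (hd : d ∣ c) (l m : ℤ) (hD : l ^ 2 - 4 * m ≠ 0) :
    ((Finset.range c).filter (fun r : ℕ => (d : ℤ) ∣ (r : ℤ) ^ 2 - l * r + m)).card ≤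
      d.divisors.card * ((c / d) * sqDiv (l ^ 2 - 4 * m)) := by
  have hd0 : 0 < d := Nat.pos_of_dvd_of_pos hd hc
  set R := (Finset.range c).filter (fun r : ℕ => (d : ℤ) ∣ (r : ℤ) ^ 2 - l * r + m) with hR
  rcases R.eq_empty_or_nonempty with h0 | ⟨s, hs⟩
  · rw [h0]; simp
  have hs2 := (Finset.mem_filter.mp hs).2
  set B : ℕ → Finset ℕ := fun g => (Finset.range c).filter (fun r : ℕ =>
    (g : ℤ) ∣ (r : ℤ) - s ∧ ((d / g : ℕ) : ℤ) ∣ (r : ℤ) + s - l) with hB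
  have hsub : R ⊆ d.divisors.biUnion B := by
    intro r hr
    have hr1 := (Finset.mem_filter.mp hr).1
    have hr2 := (Finset.mem_filter.mp hr).2
    rw [Finset.mem_biUnion]
    have hprod : (d : ℤ) ∣ ((r : ℤ) - s) * ((r : ℤ) + s - l) := by
      have := dvd_sub hr2 hs2
      have e : ((r : ℤ) ^ 2 - l * r + m) - ((s : ℤ) ^ 2 - l * s + m) =
        ((r : ℤ) - s) * ((r : ℤ) + s - l) := by ring
      rwa [e] at this
    refine ⟨Int.gcd ((r:ℤ) - s) d, ?_, ?_⟩
    · rw [Nat.mem_divisors]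
      exact ⟨by exact_mod_cast Int.gcd_dvd_right ((r:ℤ) - s) d, hd0.ne'⟩
    · rw [Finset.mem_filter]
      refine ⟨hr1, Int.gcd_dvd_left _ _, ?_⟩
      set g := Int.gcd ((r:ℤ) - s) d with hg
      have hgd : g ∣ d := Int.natCast_dvd_natCast.mp (Int.gcd_dvd_right ((r:ℤ) - s) d)
      have hgpos : 0 < g := Nat.pos_of_dvd_of_pos hgd hd0
      have h1 : ((d / g : ℕ) : ℤ) = (d : ℤ) / g := by push_cast; rfl
      rw [h1]
      have hcop : IsCoprime ((d:ℤ) / g) (((r:ℤ) - s) / g) := by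
        rw [Int.isCoprime_iff_gcd_eq_one, Int.gcd_comm]
        exact Int.gcd_div_gcd_div_gcd (by rw [← hg]; exact hgpos)
      refine hcop.dvd_of_dvd_mul_left ?_
      have hgl : (g:ℤ) ∣ (r:ℤ) - s := Int.gcd_dvd_left _ _
      have hgr : (g:ℤ) ∣ d := by exact_mod_cast hgd
      have hg0 : (g:ℤ) ≠ 0 := by exact_mod_cast hgpos.ne'
      rw [← mul_dvd_mul_iff_left hg0, ← mul_assoc, Int.mul_ediv_cancel' hgl,
        Int.mul_ediv_cancel' hgr]
      exact hprod
  refine (Finset.card_le_card hsub).trans (Finset.card_biUnion_le_card_mul _ _ _ fun g hg => ?_)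
  have hgd := Nat.dvd_of_mem_divisors hg
  have hg0 := Nat.pos_of_mem_divisors hg
  rcases (B g).eq_empty_or_nonempty with h0 | ⟨r, hr⟩
  · rw [h0]; simp
  obtain ⟨-, hr1, hr2⟩ := Finset.mem_filter.mp hr
  set δ := Nat.gcd g (d / g) with hδ
  have hmul : δ * Nat.lcm g (d / g) = d := by
    rw [hδ, Nat.gcd_mul_lcm, Nat.mul_div_cancel' hgd]
  have hlpos : 0 < Nat.lcm g (d / g) := Nat.pos_of_ne_zero fun h => by
    rw [h, mul_zero] at hmul; omega
  have hδpos : 0 < δ := Nat.pos_of_ne_zero fun h => by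
    rw [h, zero_mul] at hmul; omega
  have hδD : (δ : ℤ) ^ 2 ∣ l ^ 2 - 4 * m := by
    have a1 : (δ : ℤ) ∣ (r:ℤ) - s := (Int.natCast_dvd_natCast.mpr (Nat.gcd_dvd_left _ _)).trans hr1
    have a2 : (δ : ℤ) ∣ (r:ℤ) + s - l :=
      (Int.natCast_dvd_natCast.mpr (Nat.gcd_dvd_right _ _)).trans hr2
    have a3 : (δ : ℤ) ∣ 2 * s - l := by
      have := dvd_sub a2 a1
      have e : ((r:ℤ) + s - l) - ((r:ℤ) - s) = 2 * s - l := by ring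
      rwa [e] at this
    have a4 : δ ^ 2 ∣ d := by
      rw [← Nat.mul_div_cancel' hgd, pow_two]
      exact mul_dvd_mul (Nat.gcd_dvd_left _ _) (Nat.gcd_dvd_right _ _)
    have a5 : (δ : ℤ) ^ 2 ∣ (s : ℤ) ^ 2 - l * s + m := by
      refine dvd_trans ?_ hs2
      exact_mod_cast a4
    have := dvd_sub (pow_dvd_pow_of_dvd a3 2) (a5.mul_left 4)
    have e : (2 * (s:ℤ) - l) ^ 2 - 4 * ((s : ℤ) ^ 2 - l * s + m) = l ^ 2 - 4 * m := by ring
    rwa [e] at this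
  have hcard : (B g).card ≤ c / Nat.lcm g (d / g) := by
    refine card_modEq_le c _ ((Dvd.intro_left _ hmul).trans hd) _ (Finset.filter_subset _ _) ?_
    intro x hx y hy
    obtain ⟨-, hx1, hx2⟩ := Finset.mem_filter.mp hx
    obtain ⟨-, hy1, hy2⟩ := Finset.mem_filter.mp hy
    rw [Nat.modEq_iff_dvd]
    have b1 : (g : ℤ) ∣ (y:ℤ) - x := by
      have := dvd_sub hy1 hx1
      have e : ((y:ℤ) - s) - ((x:ℤ) - s) = y - x := by ring
      rwa [e] at this
    have b2 : ((d / g : ℕ) : ℤ) ∣ (y:ℤ) - x := by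
      have := dvd_sub hy2 hx2
      have e : ((y:ℤ) + s - l) - ((x:ℤ) + s - l) = y - x := by ring
      rwa [e] at this
    have b3 := Int.coe_lcm_dvd b1 b2
    exact b3
  have hfin : c / Nat.lcm g (d / g) = (c / d) * δ := by
    obtain ⟨e, rfl⟩ := hd
    rw [Nat.mul_div_cancel_left _ hd0]
    apply Nat.div_eq_of_eq_mul_left hlpos
    calc d * e = (δ * Nat.lcm g (d / g)) * e := by rw [hmul]
      _ = _ := by ring
  rw [hfin] at hcard
  exact hcard.trans (Nat.mul_le_mul_left _ (le_sqDiv _ hD _ hδD))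

lemma card_two_mul (c : ℕ) [NeZero c] :
    (Finset.univ.filter (fun h : ZMod c => 2 * h = 0)).card ≤ 2 := by
  rw [← Finset.card_image_of_injective _ (ZMod.val_injective c)]
  refine (Finset.card_le_card (t := {0, c / 2}) ?_).trans Finset.card_le_two
  intro y hy
  obtain ⟨x, hx, rfl⟩ := Finset.mem_image.mp hy
  have h := (Finset.mem_filter.mp hx).2
  rw [← ZMod.natCast_zmod_val x] at h
  have h' : ((2 * x.val : ℕ) : ZMod c) = 0 := by push_cast; exact_mod_cast h
  rw [ZMod.natCast_eq_zero_iff] at h'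
  obtain ⟨k, hk⟩ := h'
  have hlt := ZMod.val_lt x
  have : k < 2 := by
    by_contra hk2
    have : c * 2 ≤ c * k := Nat.mul_le_mul_left _ (by omega)
    omega
  simp only [Finset.mem_insert, Finset.mem_singleton]
  interval_cases k <;> omega

lemma gauss_bound (c : ℕ) [NeZero c] (y l : ZMod c) (hy : IsUnit y) :
    ‖∑ n : ZMod c, ZMod.stdAddChar (n ^ 2 * y - n * l)‖ ≤ Real.sqrt (2 * c) := by
  apply Real.le_sqrt_of_sq_le
  set G := ∑ n : ZMod c, ZMod.stdAddChar (n ^ 2 * y - n * l) with hG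
  have h1 : ((‖G‖ ^ 2 : ℝ) : ℂ) = ∑ h : ZMod c, ZMod.stdAddChar (h ^ 2 * y - h * l) *
      ∑ n : ZMod c, ZMod.stdAddChar (n * (2 * h * y)) := by
    push_cast
    rw [← Complex.mul_conj', hG, map_sum, Finset.sum_mul_sum, Finset.sum_comm]
    have : ∀ n : ZMod c, ∑ i : ZMod c, ZMod.stdAddChar (i ^ 2 * y - i * l) *
        (starRingEnd ℂ) (ZMod.stdAddChar (n ^ 2 * y - n * l)) =
        ∑ h : ZMod c, ZMod.stdAddChar (h ^ 2 * y - h * l) * ZMod.stdAddChar (n * (2 * h * y)) := by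
      intro n
      rw [← Equiv.sum_comp (Equiv.addLeft n)]
      refine Finset.sum_congr rfl fun h _ => ?_
      rw [← AddChar.map_neg_eq_conj, ← AddChar.map_add_eq_mul, ← AddChar.map_add_eq_mul]
      congr 1
      simp only [Equiv.coe_addLeft]
      ring
    simp_rw [this]
    rw [Finset.sum_comm]
    simp_rw [Finset.mul_sum]
  have h2 : ‖((‖G‖ ^ 2 : ℝ) : ℂ)‖ ≤ 2 * c := by
    rw [h1]
    refine (norm_sum_le _ _).trans ?_
    simp_rw [char_orth, norm_mul, stdAddChar_norm, one_mul]
    calc _ = ∑ h : ZMod c, if 2 * h = 0 then (c : ℝ) else 0 := by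
          refine Finset.sum_congr rfl fun h _ => ?_
          by_cases h0 : 2 * h = 0
          · simp [h0]
          · rw [if_neg h0, if_neg (fun h' => h0 (hy.mul_left_eq_zero.mp h'))]; simp
      _ ≤ 2 * c := by
          rw [← Finset.sum_filter, Finset.sum_const, nsmul_eq_mul]
          gcongr
          exact_mod_cast card_two_mul c
  rwa [Complex.norm_real, Real.norm_of_nonneg (by positivity)] at h2

open Classical in
/-- Fourier expansion of the Kloosterman sum `S(m, n²; c)` in `n`. -/
lemma kloos_fourier (c : ℕ) [NeZero c] (m : ℤ) : ∃ b : ZMod c → ℂ,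
    (∀ n : ℤ, kloos m (n ^ 2) c = ∑ x : ZMod c, b x * ZMod.stdAddChar ((n : ZMod c) * x)) ∧
    (∀ x, ‖b x‖ ≤ Real.sqrt (2 * c)) ∧
    (∀ l : ℤ, l ^ 2 - 4 * m ≠ 0 →
      ‖b l‖ ≤ (c.divisors.card : ℝ) ^ 2 * sqDiv (l ^ 2 - 4 * m)) := by
  have hc : (c : ℂ) ≠ 0 := by exact_mod_cast NeZero.ne c
  have hcr : (0 : ℝ) < c := by exact_mod_cast Nat.pos_of_ne_zero (NeZero.ne c)
  set f : ZMod c → ℂ := fun n => ∑ x : ZMod c,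
    (if IsUnit x then ZMod.stdAddChar (n ^ 2 * x⁻¹) else 0) *
      ZMod.stdAddChar ((m : ZMod c) * x) with hf
  set b : ZMod c → ℂ := fun l => (c : ℂ)⁻¹ * ∑ n : ZMod c, f n * ZMod.stdAddChar (-(n * l)) with hb
  have hb2 : ∀ l, b l = (c : ℂ)⁻¹ * ∑ x : ZMod c, (if IsUnit x then
      ZMod.stdAddChar ((m : ZMod c) * x) *
        ∑ n : ZMod c, ZMod.stdAddChar (n ^ 2 * x⁻¹ - n * l) else 0) := by
    intro l
    simp only [hb, hf]
    congr 1
    simp_rw [Finset.sum_mul]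
    rw [Finset.sum_comm]
    refine Finset.sum_congr rfl fun x _ => ?_
    split_ifs with hx
    · rw [Finset.mul_sum]
      refine Finset.sum_congr rfl fun n _ => ?_
      rw [sub_eq_add_neg, AddChar.map_add_eq_mul]; ring
    · simp
  refine ⟨b, ?_, ?_, ?_⟩
  · intro n
    have h1 : kloos m (n ^ 2) c = f n := by
      rw [kloos_eq_zmod, hf]; push_cast; rfl
    rw [h1]
    simp only [hb, mul_assoc, Finset.sum_mul]
    rw [← Finset.mul_sum, Finset.sum_comm]
    have : ∀ y x : ZMod c, f y * (ZMod.stdAddChar (-(y * x)) * ZMod.stdAddChar ((n : ZMod c) * x)) =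
        f y * ZMod.stdAddChar (x * ((n : ZMod c) - y)) := by
      intro y x
      rw [← AddChar.map_add_eq_mul]; congr 2; ring
    simp_rw [this, ← Finset.mul_sum, char_orth]
    rw [Finset.sum_eq_single (n : ZMod c)]
    · rw [sub_self, if_pos rfl]; field_simp
    · intro y _ hy
      rw [if_neg (sub_ne_zero.mpr (Ne.symm hy)), mul_zero]
    · simp
  · intro l
    rw [hb2, norm_mul, norm_inv, Complex.norm_natCast, inv_mul_le_iff₀ hcr]
    refine (norm_sum_le _ _).trans ?_
    calc _ ≤ ∑ x : ZMod c, Real.sqrt (2 * c) := by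
          refine Finset.sum_le_sum fun x _ => ?_
          split_ifs with hx
          · rw [norm_mul, stdAddChar_norm, one_mul]
            refine gauss_bound c _ _ ?_
            obtain ⟨u, rfl⟩ := hx
            rw [ZMod.inv_coe_unit]; exact Units.isUnit _
          · simp
      _ = _ := by simp [ZMod.card]
  · intro l hD
    have hb3 : b l = (c : ℂ)⁻¹ * ∑ r : ZMod c, ∑ x : ZMod c, (if IsUnit x then
        ZMod.stdAddChar (x * (r ^ 2 - (l : ZMod c) * r + (m : ZMod c))) else 0) := by
      rw [hb2, Finset.sum_comm]
      congr 1
      refine Finset.sum_congr rfl fun x _ => ?_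
      split_ifs with hx
      · obtain ⟨u, rfl⟩ := hx
        rw [← Equiv.sum_comp (Units.mulLeft u), Finset.mul_sum]
        refine Finset.sum_congr rfl fun r _ => ?_
        rw [← AddChar.map_add_eq_mul]
        congr 1
        simp only [Units.mulLeft_apply]
        have : (u : ZMod c) * (u : ZMod c)⁻¹ = 1 := by
          rw [ZMod.inv_coe_unit]; simp
        linear_combination (r ^ 2 * u) * this
      · simp
    rw [hb3, norm_mul, norm_inv, Complex.norm_natCast, inv_mul_le_iff₀ hcr]
    refine (norm_sum_le _ _).trans ((Finset.sum_le_sum fun r _ => ramanujan_bound c _).trans ?_)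
    rw [Finset.sum_comm]
    have hterm : ∀ e ∈ c.divisors, (∑ r : ZMod c,
        if (e : ZMod c) * (r ^ 2 - (l : ZMod c) * r + (m : ZMod c)) = 0 then ((c / e : ℕ) : ℝ) else 0) ≤
        c * (c.divisors.card * sqDiv (l ^ 2 - 4 * m)) := by
      intro e he
      have hec := Nat.dvd_of_mem_divisors he
      have he0 : 0 < e := Nat.pos_of_mem_divisors he
      have hcpos : 0 < c := Nat.pos_of_ne_zero (NeZero.ne c)
      rw [← Finset.sum_filter, Finset.sum_const, nsmul_eq_mul,
        ← Finset.card_image_of_injective _ (ZMod.val_injective c)]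
      have hcnt := root_count c (c / e) hcpos (Nat.div_dvd_of_dvd hec) l m hD
      have hsub : ((Finset.univ.filter (fun r : ZMod c =>
          (e : ZMod c) * (r ^ 2 - (l : ZMod c) * r + (m : ZMod c)) = 0)).image ZMod.val) ⊆
          (Finset.range c).filter (fun r : ℕ => ((c / e : ℕ) : ℤ) ∣ (r : ℤ) ^ 2 - l * r + m) := by
        intro y hy
        obtain ⟨x, hx, rfl⟩ := Finset.mem_image.mp hy
        have h := (Finset.mem_filter.mp hx).2
        rw [Finset.mem_filter]
        refine ⟨Finset.mem_range.mpr (ZMod.val_lt x), ?_⟩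
        have h' : ((e * ((x.val : ℤ) ^ 2 - l * x.val + m) : ℤ) : ZMod c) = 0 := by
          push_cast
          rw [ZMod.natCast_val, ZMod.cast_id', id_eq]
          exact h
        rw [ZMod.intCast_zmod_eq_zero_iff_dvd] at h'
        have he' : (e : ℤ) ≠ 0 := by exact_mod_cast he0.ne'
        rw [← mul_dvd_mul_iff_left he']
        have : (e : ℤ) * ((c / e : ℕ) : ℤ) = c := by
          exact_mod_cast Nat.mul_div_cancel' hec
        rw [this]; exact h'
      have h1 := (Finset.card_le_card hsub).trans hcnt
      have h2 : (c / e).divisors.card ≤ c.divisors.card :=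
        Finset.card_le_card (Nat.divisors_subset_of_dvd hcpos.ne' (Nat.div_dvd_of_dvd hec))
      have h3 : c / (c / e) = e := Nat.div_div_self hec hcpos.ne'
      rw [h3] at h1
      have h4 : (c / e) * e = c := Nat.div_mul_cancel hec
      norm_cast
      calc _ ≤ (c / e).divisors.card * (e * sqDiv (l ^ 2 - 4 * m)) * (c / e) :=
            Nat.mul_le_mul_right _ h1
        _ ≤ c.divisors.card * (e * sqDiv (l ^ 2 - 4 * m)) * (c / e) := by gcongr
        _ = ((c / e) * e) * (c.divisors.card * sqDiv (l ^ 2 - 4 * m)) := by ring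
        _ = _ := by rw [h4]
    refine (Finset.sum_le_sum hterm).trans ?_
    rw [Finset.sum_const, nsmul_eq_mul]
    apply le_of_eq; ring

open scoped FourierTransform ContDiff

lemma eventually_zero_of_supp {w : ℝ → ℂ} (hs : Function.support w ⊆ Set.Icc 1 2) {t : ℝ}
    (ht : t < 1) : w =ᶠ[nhds t] 0 := by
  filter_upwards [Iio_mem_nhds ht] with x hx
  by_contra h
  exact absurd (hs h).1 (not_le.mpr hx)

lemma smooth_mul_of_supp {w φ : ℝ → ℂ} (hw : ContDiff ℝ ∞ w)
    (hs : Function.support w ⊆ Set.Icc 1 2) (hφ : ∀ t : ℝ, 0 < t → ContDiffAt ℝ ∞ φ t) :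
    ContDiff ℝ ∞ (fun t => w t * φ t) ∧ Function.support (fun t => w t * φ t) ⊆ Set.Icc 1 2 := by
  constructor
  · rw [contDiff_iff_contDiffAt]
    intro t
    by_cases ht : 0 < t
    · exact hw.contDiffAt.mul (hφ t ht)
    · have h0 := eventually_zero_of_supp hs (t := t) (by linarith)
      have : (fun t => w t * φ t) =ᶠ[nhds t] fun _ => 0 := by
        filter_upwards [h0] with x hx
        simp [hx]
      exact contDiffAt_const.congr_of_eventuallyEq this
  · intro t ht
    apply hs
    intro h
    apply ht
    simp [h]

lemma supp_deriv_of_supp {w : ℝ → ℂ} (hs : Function.support w ⊆ Set.Icc 1 2) :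
    Function.support (deriv w) ⊆ Set.Icc 1 2 :=
  support_deriv_subset.trans (closure_minimal hs isClosed_Icc)

lemma phase_smooth (β : ℝ) (t : ℝ) (ht : 0 < t) :
    ContDiffAt ℝ ∞ (fun t : ℝ => Complex.exp (Complex.I * (β * (Real.sqrt t : ℂ)))) t := by
  have h1 : ContDiffAt ℝ ∞ (fun t : ℝ => (Real.sqrt t : ℂ)) t :=
    Complex.ofRealCLM.contDiff.contDiffAt.comp t (Real.contDiffAt_sqrt ht.ne')
  exact (contDiffAt_const.mul (contDiffAt_const.mul h1)).cexp

lemma invsqrt_smooth (t : ℝ) (ht : 0 < t) :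
    ContDiffAt ℝ ∞ (fun t : ℝ => (((1 / (2 * Real.sqrt t) : ℝ)) : ℂ)) t := by
  refine Complex.ofRealCLM.contDiff.contDiffAt.comp t ?_
  refine contDiffAt_const.div (contDiffAt_const.mul (Real.contDiffAt_sqrt ht.ne')) ?_
  have := Real.sqrt_pos.mpr ht
  positivity

lemma phase_norm (β s : ℝ) : ‖Complex.exp (Complex.I * (β * (s : ℂ)))‖ = 1 := by
  rw [show Complex.I * (β * (s : ℂ)) = ((β * s : ℝ) : ℂ) * Complex.I by push_cast; ring]
  exact Complex.norm_exp_ofReal_mul_I _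

lemma fourier_norm_le (f : ℝ → ℂ) (ξ : ℝ) : ‖𝓕 f ξ‖ ≤ ∫ t, ‖f t‖ := by
  rw [Real.fourier_real_eq]
  refine (MeasureTheory.norm_integral_le_integral_norm _).trans (le_of_eq ?_)
  simp_rw [Circle.norm_smul]

lemma phase_deriv {w : ℝ → ℂ} (hw : ContDiff ℝ ∞ w)
    (hs : Function.support w ⊆ Set.Icc 1 2) (β : ℝ) :
    deriv (fun t => w t * Complex.exp (Complex.I * (β * (Real.sqrt t : ℂ)))) =
    (fun t => deriv w t * Complex.exp (Complex.I * (β * (Real.sqrt t : ℂ)))) +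
    (Complex.I * β) • (fun t => (w t * (((1 / (2 * Real.sqrt t) : ℝ)) : ℂ)) *
      Complex.exp (Complex.I * (β * (Real.sqrt t : ℂ)))) := by
  funext t
  by_cases ht : 0 < t
  · have h1 : HasDerivAt (fun t : ℝ => (Real.sqrt t : ℂ)) (((1 / (2 * Real.sqrt t) : ℝ)) : ℂ) t :=
      (Real.hasDerivAt_sqrt ht.ne').ofReal_comp
    have h2 := ((h1.const_mul (β : ℂ)).const_mul Complex.I).cexp
    have h3 : HasDerivAt w (deriv w t) t :=
      (hw.differentiable (by simp)).differentiableAt.hasDerivAt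
    refine (h3.mul h2).deriv.trans ?_
    simp only [Pi.add_apply, Pi.smul_apply, smul_eq_mul]
    ring
  · have h0 := eventually_zero_of_supp hs (t := t) (by linarith)
    have : (fun t => w t * Complex.exp (Complex.I * (β * (Real.sqrt t : ℂ)))) =ᶠ[nhds t]
        fun _ => 0 := by
      filter_upwards [h0] with x hx
      simp [hx]
    rw [this.deriv_eq]
    have h4 : deriv w t = 0 := by
      rw [Filter.EventuallyEq.deriv_eq h0]; simp
    have h5 : w t = 0 := h0.self_of_nhds
    simp [h4, h5]

lemma fourier_phase_bound (j : ℕ) : ∀ (w : ℝ → ℂ), ContDiff ℝ ∞ w →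
    Function.support w ⊆ Set.Icc 1 2 → ∃ C, 0 ≤ C ∧ ∀ β ξ : ℝ,
    |ξ| ^ j * ‖𝓕 (fun t => w t * Complex.exp (Complex.I * (β * (Real.sqrt t : ℂ)))) ξ‖ ≤
      C * (1 + |β|) ^ j := by
  induction j with
  | zero =>
    intro w hw hs
    refine ⟨∫ t, ‖w t‖, MeasureTheory.integral_nonneg fun _ => norm_nonneg _, fun β ξ => ?_⟩
    rw [pow_zero, pow_zero, one_mul, mul_one]
    refine (fourier_norm_le _ _).trans (le_of_eq ?_)
    simp_rw [norm_mul, phase_norm, mul_one]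
  | succ j ih =>
    intro w hw hs
    have hw' : ContDiff ℝ ∞ (deriv w) := (contDiff_infty_iff_deriv.mp hw).2
    obtain ⟨C1, hC1, h1⟩ := ih (deriv w) hw' (supp_deriv_of_supp hs)
    obtain ⟨hv, hvs⟩ := smooth_mul_of_supp hw hs invsqrt_smooth
    obtain ⟨C2, hC2, h2⟩ := ih _ hv hvs
    refine ⟨C1 + C2, by positivity, fun β ξ => ?_⟩
    set G := fun t => w t * Complex.exp (Complex.I * (β * (Real.sqrt t : ℂ))) with hG
    have hi : ∀ v : ℝ → ℂ, ContDiff ℝ ∞ v → Function.support v ⊆ Set.Icc 1 2 →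
        MeasureTheory.Integrable v := fun v hv hvs =>
      hv.continuous.integrable_of_hasCompactSupport (cs_of_supp hvs)
    obtain ⟨hGs, hGss⟩ := smooth_mul_of_supp hw hs (phase_smooth β)
    obtain ⟨a1, a2⟩ := smooth_mul_of_supp hw' (supp_deriv_of_supp hs) (phase_smooth β)
    obtain ⟨b1, b2⟩ := smooth_mul_of_supp hv hvs (phase_smooth β)
    have hd := Real.fourier_deriv (hi _ hGs hGss) (hGs.differentiable (by simp))
      (hi _ (contDiff_infty_iff_deriv.mp hGs).2 (supp_deriv_of_supp hGss))
    have hd := congrFun hd ξ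
    rw [phase_deriv hw hs β, Real.fourier_real_eq] at hd
    have hadd : ∀ f g : ℝ → ℂ, MeasureTheory.Integrable f → MeasureTheory.Integrable g → ∀ z : ℂ,
        (∫ v : ℝ, Real.fourierChar (-(v * ξ)) • (f + z • g) v) = 𝓕 f ξ + z * 𝓕 g ξ := by
      intro f g hf hg z
      rw [Real.fourier_real_eq, Real.fourier_real_eq, ← MeasureTheory.integral_const_mul,
        ← MeasureTheory.integral_add]
      · congr 1; funext v
        simp only [Pi.add_apply, Pi.smul_apply, smul_eq_mul, Circle.smul_def]; ring
      · have := (Real.fourierIntegral_convergent_iff (f := f) ξ).mpr hf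
        simpa [mul_comm] using this
      · have := (Real.fourierIntegral_convergent_iff (f := g) ξ).mpr hg
        refine MeasureTheory.Integrable.const_mul ?_ _
        simpa [mul_comm] using this
    rw [hadd _ _ (hi _ a1 a2) (hi _ b1 b2)] at hd
    have hn := congrArg norm hd
    rw [norm_smul] at hn
    have e1 : ‖(2 * Real.pi * Complex.I * ξ : ℂ)‖ = 2 * Real.pi * |ξ| := by
      simp [abs_of_pos Real.pi_pos]
    rw [e1] at hn
    have hle := norm_add_le
      (𝓕 (fun t => deriv w t * Complex.exp (Complex.I * (β * (Real.sqrt t : ℂ)))) ξ)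
      (Complex.I * β * 𝓕 (fun t => (w t * (((1 / (2 * Real.sqrt t) : ℝ)) : ℂ)) *
      Complex.exp (Complex.I * (β * (Real.sqrt t : ℂ)))) ξ)
    rw [hn] at hle
    have e2 : ‖Complex.I * (β : ℂ)‖ = |β| := by simp
    rw [norm_mul, e2] at hle
    have g1 := h1 β ξ
    have g2 := h2 β ξ
    set X1 := ‖𝓕 (fun t => deriv w t * Complex.exp (Complex.I * (β * (Real.sqrt t : ℂ)))) ξ‖
    set X2 := ‖𝓕 (fun t => (w t * (((1 / (2 * Real.sqrt t) : ℝ)) : ℂ)) *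
      Complex.exp (Complex.I * (β * (Real.sqrt t : ℂ)))) ξ‖
    set Y := ‖𝓕 (fun t => w t * Complex.exp (Complex.I * (β * (Real.sqrt t : ℂ)))) ξ‖
    have hY : 0 ≤ |ξ| * Y := by positivity
    have hpi : |ξ| * Y ≤ 2 * Real.pi * |ξ| * Y := by
      have := Real.pi_gt_three
      nlinarith
    have hpj : 0 ≤ |ξ| ^ j := by positivity
    have hb := abs_nonneg β
    have hbj : (0:ℝ) ≤ (1 + |β|) ^ j := by positivity
    calc |ξ| ^ (j + 1) * Y = |ξ| ^ j * (|ξ| * Y) := by ring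
      _ ≤ |ξ| ^ j * (X1 + |β| * X2) := by
          apply mul_le_mul_of_nonneg_left (hpi.trans hle) hpj
      _ = |ξ| ^ j * X1 + |β| * (|ξ| ^ j * X2) := by ring
      _ ≤ C1 * (1 + |β|) ^ j + |β| * (C2 * (1 + |β|) ^ j) := by gcongr
      _ ≤ C1 * (1 + |β|) ^ j * (1 + |β|) + (1 + |β|) * (C2 * (1 + |β|) ^ j) := by
          have q1 := mul_nonneg (mul_nonneg hC1 hbj) hb
          have q2 := mul_nonneg hC2 hbj
          nlinarith
      _ = _ := by ring

lemma fourier_shift (v : ℝ → ℂ) (α ξ : ℝ) :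
    𝓕 (fun t => v t * Complex.exp (2 * Real.pi * Complex.I * (α * t))) ξ = 𝓕 v (ξ - α) := by
  rw [Real.fourier_real_eq_integral_exp_smul, Real.fourier_real_eq_integral_exp_smul]
  congr 1; funext t
  simp only [smul_eq_mul]
  rw [mul_comm (v t), ← mul_assoc, ← Complex.exp_add]
  congr 2; push_cast; ring

lemma fourier_decay4 (v : ℝ → ℂ) (hv : ContDiff ℝ ∞ v)
    (hs : Function.support v ⊆ Set.Icc 1 2) : ∃ C, 0 ≤ C ∧ ∀ ξ : ℝ,
    ‖𝓕 v ξ‖ ≤ C / (1 + |ξ|) ^ 4 := by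
  obtain ⟨C0, h0, H0⟩ := fourier_phase_bound 0 v hv hs
  obtain ⟨C4, h4, H4⟩ := fourier_phase_bound 4 v hv hs
  refine ⟨8 * (C0 + C4), by positivity, fun ξ => ?_⟩
  have a := H0 0 ξ
  have b := H4 0 ξ
  simp only [pow_zero, Complex.ofReal_zero, zero_mul, mul_zero, Complex.exp_zero, mul_one,
    one_mul, abs_zero, add_zero, one_pow] at a b
  have hx := abs_nonneg ξ
  rw [le_div_iff₀ (by positivity)]
  have : (1 + |ξ|) ^ 4 ≤ 8 * (1 + |ξ| ^ 4) := by
    nlinarith [sq_nonneg (|ξ| - 1), sq_nonneg (|ξ|^2 - 1), sq_nonneg (|ξ|^2 - |ξ|),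
      mul_nonneg hx (sq_nonneg (|ξ| - 1))]
  calc _ ≤ ‖𝓕 v ξ‖ * (8 * (1 + |ξ| ^ 4)) := by gcongr
    _ = 8 * (‖𝓕 v ξ‖ + |ξ| ^ 4 * ‖𝓕 v ξ‖) := by ring
    _ ≤ _ := by gcongr


lemma tau_bound (η : ℝ) (hη : 0 < η) : ∃ C : ℝ, 0 ≤ C ∧ ∀ n : ℕ, n ≠ 0 →
    (n.divisors.card : ℝ) ≤ C * (n : ℝ) ^ η := by
  set δ : ℝ := 2 ^ η - 1 with hδ
  have hδ0 : 0 < δ := by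
    have := Real.one_lt_rpow (x := 2) (by norm_num) hη
    linarith
  set K : ℝ := 1 + 1 / δ with hK
  have hK1 : 1 ≤ K := by rw [hK]; have : 0 < 1 / δ := by positivity
                         linarith
  obtain ⟨P, hP⟩ := exists_nat_ge ((2:ℝ) ^ (1 / η))
  refine ⟨K ^ P, by positivity, fun n hn => ?_⟩
  rw [Nat.card_divisors hn]
  push_cast
  have hpt : ∀ p ∈ n.primeFactors, ((n.factorization p : ℝ) + 1) ≤
      (if p < P then K else 1) * ((p : ℝ) ^ (n.factorization p)) ^ η := by
    intro p hp
    have hpp := Nat.prime_of_mem_primeFactors hp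
    have hp2 : (2:ℝ) ≤ p := by exact_mod_cast hpp.two_le
    set e := n.factorization p
    have e1 : ((p : ℝ) ^ e) ^ η = ((p : ℝ) ^ η) ^ e := by
      rw [← Real.rpow_natCast, ← Real.rpow_natCast, ← Real.rpow_mul (by positivity),
        ← Real.rpow_mul (by positivity), mul_comm]
    rw [e1]
    split_ifs with hpP
    · have h2 : (2:ℝ) ^ η ≤ (p:ℝ) ^ η := Real.rpow_le_rpow (by norm_num) hp2 hη.le
      have h3 : 1 + (e:ℝ) * δ ≤ (1 + δ) ^ e := one_add_mul_le_pow (by linarith) e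
      have h4 : (1 + δ) ^ e ≤ ((p:ℝ) ^ η) ^ e := by
        apply pow_le_pow_left₀ (by linarith); linarith
      calc (e:ℝ) + 1 ≤ K * (1 + e * δ) := by
            rw [hK]
            have : (1 + 1 / δ) * (1 + e * δ) = 1 + e + e * δ + 1 / δ := by field_simp; ring
            rw [this]
            have : 0 ≤ e * δ := by positivity
            have : 0 ≤ 1 / δ := by positivity
            linarith
        _ ≤ _ := by gcongr; linarith
    · rw [one_mul]
      have hpP' : (P:ℝ) ≤ p := by exact_mod_cast not_lt.mp hpP
      have h2 : (2:ℝ) ≤ (p:ℝ) ^ η := by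
        calc (2:ℝ) = ((2:ℝ) ^ (1 / η)) ^ η := by
              rw [← Real.rpow_mul (by norm_num), one_div_mul_cancel hη.ne', Real.rpow_one]
          _ ≤ _ := Real.rpow_le_rpow (by positivity) (hP.trans hpP') hη.le
      calc (e:ℝ) + 1 ≤ 2 ^ e := by
            have := one_add_mul_le_pow (a := (1:ℝ)) (by norm_num) e
            norm_num at this; linarith
        _ ≤ _ := by gcongr
  refine (Finset.prod_le_prod (fun p _ => by positivity) hpt).trans ?_
  rw [Finset.prod_mul_distrib]
  have hA : ∏ p ∈ n.primeFactors, (if p < P then K else 1) ≤ K ^ P := by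
    rw [← Finset.prod_filter, Finset.prod_const]
    refine pow_le_pow_right₀ hK1 ?_
    calc _ ≤ (Finset.range P).card := Finset.card_le_card (by
          intro p hp; simpa using (Finset.mem_filter.mp hp).2)
      _ = P := by simp
  have hB : ∏ p ∈ n.primeFactors, ((p : ℝ) ^ (n.factorization p)) ^ η = (n:ℝ) ^ η := by
    rw [Real.finsetProd_rpow _ _ (fun p _ => by positivity)]
    congr 1
    have := Nat.prod_factorization_pow_eq_self hn
    conv_rhs => rw [← this]
    rw [Finsupp.prod, Nat.support_factorization]
    push_cast; rfl
  rw [hB]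
  gcongr

lemma sqDiv_natAbs (D : ℤ) : sqDiv D = sqDiv (D.natAbs : ℤ) := by
  unfold sqDiv
  simp [Int.natAbs_abs]

lemma sqDiv_avg (K : ℕ) : (∑ j ∈ Finset.Ioc 0 K, (sqDiv (j : ℤ) : ℝ)) ≤
    K * (1 + Real.log K) := by
  have h1 : ∀ j ∈ Finset.Ioc 0 K, (sqDiv (j : ℤ) : ℝ) ≤
      ∑ δ ∈ Finset.Icc 1 K, if δ ^ 2 ∣ j then (δ : ℝ) else 0 := by
    intro j hj
    rw [Finset.mem_Ioc] at hj
    unfold sqDiv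
    push_cast
    rw [← Finset.sum_filter]
    refine Finset.sum_le_sum_of_subset_of_nonneg ?_ (fun _ _ _ => by positivity)
    intro δ hδ
    rw [Finset.mem_filter, Finset.mem_range, Int.natAbs_natCast] at hδ
    have hd : δ ^ 2 ∣ j := by exact_mod_cast hδ.2
    rw [Finset.mem_filter, Finset.mem_Icc]
    refine ⟨⟨?_, by omega⟩, hd⟩
    rcases Nat.eq_zero_or_pos δ with h | h
    · subst h; simp at hd; omega
    · exact h
  refine (Finset.sum_le_sum h1).trans ?_
  rw [Finset.sum_comm]
  have h2 : ∀ δ ∈ Finset.Icc 1 K, (∑ j ∈ Finset.Ioc 0 K, if δ ^ 2 ∣ j then (δ : ℝ) else 0) ≤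
      K * (δ : ℝ)⁻¹ := by
    intro δ hδ
    have hδ1 : (0:ℝ) < δ := by exact_mod_cast (Finset.mem_Icc.mp hδ).1
    rw [← Finset.sum_filter, Finset.sum_const, nsmul_eq_mul, Nat.Ioc_filter_dvd_card_eq_div]
    have : ((K / δ ^ 2 : ℕ) : ℝ) ≤ K / (δ:ℝ) ^ 2 := by
      have := Nat.cast_div_le (α := ℝ) (m := K) (n := δ ^ 2)
      push_cast at this; exact this
    calc _ ≤ K / (δ:ℝ) ^ 2 * δ := by gcongr
      _ = _ := by field_simp
  refine (Finset.sum_le_sum h2).trans ?_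
  rw [← Finset.mul_sum]
  gcongr
  have := harmonic_le_one_add_log K
  rw [harmonic_eq_sum_Icc] at this
  push_cast at this
  exact this

lemma sqDiv_sum (l : ℤ) (R K : ℕ) (hK : l.natAbs ^ 2 + 4 * R ≤ K) :
    (∑ m ∈ (Finset.Icc 1 R).filter (fun m : ℕ => l ^ 2 - 4 * (m:ℤ) ≠ 0),
      (sqDiv (l ^ 2 - 4 * (m:ℤ)) : ℝ)) ≤ 2 * (K * (1 + Real.log K)) := by
  have key : ∀ T : Finset ℕ, (∀ m ∈ T, 1 ≤ m ∧ m ≤ R ∧ l ^ 2 - 4 * (m:ℤ) ≠ 0) →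
      (Set.InjOn (fun m : ℕ => (l ^ 2 - 4 * (m:ℤ)).natAbs) T) →
      (∑ m ∈ T, (sqDiv (l ^ 2 - 4 * (m:ℤ)) : ℝ)) ≤ K * (1 + Real.log K) := by
    intro T hT hinj
    refine le_trans (le_of_eq ?_) ((Finset.sum_le_sum_of_subset_of_nonneg
      (s := T.image (fun m : ℕ => (l ^ 2 - 4 * (m:ℤ)).natAbs)) (f := fun j : ℕ => (sqDiv (j:ℤ) : ℝ))
      ?_ (fun _ _ _ => by positivity)).trans (sqDiv_avg K))
    · rw [Finset.sum_image hinj]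
      refine Finset.sum_congr rfl fun m _ => ?_
      rw [sqDiv_natAbs]
    · intro j hj
      obtain ⟨m, hm, rfl⟩ := Finset.mem_image.mp hj
      obtain ⟨h1, h2, h3⟩ := hT m hm
      rw [Finset.mem_Ioc]
      have : ((l.natAbs ^ 2 : ℕ) : ℤ) = l ^ 2 := by push_cast; exact sq_abs l
      have h4 := sq_nonneg l
      generalize l.natAbs ^ 2 = a at *
      generalize l ^ 2 = b at *
      omega
  rw [← Finset.sum_filter_add_sum_filter_not _ (fun m : ℕ => 0 < l ^ 2 - 4 * (m:ℤ)), two_mul]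
  refine add_le_add (key _ ?_ ?_) (key _ ?_ ?_)
  · intro m hm
    simp only [Finset.mem_filter, Finset.mem_Icc] at hm
    exact ⟨hm.1.1.1, hm.1.1.2, hm.1.2⟩
  · intro m hm m' hm' h
    simp only [Finset.coe_filter, Finset.mem_filter, Finset.mem_Icc, Set.mem_ofPred_eq] at hm hm' h
    omega
  · intro m hm
    simp only [Finset.mem_filter, Finset.mem_Icc] at hm
    exact ⟨hm.1.1.1, hm.1.1.2, hm.1.2⟩
  · intro m hm m' hm' h
    simp only [Finset.coe_filter, Finset.mem_filter, Finset.mem_Icc, Set.mem_ofPred_eq] at hm hm' h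
    omega

lemma log_bound (θ : ℝ) (hθ : 0 < θ) (K : ℝ) (hK : 1 ≤ K) :
    K * (1 + Real.log K) ≤ (1 + 1 / θ) * K ^ (1 + θ) := by
  have h1 := Real.log_le_rpow_div (by linarith : 0 ≤ K) hθ
  have h2 : 1 ≤ K ^ θ := Real.one_le_rpow hK hθ.le
  rw [Real.rpow_add (by linarith), Real.rpow_one]
  have : 1 + Real.log K ≤ (1 + 1 / θ) * K ^ θ := by
    calc _ ≤ K ^ θ + K ^ θ / θ := by linarith
      _ = _ := by ring
  nlinarith

lemma sumS1 (η : ℝ) (hη : 0 < η) : ∃ C : ℝ, 0 ≤ C ∧ ∀ (q X : ℝ), 1 ≤ q → 0 < X → ∀ n : ℕ,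
    (∑ b ∈ Finset.range n, 1 / (q * ((b:ℝ) + 1)) * (X / (q * ((b:ℝ) + 1))) ^ η) ≤
      C * X ^ η / q := by
  have hs : Summable (fun b : ℕ => 1 / ((b:ℝ) + 1) ^ (1 + η)) := by
    have h := (summable_nat_add_iff 1).mpr
      (Real.summable_one_div_nat_rpow.mpr (by linarith : 1 < 1 + η))
    push_cast at h; exact h
  refine ⟨∑' b : ℕ, 1 / ((b:ℝ) + 1) ^ (1 + η), tsum_nonneg fun b => by positivity,
    fun q X hq hX n => ?_⟩
  have hq0 : 0 < q := by linarith
  have hpt : ∀ b ∈ Finset.range n, 1 / (q * ((b:ℝ) + 1)) * (X / (q * ((b:ℝ) + 1))) ^ η ≤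
      X ^ η / q * (1 / ((b:ℝ) + 1) ^ (1 + η)) := by
    intro b _
    rw [Real.div_rpow hX.le (by positivity), Real.mul_rpow hq0.le (by positivity),
      Real.rpow_add (by positivity), Real.rpow_one]
    have h1 : 1 ≤ q ^ η := Real.one_le_rpow hq hη.le
    have h2 : 0 < ((b:ℝ) + 1) ^ η := by positivity
    calc _ = X ^ η / q * (1 / (((b:ℝ) + 1) * ((b:ℝ) + 1) ^ η)) * (1 / q ^ η) := by
          field_simp
      _ ≤ X ^ η / q * (1 / (((b:ℝ) + 1) * ((b:ℝ) + 1) ^ η)) * 1 := by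
          gcongr
          rw [div_le_one (by positivity)]; exact h1
      _ = _ := by ring
  refine (Finset.sum_le_sum hpt).trans ?_
  rw [← Finset.mul_sum]
  calc _ ≤ X ^ η / q * ∑' b : ℕ, 1 / ((b:ℝ) + 1) ^ (1 + η) := by
        gcongr
        exact hs.sum_le_tsum _ (fun b _ => by positivity)
    _ = _ := by ring

lemma sumS2_step (Z : ℝ) (hZ : 0 < Z) (b : ℝ) (hb : 0 ≤ b) :
    (min 1 (Z / (b + 1))) ^ 4 / Real.sqrt (b + 1) ≤
      8 * (Real.sqrt (Z * (b + 1) / (Z + (b + 1))) - Real.sqrt (Z * b / (Z + b))) := by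
  set μ := min 1 (Z / (b + 1)) with hμ
  have hμ0 : 0 ≤ μ := by positivity
  have hμ1 : μ ≤ 1 := min_le_left _ _
  set ρ := Z / (Z + (b + 1)) with hρ
  have hρ0 : 0 < ρ := by positivity
  have hμρ : μ ≤ 2 * ρ := by
    rw [hρ]
    have h2 : μ ≤ Z / (b + 1) := min_le_right _ _
    rw [le_div_iff₀ (by positivity)] at h2
    rw [← mul_div_assoc, le_div_iff₀ (by positivity)]
    nlinarith
  have hμ4 : μ ^ 4 ≤ 4 * ρ ^ 2 := by
    have a : μ ^ 2 ≤ 1 := by nlinarith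
    have b : μ ^ 2 ≤ 4 * ρ ^ 2 := by nlinarith
    nlinarith [sq_nonneg μ]
  set r1 := Z * (b + 1) / (Z + (b + 1)) with hr1
  set r0 := Z * b / (Z + b) with hr0
  have hr1p : 0 < r1 := by positivity
  have hr0p : 0 ≤ r0 := by positivity
  have hdiff : ρ ^ 2 ≤ r1 - r0 := by
    have : r1 - r0 = Z ^ 2 / ((Z + (b + 1)) * (Z + b)) := by
      rw [hr1, hr0]; field_simp; ring
    rw [this, hρ, div_pow]
    gcongr
    nlinarith
  have hs1 := Real.sq_sqrt hr1p.le
  have hs0 := Real.sq_sqrt hr0p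
  have p1 : 0 < Real.sqrt r1 := Real.sqrt_pos.mpr hr1p
  have p0 := Real.sqrt_nonneg r0
  have hle : Real.sqrt r0 ≤ Real.sqrt r1 := Real.sqrt_le_sqrt (by nlinarith [sq_nonneg ρ])
  have hrb : Real.sqrt r1 ≤ Real.sqrt (b + 1) := by
    apply Real.sqrt_le_sqrt
    rw [hr1, div_le_iff₀ (by positivity)]
    nlinarith
  rw [div_le_iff₀ (by positivity)]
  have h5 : ρ ^ 2 ≤ 2 * (Real.sqrt r1 - Real.sqrt r0) * Real.sqrt r1 := by
    nlinarith
  have h6 : 2 * (Real.sqrt r1 - Real.sqrt r0) * Real.sqrt r1 ≤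
      2 * (Real.sqrt r1 - Real.sqrt r0) * Real.sqrt (b + 1) := by
    apply mul_le_mul_of_nonneg_left hrb; linarith
  linarith

lemma sumS2 (q X : ℝ) (hq : 1 ≤ q) (hX : 0 < X) (n : ℕ) :
    (∑ b ∈ Finset.range n, (min 1 (X / (q * ((b:ℝ) + 1)))) ^ 4 / Real.sqrt (q * ((b:ℝ) + 1))) ≤
      8 * Real.sqrt X / q := by
  have hq0 : 0 < q := by linarith
  have hZ : 0 < X / q := by positivity
  have hpt : ∀ b ∈ Finset.range n,
      (min 1 (X / (q * ((b:ℝ) + 1)))) ^ 4 / Real.sqrt (q * ((b:ℝ) + 1)) ≤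
      8 / Real.sqrt q * (Real.sqrt (X / q * (((b + 1 : ℕ) : ℝ)) / (X / q + ((b + 1 : ℕ) : ℝ))) -
        Real.sqrt (X / q * (b : ℝ) / (X / q + b))) := by
    intro b _
    have h := sumS2_step (X / q) hZ b (by positivity)
    rw [Real.sqrt_mul hq0.le, ← div_div X q]
    push_cast
    have hsq : 0 < Real.sqrt q := Real.sqrt_pos.mpr hq0
    calc _ = 1 / Real.sqrt q * (min 1 (X / q / ((b:ℝ) + 1)) ^ 4 / Real.sqrt ((b:ℝ) + 1)) := by
          field_simp
      _ ≤ _ := (mul_le_mul_of_nonneg_left h (by positivity)).trans (le_of_eq (by ring))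
  refine (Finset.sum_le_sum hpt).trans ?_
  rw [← Finset.mul_sum, Finset.sum_range_sub (fun b : ℕ => Real.sqrt (X / q * (b : ℝ) / (X / q + b)))]
  have hsq : 0 < Real.sqrt q := Real.sqrt_pos.mpr hq0
  simp only [Nat.cast_zero, mul_zero, zero_div, Real.sqrt_zero, sub_zero]
  have h1 : Real.sqrt (X / q * (n : ℝ) / (X / q + n)) ≤ Real.sqrt (X / q) := by
    apply Real.sqrt_le_sqrt
    rw [div_le_iff₀ (by positivity)]
    nlinarith [sq_nonneg (X / q)]
  calc _ ≤ 8 / Real.sqrt q * Real.sqrt (X / q) := by gcongr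
    _ = 8 * Real.sqrt X / q := by
        rw [Real.sqrt_div hX.le]
        have := Real.mul_self_sqrt hq0.le
        conv_rhs => rw [← this]
        field_simp

/-- `T1`. -/
lemma mu_T1 (u p : ℝ) (hu : 0 < u) (hp : p ≤ 4) :
    (min 1 u) ^ 8 * (1 + 1 / u) ^ p ≤ 16 * (min 1 u) ^ 4 := by
  set μ := min 1 u
  have hμ : 0 < μ := lt_min one_pos hu
  have h1 : μ * (1 + 1 / u) ≤ 2 := by
    have a : μ ≤ 1 := min_le_left _ _
    have b : μ / u ≤ 1 := (div_le_one hu).mpr (min_le_right _ _)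
    calc _ = μ + μ / u := by ring
      _ ≤ 2 := by linarith
  have hu1 : 0 < 1 / u := by positivity
  have h2 : (1 + 1 / u) ^ p ≤ (1 + 1 / u) ^ 4 := by
    rw [← Real.rpow_natCast]
    exact Real.rpow_le_rpow_of_exponent_le (by linarith) (by push_cast; exact hp)
  calc _ ≤ μ ^ 8 * (1 + 1 / u) ^ 4 := by gcongr
    _ = μ ^ 4 * (μ * (1 + 1 / u)) ^ 4 := by ring
    _ ≤ μ ^ 4 * 2 ^ 4 := by gcongr
    _ = _ := by ring

lemma mu_T3 (u η : ℝ) (hu : 0 < u) (h0 : 0 ≤ η) (h1 : η ≤ 1) : min 1 u ≤ u ^ η := by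
  rcases le_total 1 u with h | h
  · exact (min_le_left _ _).trans (Real.one_le_rpow h h0)
  · refine (min_le_right _ _).trans ?_
    have := Real.rpow_le_rpow_of_exponent_ge hu h h1
    rwa [Real.rpow_one] at this

lemma mu_T2 (X c η : ℝ) (hX : 0 < X) (hc : 0 < c) (h0 : 0 ≤ η) (h1 : η ≤ 1) :
    min 1 (X / c) * c ^ η ≤ X ^ η := by
  have := mu_T3 (X / c) η (by positivity) h0 h1
  calc _ ≤ (X / c) ^ η * c ^ η := by gcongr
    _ = _ := by rw [← Real.mul_rpow (by positivity) hc.le, div_mul_cancel₀ _ hc.ne']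

lemma summable_one_add_abs (s : ℝ) (hs : 1 < s) :
    Summable (fun y : ℤ => (1 + |(y:ℝ)|) ^ (-s)) := by
  have h1 := (Real.summable_abs_int_rpow hs).add
    (summable_of_finite_support (f := fun y : ℤ => if y = 0 then (1:ℝ) else 0)
      ((Set.finite_singleton 0).subset (by intro y hy; by_contra h; simp_all)))
  refine Summable.of_nonneg_of_le (fun y => by positivity) (fun y => ?_) h1
  by_cases hy : y = 0
  · subst hy
    simp only [Int.cast_zero, abs_zero, add_zero, Real.one_rpow, if_true]
    have := Real.rpow_nonneg (le_refl (0:ℝ)) (-s)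
    linarith
  · simp only [if_neg hy, add_zero]
    have : 0 < |(y:ℝ)| := by positivity
    exact Real.rpow_le_rpow_of_nonpos this (by linarith) (by linarith)

open scoped FourierTransform ContDiff

lemma min_sq_le_rpow (v : ℝ) (hv : 0 ≤ v) : min 1 (v ^ 2) ≤ v ^ ((5:ℝ) / 4) := by
  rcases le_total 1 v with h | h
  · exact (min_le_left _ _).trans (Real.one_le_rpow h (by norm_num))
  · rcases hv.eq_or_lt with h0 | h0
    · subst h0; refine (min_le_right _ _).trans ?_; simp
    · refine (min_le_right _ _).trans ?_
      have := Real.rpow_le_rpow_of_exponent_ge h0 h (show (5:ℝ) / 4 ≤ 2 by norm_num)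
      exact_mod_cast this

open Classical in
lemma caseM_A (W : ℝ → ℂ) (hW : ContDiff ℝ ∞ W) (hs : Function.support W ⊆ Set.Icc 1 2)
    (a ν : ℕ) (hν : 2 * a ≤ ν) : ∃ C : ℝ, 0 ≤ C ∧ ∀ (c : ℕ), 2 ≤ c → ∀ (n : ℕ) (M : ℝ), 1 ≤ M →
    ‖∑ m ∈ Finset.Icc 1 ⌊2 * M⌋₊, (W (m / M) * kloos m ((n:ℤ) ^ 2) c) *
      (besselJ ν (4 * Real.pi * n * Real.sqrt m / c) : ℂ)‖ ≤
    C * ((n * Real.sqrt M / c) ^ (2 * a) *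
      (M * ((1 + n * Real.sqrt M / c) * c / M) ^ ((5:ℝ) / 4))) := by
  obtain ⟨K, hK, hKb⟩ := bessel_transfer (2 * a) ν hν
  obtain ⟨hw, hws⟩ := smooth_mul_of_supp (φ := fun t : ℝ => (t : ℂ) ^ a) hW hs
    (fun t _ => ((Complex.ofRealCLM.contDiff).pow a).contDiffAt)
  obtain ⟨C0, hC0, H0⟩ := fourier_phase_bound 0 _ hw hws
  obtain ⟨C2, hC2, H2⟩ := fourier_phase_bound 2 _ hw hws
  set Zs := ∑' y : ℤ, |(y:ℝ)| ^ (-((5:ℝ) / 4)) with hZs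
  have hZ0 : 0 ≤ Zs := tsum_nonneg fun y => by positivity
  refine ⟨K * (13 ^ (2 * a) * ((C0 + C2) * 13 ^ ((5:ℝ) / 4) * Zs)), by positivity, ?_⟩
  intro c hc n M hM
  have : NeZero c := ⟨by omega⟩
  have hcr : (0:ℝ) < c := by exact_mod_cast (by omega : 0 < c)
  have hM0 : 0 < M := by linarith
  have hsM : 0 < Real.sqrt M := Real.sqrt_pos.mpr hM0
  set U := n * Real.sqrt M / c with hU
  have hU0 : 0 ≤ U := by positivity
  refine (hKb ℕ (Finset.Icc 1 ⌊2 * M⌋₊) (fun m => W (m / M) * kloos m ((n:ℤ) ^ 2) c)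
    (fun m => 4 * Real.pi * n * Real.sqrt m / c) (13 ^ (2 * a) * U ^ (2 * a) *
      (M * ((C0 + C2) * (13 ^ ((5:ℝ) / 4)  * ((1 + U) * c / M) ^ ((5:ℝ) / 4)) * Zs))) ?_).trans
        (le_of_eq (by ring))
  intro σ hσ
  set β : ℝ := -(4 * Real.pi * U * σ) with hβ
  have hβ13 : |β| ≤ 13 * U := by
    rw [hβ, abs_neg, abs_mul, abs_of_nonneg (by positivity : 0 ≤ 4 * Real.pi * U)]
    have := Real.pi_lt_d2
    have h1 : 4 * Real.pi * U * |σ| ≤ 4 * Real.pi * U * 1 := by gcongr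
    nlinarith
  set F : ℝ → ℂ := fun t => W t * (t : ℂ) ^ a *
    Complex.exp (Complex.I * (β * (Real.sqrt t : ℂ))) with hF
  obtain ⟨hFc, hFs⟩ := smooth_mul_of_supp hw hws (phase_smooth β)
  set b : ZMod c → ℂ := fun x =>
    if IsUnit x then ZMod.stdAddChar ((((n:ℤ)^2 : ℤ) : ZMod c) * x⁻¹) else 0 with hb
  have hterm : ∀ m ∈ Finset.Icc 1 ⌊2 * M⌋₊, (W (m / M) * kloos m ((n:ℤ) ^ 2) c) *
      (((4 * Real.pi * n * Real.sqrt m / c : ℝ) : ℂ) ^ (2 * a) *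
        Complex.exp (-(Complex.I * (((4 * Real.pi * n * Real.sqrt m / c : ℝ) : ℂ) * σ)))) =
      ((4 * Real.pi * U : ℝ) : ℂ) ^ (2 * a) * (F (m / M) *
        ∑ x : ZMod c, b x * ZMod.stdAddChar ((m : ZMod c) * x)) := by
    intro m _
    have hx : 4 * Real.pi * n * Real.sqrt m / c = 4 * Real.pi * U * Real.sqrt (m / M) := by
      rw [Real.sqrt_div (by positivity), hU]; field_simp
    have hpow : (((Real.sqrt (m / M) : ℝ)) : ℂ) ^ (2 * a) = (((m:ℝ) / M : ℝ) : ℂ) ^ a := by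
      rw [pow_mul]; congr 1
      exact_mod_cast Real.sq_sqrt (by positivity : 0 ≤ (m:ℝ) / M)
    rw [hx, kloos_eq_zmod]
    have hexp : Complex.exp (-(Complex.I * (((4 * Real.pi * U * Real.sqrt (m / M) : ℝ) : ℂ) * σ)))
        = Complex.exp (Complex.I * (β * (Real.sqrt (m / M) : ℂ))) := by
      congr 1; rw [hβ]; push_cast; ring
    rw [hexp, Complex.ofReal_mul, mul_pow, hpow]
    simp only [hF, hb, Int.cast_natCast]
    ring
  rw [Finset.sum_congr rfl hterm, ← Finset.mul_sum, norm_mul, norm_pow, Complex.norm_real,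
    Real.norm_of_nonneg (by positivity)]
  have hpoi := poisson_bound F hFc hFs c b M hM0
    (fun y => ((C0 + C2) * (13 * ((1 + U) * c / M)) ^ ((5:ℝ) / 4)) * |(y:ℝ)| ^ (-((5:ℝ) / 4)))
    ((Real.summable_abs_int_rpow (by norm_num)).mul_left _) ?_
  · rw [tsum_mul_left, ← hZs, Real.mul_rpow (by norm_num) (by positivity)] at hpoi
    have hpi : (4 * Real.pi * U) ^ (2 * a) ≤ 13 ^ (2 * a) * U ^ (2 * a) := by
      rw [← mul_pow]
      have := Real.pi_lt_d2
      gcongr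
      linarith
    exact mul_le_mul hpi hpoi (norm_nonneg _) (by positivity)
  · intro y
    by_cases hy : y = 0
    · subst hy
      have : b (-((0:ℤ) : ZMod c)) = 0 := by
        have : Fact (1 < c) := ⟨by omega⟩
        simp [hb]
      rw [this, norm_zero, zero_mul]
      positivity
    · have hb1 : ‖b (-(y : ZMod c))‖ ≤ 1 := by
        simp only [hb]
        split_ifs
        · rw [stdAddChar_norm]
        · simp
      have hy0 : 0 < |(y:ℝ)| := by positivity
      set ξ : ℝ := M * y / c with hξ
      have hξa : |ξ| = M * |(y:ℝ)| / c := by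
        rw [hξ, abs_div, abs_mul, abs_of_pos hM0, abs_of_pos hcr]
      have hξ0 : 0 < |ξ| := by rw [hξa]; positivity
      have h0 := H0 β ξ
      have h2 := H2 β ξ
      rw [pow_zero, pow_zero, one_mul, mul_one] at h0
      set v := (1 + |β|) / |ξ| with hv
      have hv0 : 0 ≤ v := by positivity
      have h2' : ‖𝓕 F ξ‖ ≤ C2 * v ^ 2 := by
        rw [hv, div_pow, ← mul_div_assoc, le_div_iff₀ (by positivity), mul_comm]
        exact h2
      have h3 : ‖𝓕 F ξ‖ ≤ (C0 + C2) * min 1 (v ^ 2) := by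
        rcases min_choice 1 (v ^ 2) with h | h <;> rw [h]
        · linarith [h0]
        · nlinarith [sq_nonneg v]
      have hvle : v ≤ 13 * ((1 + U) * c / M) * |(y:ℝ)|⁻¹ := by
        rw [hv, hξa]
        calc (1 + |β|) / (M * |(y:ℝ)| / c) ≤ (13 * (1 + U)) / (M * |(y:ℝ)| / c) := by
              gcongr; linarith
          _ = _ := by field_simp
      calc _ ≤ 1 * ((C0 + C2) * v ^ ((5:ℝ)/4)) := by
            refine mul_le_mul hb1 (h3.trans ?_) (norm_nonneg _) zero_le_one
            exact mul_le_mul_of_nonneg_left (min_sq_le_rpow v hv0) (by positivity)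
        _ ≤ (C0 + C2) * (13 * ((1 + U) * c / M) * |(y:ℝ)|⁻¹) ^ ((5:ℝ)/4) := by
            rw [one_mul]; gcongr
        _ = _ := by
            rw [Real.mul_rpow (by positivity) (by positivity), Real.inv_rpow hy0.le,
              ← Real.rpow_neg hy0.le]; ring

open scoped FourierTransform ContDiff

/-- The finite double sum for a fixed modulus. -/
noncomputable def Tsum (V W : ℝ → ℂ) (ν : ℕ) (N M : ℝ) (c : ℕ) : ℂ :=
  ∑ n ∈ Finset.Icc 1 ⌊2 * N⌋₊, ∑ m ∈ Finset.Icc 1 ⌊2 * M⌋₊, V (n / N) *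
    ((W (m / M) * kloos m ((n:ℤ) ^ 2) c) * (besselJ ν (4 * Real.pi * n * Real.sqrt m / c) : ℂ))

lemma bounded_of_supp {V : ℝ → ℂ} (hV : ContDiff ℝ ∞ V)
    (hs : Function.support V ⊆ Set.Icc 1 2) : ∃ B : ℝ, 0 ≤ B ∧ ∀ t, ‖V t‖ ≤ B := by
  obtain ⟨B, hB⟩ := hV.continuous.bounded_above_of_compact_support (cs_of_supp hs)
  exact ⟨B, (norm_nonneg _).trans (hB 0), hB⟩

lemma caseM_c (V W : ℝ → ℂ) (hV : ContDiff ℝ ∞ V) (hVs : Function.support V ⊆ Set.Icc 1 2)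
    (hW : ContDiff ℝ ∞ W) (hWs : Function.support W ⊆ Set.Icc 1 2) (ν : ℕ) (hν : 8 ≤ ν) :
    ∃ C : ℝ, 0 ≤ C ∧ ∀ (c : ℕ), 2 ≤ c → ∀ (N M : ℝ), 1 ≤ N → 1 ≤ M →
    ‖Tsum V W ν N M c‖ ≤ C * (N * ((min 1 (N * Real.sqrt M / c)) ^ 8 *
      (M * ((1 + N * Real.sqrt M / c) * c / M) ^ ((5:ℝ) / 4)))) := by
  obtain ⟨B, hB, hVB⟩ := bounded_of_supp hV hVs
  obtain ⟨C0, hC0, H0⟩ := caseM_A W hW hWs 0 ν (by omega)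
  obtain ⟨C8, hC8, H8⟩ := caseM_A W hW hWs 4 ν (by omega)
  refine ⟨2 * (B * ((C0 + C8) * (2 ^ 8 * 2 ^ ((5:ℝ) / 4)))), by positivity, ?_⟩
  intro c hc N M hN hM
  have hcr : (0:ℝ) < c := by exact_mod_cast (by omega : 0 < c)
  set u := N * Real.sqrt M / c with hu
  have hsM : 0 < Real.sqrt M := Real.sqrt_pos.mpr (by linarith)
  have hu0 : 0 < u := by rw [hu]; positivity
  set Bd := (min 1 u) ^ 8 * (M * ((1 + u) * c / M) ^ ((5:ℝ) / 4)) with hBd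
  have hBd0 : 0 ≤ Bd := by positivity
  unfold Tsum
  have hn : ∀ n ∈ Finset.Icc 1 ⌊2 * N⌋₊,
      ‖∑ m ∈ Finset.Icc 1 ⌊2 * M⌋₊, V (n / N) * ((W (m / M) * kloos m ((n:ℤ) ^ 2) c) *
        (besselJ ν (4 * Real.pi * n * Real.sqrt m / c) : ℂ))‖ ≤
      B * ((C0 + C8) * (2 ^ 8 * 2 ^ ((5:ℝ) / 4)) * Bd) := by
    intro n hn
    rw [Finset.mem_Icc] at hn
    have hn2 : (n:ℝ) ≤ 2 * N := (Nat.le_floor_iff (by positivity)).mp hn.2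
    rw [← Finset.mul_sum, norm_mul]
    refine mul_le_mul (hVB _) ?_ (norm_nonneg _) hB
    set U := n * Real.sqrt M / c with hU
    have hU0 : 0 ≤ U := by positivity
    have hUu : U ≤ 2 * u := by
      rw [hU, hu, ← mul_div_assoc, ← mul_assoc]; gcongr
    set D := M * ((1 + U) * c / M) ^ ((5:ℝ) / 4) with hD
    have hD0 : 0 ≤ D := by positivity
    have hDle : D ≤ 2 ^ ((5:ℝ)/4) * (M * ((1 + u) * c / M) ^ ((5:ℝ) / 4)) := by
      rw [hD]
      calc _ ≤ M * (2 * ((1 + u) * c / M)) ^ ((5:ℝ) / 4) := by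
            gcongr
            rw [← mul_div_assoc, ← mul_assoc]
            gcongr
            linarith
        _ = _ := by rw [Real.mul_rpow (by norm_num) (by positivity)]; ring
    have h0 := H0 c hc n M hM
    have h8 := H8 c hc n M hM
    rw [← hU, ← hD] at h0 h8
    rw [mul_zero, pow_zero, one_mul] at h0
    set S := ‖∑ m ∈ Finset.Icc 1 ⌊2 * M⌋₊, (W (m / M) * kloos m ((n:ℤ) ^ 2) c) *
        (besselJ ν (4 * Real.pi * n * Real.sqrt m / c) : ℂ)‖
    have hS : S ≤ (C0 + C8) * ((2 ^ 8 * (min 1 u) ^ 8) * D) := by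
      rcases le_total 1 u with h | h
      · rw [min_eq_left h]
        have : C0 * D ≤ C0 * ((2 ^ 8 * 1 ^ 8) * D) := by
          apply mul_le_mul_of_nonneg_left _ hC0; nlinarith
        have : 0 ≤ C8 * ((2 ^ 8 * 1 ^ 8) * D) := by positivity
        linarith
      · rw [min_eq_right h]
        have h1 : U ^ 8 ≤ 2 ^ 8 * u ^ 8 := by rw [← mul_pow]; gcongr
        have : C8 * (U ^ (2 * 4) * D) ≤ C8 * ((2 ^ 8 * u ^ 8) * D) := by gcongr
        have : 0 ≤ C0 * ((2 ^ 8 * u ^ 8) * D) := by positivity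
        linarith
    calc S ≤ _ := hS
      _ ≤ (C0 + C8) * ((2 ^ 8 * (min 1 u) ^ 8) *
          (2 ^ ((5:ℝ)/4) * (M * ((1 + u) * c / M) ^ ((5:ℝ) / 4)))) := by gcongr
      _ = _ := by rw [hBd]; ring
  refine (norm_sum_le _ _).trans ((Finset.sum_le_sum hn).trans ?_)
  rw [Finset.sum_const, nsmul_eq_mul, Nat.card_Icc, Nat.add_sub_cancel]
  have hfl : ((⌊2 * N⌋₊ : ℕ) : ℝ) ≤ 2 * N := Nat.floor_le (by positivity)
  calc _ ≤ 2 * N * (B * ((C0 + C8) * (2 ^ 8 * 2 ^ ((5:ℝ) / 4)) * Bd)) := by gcongr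
    _ = _ := by ring

lemma caseM_total (V W : ℝ → ℂ) (hV : ContDiff ℝ ∞ V) (hVs : Function.support V ⊆ Set.Icc 1 2)
    (hW : ContDiff ℝ ∞ W) (hWs : Function.support W ⊆ Set.Icc 1 2) (ν : ℕ) (hν : 8 ≤ ν) :
    ∃ C : ℝ, 0 ≤ C ∧ ∀ (q : ℕ), 2 ≤ q → ∀ (N M : ℝ), 1 ≤ N → 1 ≤ M → N ≤ M → ∀ n : ℕ,
    ∑ b ∈ Finset.range n, ‖Tsum V W ν N M ((b + 1) * q)‖ / (((b + 1) * q : ℕ) : ℝ) ≤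
      C * (N ^ ((3:ℝ)/2) * M ^ ((5:ℝ)/4)) / q := by
  obtain ⟨C, hC, H⟩ := caseM_c V W hV hVs hW hWs ν hν
  obtain ⟨C1, hC1, H1⟩ := sumS1 (1/16) (by norm_num)
  refine ⟨C * 16 * C1, by positivity, ?_⟩
  intro q hq N M hN hM hNM n
  have hN0 : 0 < N := by linarith
  have hM0 : 0 < M := by linarith
  have hsM : 0 < Real.sqrt M := Real.sqrt_pos.mpr hM0
  set X := N * Real.sqrt M with hX
  have hX0 : 0 < X := by positivity
  have hqr : (1:ℝ) ≤ q := by exact_mod_cast (by omega : 1 ≤ q)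
  have hpt : ∀ b ∈ Finset.range n,
      ‖Tsum V W ν N M ((b + 1) * q)‖ / (((b + 1) * q : ℕ) : ℝ) ≤
      C * 16 * (N * M * (X / M) ^ ((5:ℝ)/4)) *
        (1 / (q * ((b:ℝ) + 1)) * (X / (q * ((b:ℝ) + 1))) ^ ((1:ℝ)/16)) := by
    intro b _
    have hcast : (((b + 1) * q : ℕ) : ℝ) = q * ((b:ℝ) + 1) := by push_cast; ring
    have hc2 : 2 ≤ (b + 1) * q := by nlinarith
    have h := H ((b + 1) * q) hc2 N M hN hM
    rw [hcast] at h ⊢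
    rw [← hX] at h
    set c : ℝ := q * ((b:ℝ) + 1) with hc
    have hc0 : 0 < c := by positivity
    set u := X / c with hu
    have hu0 : 0 < u := by positivity
    have e1 : (1 + u) * c / M = (X / M) * (1 + 1 / u) := by
      rw [hu]; field_simp; ring
    rw [e1, Real.mul_rpow (by positivity) (by positivity)] at h
    have t1 := mu_T1 u (5/4) hu0 (by norm_num)
    have t3 := mu_T3 u (1/16) hu0 (by norm_num) (by norm_num)
    have hμ0 : 0 < min 1 u := lt_min one_pos hu0
    have hμ1 : min 1 u ≤ 1 := min_le_left _ _
    have t4 : (min 1 u) ^ 4 ≤ u ^ ((1:ℝ)/16) :=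
      (pow_le_of_le_one hμ0.le hμ1 (by norm_num)).trans t3
    rw [div_eq_mul_one_div]
    calc _ ≤ (C * (N * (min 1 u ^ 8 * (M * ((X / M) ^ ((5:ℝ) / 4) *
            (1 + 1 / u) ^ ((5:ℝ) / 4)))))) * (1 / c) := by gcongr
      _ = C * (N * M * (X / M) ^ ((5:ℝ)/4)) * (1 / c) *
            (min 1 u ^ 8 * (1 + 1 / u) ^ ((5:ℝ) / 4)) := by ring
      _ ≤ C * (N * M * (X / M) ^ ((5:ℝ)/4)) * (1 / c) * (16 * u ^ ((1:ℝ)/16)) := by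
          refine mul_le_mul_of_nonneg_left (by linarith) (by positivity)
      _ = _ := by ring
  refine (Finset.sum_le_sum hpt).trans ?_
  rw [← Finset.mul_sum]
  have h1 := H1 q X hqr hX0 n
  have hexp : N * M * (X / M) ^ ((5:ℝ)/4) * X ^ ((1:ℝ)/16) ≤
      N ^ ((3:ℝ)/2) * M ^ ((5:ℝ)/4) := by
    have eX : X = N * M ^ ((1:ℝ)/2) := by rw [hX, Real.sqrt_eq_rpow]
    rw [Real.div_rpow hX0.le hM0.le, eX, Real.mul_rpow hN0.le (by positivity),
      Real.mul_rpow hN0.le (by positivity), ← Real.rpow_mul hM0.le, ← Real.rpow_mul hM0.le]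
    have e : N * M * (N ^ ((5:ℝ)/4) * M ^ ((1:ℝ)/2 * (5/4)) / M ^ ((5:ℝ)/4)) *
        (N ^ ((1:ℝ)/16) * M ^ ((1:ℝ)/2 * (1/16))) =
        (N ^ (1:ℝ) * N ^ ((5:ℝ)/4) * N ^ ((1:ℝ)/16)) *
        (M ^ (1:ℝ) * M ^ ((1:ℝ)/2 * (5/4)) * M ^ (-((5:ℝ)/4)) * M ^ ((1:ℝ)/2 * (1/16))) := by
      rw [Real.rpow_neg hM0.le, Real.rpow_one, Real.rpow_one]; ring
    rw [e, ← Real.rpow_add hN0, ← Real.rpow_add hN0, ← Real.rpow_add hM0, ← Real.rpow_add hM0,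
      ← Real.rpow_add hM0]
    have e2 : N ^ ((1:ℝ) + 5/4 + 1/16) = N ^ ((3:ℝ)/2) * N ^ ((13:ℝ)/16) := by
      rw [← Real.rpow_add hN0]; norm_num
    have e3 : M ^ ((5:ℝ)/4) = M ^ ((13:ℝ)/16) * M ^ ((7:ℝ)/16) := by
      rw [← Real.rpow_add hM0]; norm_num
    rw [e2, e3]
    have h3 : N ^ ((13:ℝ)/16) ≤ M ^ ((13:ℝ)/16) := by gcongr
    have h4 : M ^ ((1:ℝ) + 1/2 * (5/4) + -(5/4) + 1/2 * (1/16)) ≤ M ^ ((7:ℝ)/16) :=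
      Real.rpow_le_rpow_of_exponent_le hM (by norm_num)
    calc _ = N ^ ((3:ℝ)/2) * (N ^ ((13:ℝ)/16) *
          M ^ ((1:ℝ) + 1/2 * (5/4) + -(5/4) + 1/2 * (1/16))) := by ring
      _ ≤ _ := by gcongr
  calc _ ≤ C * 16 * (N * M * (X / M) ^ ((5:ℝ)/4)) * (C1 * X ^ ((1:ℝ)/16) / q) := by
        gcongr
    _ = C * 16 * C1 * (N * M * (X / M) ^ ((5:ℝ)/4) * X ^ ((1:ℝ)/16)) / q := by ring
    _ ≤ _ := by gcongr

open scoped FourierTransform ContDiff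

lemma omega1 (L y s : ℝ) (hL : 1 ≤ L) (hy : 0 ≤ y) (h0 : 0 ≤ s) (h4 : s ≤ 4) :
    (L / (L + y)) ^ 4 ≤ L ^ s * (1 + y) ^ (-s) := by
  have hL0 : 0 < L := by linarith
  have h1 : L / (L + y) ≤ 1 := (div_le_one (by positivity)).mpr (by linarith)
  have h2 : (L / (L + y)) ^ 4 ≤ (L / (L + y)) ^ s := by
    rw [← Real.rpow_natCast]
    exact Real.rpow_le_rpow_of_exponent_ge (by positivity) h1 (by push_cast; exact h4)
  refine h2.trans ?_
  rw [Real.div_rpow hL0.le (by positivity), Real.rpow_neg (by positivity), div_eq_mul_inv]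
  gcongr

lemma omega2 (L y θ : ℝ) (hL : 1 ≤ L) (hy : 0 ≤ y) (h0 : 0 ≤ θ) (h4 : θ ≤ 1 / 2) :
    (L / (L + y)) ^ 4 * (L + y) ^ (2 + θ) ≤ L ^ (3 + 2 * θ) * (1 + y) ^ (-(1 + θ)) := by
  have hL0 : 0 < L := by linarith
  have hLy : 0 < L + y := by linarith
  have e : (L / (L + y)) ^ 4 * (L + y) ^ (2 + θ) =
      L ^ (4:ℝ) * ((L + y) ^ (-(1 - 2 * θ)) * (L + y) ^ (-(1 + θ))) := by
    rw [← Real.rpow_add hLy, div_pow, ← Real.rpow_natCast L, ← Real.rpow_natCast (L + y)]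
    have : (-(1 - 2 * θ) + -(1 + θ)) = (2 + θ) - (4:ℕ) := by push_cast; ring
    rw [this, Real.rpow_sub hLy]
    push_cast; ring
  rw [e]
  have h1 : (L + y) ^ (-(1 - 2 * θ)) ≤ L ^ (-(1 - 2 * θ)) :=
    Real.rpow_le_rpow_of_nonpos hL0 (by linarith) (by linarith)
  have h2 : (L + y) ^ (-(1 + θ)) ≤ (1 + y) ^ (-(1 + θ)) :=
    Real.rpow_le_rpow_of_nonpos (by linarith) (by linarith) (by linarith)
  have e2 : L ^ (3 + 2 * θ) = L ^ (4:ℝ) * L ^ (-(1 - 2 * θ)) := by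
    rw [← Real.rpow_add hL0]; congr 1; ring
  rw [e2, mul_assoc]
  gcongr

lemma caseN_A (V : ℝ → ℂ) (hV : ContDiff ℝ ∞ V) (hs : Function.support V ⊆ Set.Icc 1 2)
    (a ν : ℕ) (hν : a ≤ ν) : ∃ C : ℝ, 0 ≤ C ∧ ∀ (c : ℕ) [NeZero c] (m : ℕ) (N M L : ℝ), 1 ≤ N →
    1 ≤ M → (m : ℝ) ≤ 2 * M → L = Real.sqrt M + c / N → ∀ b : ZMod c → ℂ,
    (∀ n : ℤ, kloos m (n ^ 2) c = ∑ x : ZMod c, b x * ZMod.stdAddChar ((n : ZMod c) * x)) →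
    (∀ x, ‖b x‖ ≤ Real.sqrt (2 * c)) →
    ‖∑ n ∈ Finset.Icc 1 ⌊2 * N⌋₊, (V (n / N) * kloos m ((n:ℤ) ^ 2) c) *
      (besselJ ν (4 * Real.pi * n * Real.sqrt m / c) : ℂ)‖ ≤
    C * ((N * Real.sqrt M / c) ^ a *
      (N * ∑' y : ℤ, ‖b (-(y : ZMod c))‖ * (L / (L + |(y:ℝ)|)) ^ 4)) := by
  obtain ⟨K, hK, hKb⟩ := bessel_transfer a ν hν
  obtain ⟨hw, hws⟩ := smooth_mul_of_supp (φ := fun t : ℝ => (t : ℂ) ^ a) hV hs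
    (fun t _ => ((Complex.ofRealCLM.contDiff).pow a).contDiffAt)
  obtain ⟨C0, hC0, H0⟩ := fourier_decay4 _ hw hws
  refine ⟨K * (18 ^ a * (C0 * 5 ^ 4)), by positivity, ?_⟩
  intro c _ m N M L hN hM hm hL b hb hbb
  have hcr : (0:ℝ) < c := by exact_mod_cast Nat.pos_of_ne_zero (NeZero.ne c)
  have hM0 : 0 < M := by linarith
  have hN0 : 0 < N := by linarith
  have hsM : 1 ≤ Real.sqrt M := Real.one_le_sqrt.mpr hM
  have hL1 : 1 ≤ L := by rw [hL]; have : 0 < c / N := by positivity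
                         linarith
  set u := N * Real.sqrt M / c with hu
  have hu0 : 0 ≤ u := by positivity
  set U := N * Real.sqrt m / c with hU
  have hU0 : 0 ≤ U := by positivity
  have hsm : Real.sqrt m ≤ 1.42 * Real.sqrt M := by
    rw [Real.sqrt_le_left (by positivity), mul_pow, Real.sq_sqrt hM0.le]
    nlinarith
  have hUu : U ≤ 1.42 * u := by
    rw [hU, hu, ← mul_div_assoc]
    gcongr ?_ / _
    nlinarith
  set Sy := ∑' y : ℤ, ‖b (-(y : ZMod c))‖ * (L / (L + |(y:ℝ)|)) ^ 4 with hSy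
  have hsum : Summable (fun y : ℤ => ‖b (-(y : ZMod c))‖ * (L / (L + |(y:ℝ)|)) ^ 4) := by
    refine Summable.of_nonneg_of_le (fun y => by positivity) (fun y => ?_)
      ((summable_one_add_abs 2 (by norm_num)).mul_left (Real.sqrt (2 * c) * L ^ (2:ℝ)))
    rw [mul_assoc]
    exact mul_le_mul (hbb _) (omega1 L _ 2 hL1 (abs_nonneg _) (by norm_num) (by norm_num))
      (by positivity) (by positivity)
  refine (hKb ℕ (Finset.Icc 1 ⌊2 * N⌋₊) (fun n => V (n / N) * kloos m ((n:ℤ) ^ 2) c)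
    (fun n => 4 * Real.pi * n * Real.sqrt m / c) (18 ^ a * u ^ a *
      (N * ((C0 * 5 ^ 4) * Sy))) ?_).trans
        (le_of_eq (by ring))
  intro σ hσ
  set α : ℝ := -(2 * U * σ) with hα
  have hα4 : |α| ≤ 4 * u := by
    rw [hα, abs_neg, abs_mul, abs_of_nonneg (by positivity : 0 ≤ 2 * U)]
    have h1 : 2 * U * |σ| ≤ 2 * U * 1 := by gcongr
    linarith
  set F : ℝ → ℂ := fun t => V t * (t : ℂ) ^ a *
    Complex.exp (2 * Real.pi * Complex.I * (α * t)) with hF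
  obtain ⟨hFc, hFs⟩ := smooth_mul_of_supp
    (φ := fun t : ℝ => Complex.exp (2 * Real.pi * Complex.I * (α * t))) hw hws (fun t _ => by
      have h1 : ContDiff ℝ ∞ (fun t : ℝ => (t : ℂ)) := Complex.ofRealCLM.contDiff
      exact (contDiff_const.mul (contDiff_const.mul h1)).cexp.contDiffAt)
  have hterm : ∀ n ∈ Finset.Icc 1 ⌊2 * N⌋₊, (V (n / N) * kloos m ((n:ℤ) ^ 2) c) *
      (((4 * Real.pi * n * Real.sqrt m / c : ℝ) : ℂ) ^ a *
        Complex.exp (-(Complex.I * (((4 * Real.pi * n * Real.sqrt m / c : ℝ) : ℂ) * σ)))) =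
      ((4 * Real.pi * U : ℝ) : ℂ) ^ a * (F (n / N) *
        ∑ x : ZMod c, b x * ZMod.stdAddChar ((n : ZMod c) * x)) := by
    intro n _
    have hx : 4 * Real.pi * n * Real.sqrt m / c = 4 * Real.pi * U * (n / N) := by
      rw [hU]; field_simp
    rw [hx, hb n]
    have hexp : Complex.exp (-(Complex.I * (((4 * Real.pi * U * (n / N) : ℝ) : ℂ) * σ)))
        = Complex.exp (2 * Real.pi * Complex.I * (α * ((n / N : ℝ) : ℂ))) := by
      congr 1; rw [hα]; push_cast; ring
    rw [hexp, Complex.ofReal_mul, mul_pow]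
    simp only [hF, Int.cast_natCast]
    ring
  rw [Finset.sum_congr rfl hterm, ← Finset.mul_sum, norm_mul, norm_pow, Complex.norm_real,
    Real.norm_of_nonneg (by positivity)]
  have hpoi := poisson_bound F hFc hFs c b N hN0
    (fun y => (C0 * 5 ^ 4) * (‖b (-(y : ZMod c))‖ * (L / (L + |(y:ℝ)|)) ^ 4))
    (hsum.mul_left _) ?_
  · rw [tsum_mul_left, ← hSy] at hpoi
    have hpi : (4 * Real.pi * U) ^ a ≤ 18 ^ a * u ^ a := by
      rw [← mul_pow]
      have := Real.pi_lt_d2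
      refine pow_le_pow_left₀ (by positivity) ?_ a
      calc 4 * Real.pi * U ≤ 4 * 3.15 * (1.42 * u) := by gcongr
        _ ≤ 18 * u := by linarith
    exact mul_le_mul hpi hpoi (norm_nonneg _) (by positivity)
  · intro y
    set ξ : ℝ := N * y / c with hξ
    have h1 : ‖𝓕 F ξ‖ ≤ C0 / (1 + |ξ - α|) ^ 4 := by
      have := H0 (ξ - α)
      rw [← fourier_shift] at this
      exact this
    have hya : |(y:ℝ)| ≤ c / N * |ξ - α| + 4 * Real.sqrt M := by
      have e : (y:ℝ) = c / N * (ξ - α) + c / N * α := by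
        rw [hξ]; field_simp; ring
      have e2 : c / N * (4 * u) = 4 * Real.sqrt M := by rw [hu]; field_simp
      calc |(y:ℝ)| = |c / N * (ξ - α) + c / N * α| := by rw [← e]
        _ ≤ |c / N * (ξ - α)| + |c / N * α| := abs_add_le _ _
        _ = c / N * |ξ - α| + c / N * |α| := by
            rw [abs_mul, abs_mul, abs_of_pos (by positivity : 0 < (c:ℝ) / N)]
        _ ≤ c / N * |ξ - α| + c / N * (4 * u) := by gcongr
        _ = _ := by rw [e2]
    have hle : L + |(y:ℝ)| ≤ 5 * L * (1 + |ξ - α|) := by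
      have q0 := abs_nonneg (ξ - α)
      have q1 : c / N ≤ L := by rw [hL]; linarith
      have q2 : Real.sqrt M ≤ L := by rw [hL]; have : 0 < c / N := by positivity
                                      linarith
      have q3 : c / N * |ξ - α| ≤ L * |ξ - α| := by gcongr
      nlinarith [mul_nonneg (by linarith : 0 ≤ L) q0]
    have hL0 : 0 < L := by linarith
    have h2 : 1 / (1 + |ξ - α|) ≤ 5 * (L / (L + |(y:ℝ)|)) := by
      rw [← mul_div_assoc, div_le_div_iff₀ (by positivity) (by positivity)]
      linarith
    have h3 : C0 / (1 + |ξ - α|) ^ 4 ≤ C0 * (5 * (L / (L + |(y:ℝ)|))) ^ 4 := by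
      calc _ = C0 * (1 / (1 + |ξ - α|)) ^ 4 := by rw [div_pow, one_pow]; ring
        _ ≤ _ := by gcongr
    calc _ ≤ ‖b (-(y : ZMod c))‖ * (C0 * (5 * (L / (L + |(y:ℝ)|))) ^ 4) := by
          gcongr; exact h1.trans h3
      _ = _ := by ring

open scoped FourierTransform ContDiff

lemma bsum_bound : ∃ C : ℝ, 0 ≤ C ∧ ∀ (c : ℕ) [NeZero c] (M L : ℝ), 1 ≤ M → Real.sqrt M ≤ L →
    ∀ b : ℕ → ZMod c → ℂ, (∀ m x, ‖b m x‖ ≤ Real.sqrt (2 * c)) →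
    (∀ (m : ℕ) (l : ℤ), l ^ 2 - 4 * (m:ℤ) ≠ 0 →
      ‖b m l‖ ≤ (c.divisors.card : ℝ) ^ 2 * sqDiv (l ^ 2 - 4 * (m:ℤ))) →
    ∀ y : ℤ, ∑ m ∈ Finset.Icc 1 ⌊2 * M⌋₊, ‖b m (-(y : ZMod c))‖ ≤
      C * ((c.divisors.card : ℝ) ^ 2 * (L + |(y:ℝ)|) ^ ((2:ℝ) + 1 / 32) + Real.sqrt c) := by
  refine ⟨2 * ((1 + 1 / (1 / 64)) * 8 ^ ((1:ℝ) + 1 / 64)) + 2, by positivity, ?_⟩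
  intro c _ M L hM hL b hb1 hb2 y
  have hM0 : 0 < M := by linarith
  have hsM : 1 ≤ Real.sqrt M := Real.one_le_sqrt.mpr hM
  have hL1 : 1 ≤ L := by linarith
  set R := ⌊2 * M⌋₊ with hR
  have hRle : (R:ℝ) ≤ 2 * M := Nat.floor_le (by positivity)
  have hR1 : 1 ≤ R := by rw [hR, Nat.one_le_floor_iff]; linarith
  set τ := (c.divisors.card : ℝ) with hτ
  set K := (-y).natAbs ^ 2 + 4 * R with hK
  have hKr : (K:ℝ) ≤ 8 * (L + |(y:ℝ)|) ^ 2 := by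
    have e : (K:ℝ) = |(y:ℝ)| ^ 2 + 4 * R := by
      rw [hK]; push_cast; rw [Int.natAbs_neg, Nat.cast_natAbs]; push_cast; ring
    rw [e]
    have : M ≤ L ^ 2 := by
      rw [← Real.sq_sqrt hM0.le]; gcongr
    nlinarith [abs_nonneg (y:ℝ), mul_nonneg (by linarith : 0 ≤ L) (abs_nonneg (y:ℝ))]
  have hK1 : (1:ℝ) ≤ K := by exact_mod_cast (by omega : 1 ≤ K)
  have hy : (-(y : ZMod c)) = ((-y : ℤ) : ZMod c) := by push_cast; ring
  rw [hy]
  set l := -y with hl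
  have hLy : 0 < L + |(y:ℝ)| := by have := abs_nonneg (y:ℝ); linarith
  rw [← Finset.sum_filter_add_sum_filter_not _ (fun m : ℕ => l ^ 2 - 4 * (m:ℤ) ≠ 0)]
  have h1 : ∑ m ∈ (Finset.Icc 1 R).filter (fun m : ℕ => l ^ 2 - 4 * (m:ℤ) ≠ 0), ‖b m l‖ ≤
      τ ^ 2 * (2 * ((1 + 1 / (1 / 64)) * 8 ^ ((1:ℝ) + 1 / 64) *
        (L + |(y:ℝ)|) ^ ((2:ℝ) + 1 / 32))) := by
    calc _ ≤ ∑ m ∈ (Finset.Icc 1 R).filter (fun m : ℕ => l ^ 2 - 4 * (m:ℤ) ≠ 0),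
            τ ^ 2 * (sqDiv (l ^ 2 - 4 * (m:ℤ)) : ℝ) :=
          Finset.sum_le_sum (fun m hm => hb2 m l (Finset.mem_filter.mp hm).2)
      _ ≤ τ ^ 2 * (2 * (K * (1 + Real.log K))) := by
          rw [← Finset.mul_sum]
          exact mul_le_mul_of_nonneg_left (sqDiv_sum l R K le_rfl) (by positivity)
      _ ≤ _ := by
          refine mul_le_mul_of_nonneg_left ?_ (by positivity)
          refine mul_le_mul_of_nonneg_left ?_ (by positivity)
          refine (log_bound (1/64) (by norm_num) K hK1).trans ?_
          rw [mul_assoc]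
          refine mul_le_mul_of_nonneg_left ?_ (by norm_num)
          calc (K:ℝ) ^ ((1:ℝ) + 1 / 64) ≤ (8 * (L + |(y:ℝ)|) ^ 2) ^ ((1:ℝ) + 1 / 64) := by
                gcongr
            _ = _ := by
                rw [Real.mul_rpow (by norm_num) (by positivity), ← Real.rpow_natCast,
                  ← Real.rpow_mul hLy.le]
                norm_num
  have h2 : ∑ m ∈ (Finset.Icc 1 R).filter (fun m : ℕ => ¬ (l ^ 2 - 4 * (m:ℤ) ≠ 0)), ‖b m l‖ ≤
      2 * Real.sqrt c := by
    have hcard : ((Finset.Icc 1 R).filter (fun m : ℕ => ¬ (l ^ 2 - 4 * (m:ℤ) ≠ 0))).card ≤ 1 := by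
      rw [Finset.card_le_one]
      intro a ha d hd
      simp only [Finset.mem_filter, not_not] at ha hd
      omega
    calc _ ≤ ∑ m ∈ (Finset.Icc 1 R).filter (fun m : ℕ => ¬ (l ^ 2 - 4 * (m:ℤ) ≠ 0)),
          Real.sqrt (2 * c) := Finset.sum_le_sum (fun m _ => hb1 m l)
      _ ≤ 1 * Real.sqrt (2 * c) := by
          rw [Finset.sum_const, nsmul_eq_mul]; gcongr; exact_mod_cast hcard
      _ ≤ 2 * Real.sqrt c := by
          rw [one_mul, Real.sqrt_mul (by norm_num)]
          gcongr
          rw [Real.sqrt_le_left (by norm_num)]; norm_num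
  have p1 : 0 ≤ τ ^ 2 * (L + |(y:ℝ)|) ^ ((2:ℝ) + 1 / 32) := by positivity
  have p2 : 0 ≤ Real.sqrt c := Real.sqrt_nonneg _
  have p3 : (0:ℝ) ≤ 2 * ((1 + 1 / (1 / 64)) * 8 ^ ((1:ℝ) + 1 / 64)) := by positivity
  refine (add_le_add h1 h2).trans ?_
  have p4 := mul_nonneg p3 p2
  linarith

lemma caseN_c (V W : ℝ → ℂ) (hV : ContDiff ℝ ∞ V) (hVs : Function.support V ⊆ Set.Icc 1 2)
    (hW : ContDiff ℝ ∞ W) (hWs : Function.support W ⊆ Set.Icc 1 2) (ν : ℕ) (hν : 8 ≤ ν) :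
    ∃ C : ℝ, 0 ≤ C ∧ ∀ (c : ℕ) [NeZero c] (N M L : ℝ), 1 ≤ N → 1 ≤ M →
    L = Real.sqrt M + c / N →
    ‖Tsum V W ν N M c‖ ≤ C * (N * ((min 1 (N * Real.sqrt M / c)) ^ 8 *
      ((c.divisors.card : ℝ) ^ 2 * L ^ ((3:ℝ) + 2 * (1 / 32)) +
        Real.sqrt c * L ^ ((1:ℝ) + 1 / 32)))) := by
  obtain ⟨B, hB, hWB⟩ := bounded_of_supp hW hWs
  obtain ⟨C0, hC0, H0⟩ := caseN_A V hV hVs 0 ν (by omega)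
  obtain ⟨C8, hC8, H8⟩ := caseN_A V hV hVs 8 ν (by omega)
  obtain ⟨C1, hC1, H1⟩ := bsum_bound
  have hZs := summable_one_add_abs (1 + 1 / 32) (by norm_num)
  set Z := ∑' y : ℤ, (1 + |(y:ℝ)|) ^ (-((1:ℝ) + 1 / 32)) with hZ
  have hZ0 : 0 ≤ Z := tsum_nonneg (fun y => by positivity)
  refine ⟨B * ((C0 + C8) * (C1 * Z)), by positivity, ?_⟩
  intro c _ N M L hN hM hL
  have hcr : (0:ℝ) < c := by exact_mod_cast Nat.pos_of_ne_zero (NeZero.ne c)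
  have hM0 : 0 < M := by linarith
  have hN0 : 0 < N := by linarith
  have hsM : 1 ≤ Real.sqrt M := Real.one_le_sqrt.mpr hM
  have hcN : 0 < c / N := by positivity
  have hL1 : 1 ≤ L := by rw [hL]; linarith
  have hLM : Real.sqrt M ≤ L := by rw [hL]; linarith
  choose b hb using fun m : ℕ => kloos_fourier c (m:ℤ)
  set u := N * Real.sqrt M / c with hu
  have hu0 : 0 < u := by rw [hu]; positivity
  set τ := (c.divisors.card : ℝ) with hτ
  have hsum : ∀ m, Summable (fun y : ℤ => ‖b m (-(y : ZMod c))‖ * (L / (L + |(y:ℝ)|)) ^ 4) := by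
    intro m
    refine Summable.of_nonneg_of_le (fun y => by positivity) (fun y => ?_)
      ((summable_one_add_abs 2 (by norm_num)).mul_left (Real.sqrt (2 * c) * L ^ (2:ℝ)))
    rw [mul_assoc]
    exact mul_le_mul ((hb m).2.1 _) (omega1 L _ 2 hL1 (abs_nonneg _) (by norm_num) (by norm_num))
      (by positivity) (by positivity)
  have hbs := H1 c M L hM hLM b (fun m => (hb m).2.1) (fun m => (hb m).2.2)
  set D := fun m : ℕ => ∑' y : ℤ, ‖b m (-(y : ZMod c))‖ * (L / (L + |(y:ℝ)|)) ^ 4 with hD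
  have hD0 : ∀ m, 0 ≤ D m := fun m => tsum_nonneg (fun y => by positivity)
  set E := τ ^ 2 * L ^ ((3:ℝ) + 2 * (1 / 32)) + Real.sqrt c * L ^ ((1:ℝ) + 1 / 32) with hE
  have hDs : ∑ m ∈ Finset.Icc 1 ⌊2 * M⌋₊, D m ≤ C1 * Z * E := by
    rw [hD, ← Summable.tsum_finsetSum (fun m _ => hsum m)]
    have hpt : ∀ y : ℤ, ∑ m ∈ Finset.Icc 1 ⌊2 * M⌋₊,
        ‖b m (-(y : ZMod c))‖ * (L / (L + |(y:ℝ)|)) ^ 4 ≤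
        C1 * E * (1 + |(y:ℝ)|) ^ (-((1:ℝ) + 1 / 32)) := by
      intro y
      have hy := abs_nonneg (y:ℝ)
      have o1 := omega1 L |(y:ℝ)| (1 + 1/32) hL1 hy (by norm_num) (by norm_num)
      have o2 := omega2 L |(y:ℝ)| (1/32) hL1 hy (by norm_num) (by norm_num)
      rw [← Finset.sum_mul]
      calc _ ≤ C1 * (τ ^ 2 * (L + |(y:ℝ)|) ^ ((2:ℝ) + 1 / 32) + Real.sqrt c) *
            (L / (L + |(y:ℝ)|)) ^ 4 := mul_le_mul_of_nonneg_right (hbs y) (by positivity)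
        _ = C1 * (τ ^ 2 * ((L / (L + |(y:ℝ)|)) ^ 4 * (L + |(y:ℝ)|) ^ ((2:ℝ) + 1 / 32)) +
              Real.sqrt c * (L / (L + |(y:ℝ)|)) ^ 4) := by ring
        _ ≤ C1 * (τ ^ 2 * (L ^ ((3:ℝ) + 2 * (1 / 32)) * (1 + |(y:ℝ)|) ^ (-((1:ℝ) + 1 / 32))) +
              Real.sqrt c * (L ^ ((1:ℝ) + 1 / 32) * (1 + |(y:ℝ)|) ^ (-((1:ℝ) + 1 / 32)))) := by
            gcongr
        _ = _ := by rw [hE]; ring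
    calc _ ≤ ∑' y : ℤ, C1 * E * (1 + |(y:ℝ)|) ^ (-((1:ℝ) + 1 / 32)) :=
          Summable.tsum_le_tsum hpt (summable_sum (fun m _ => hsum m)) (hZs.mul_left _)
      _ = _ := by rw [tsum_mul_left, ← hZ]; ring
  have hT : Tsum V W ν N M c = ∑ m ∈ Finset.Icc 1 ⌊2 * M⌋₊, W (m / M) *
      ∑ n ∈ Finset.Icc 1 ⌊2 * N⌋₊, (V (n / N) * kloos m ((n:ℤ) ^ 2) c) *
        (besselJ ν (4 * Real.pi * n * Real.sqrt m / c) : ℂ) := by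
    unfold Tsum
    rw [Finset.sum_comm]
    refine Finset.sum_congr rfl (fun m _ => ?_)
    rw [Finset.mul_sum]
    refine Finset.sum_congr rfl (fun n _ => ?_)
    ring
  rw [hT]
  have hm : ∀ m ∈ Finset.Icc 1 ⌊2 * M⌋₊,
      ‖W (m / M) * ∑ n ∈ Finset.Icc 1 ⌊2 * N⌋₊, (V (n / N) * kloos m ((n:ℤ) ^ 2) c) *
        (besselJ ν (4 * Real.pi * n * Real.sqrt m / c) : ℂ)‖ ≤
      B * ((C0 + C8) * ((min 1 u) ^ 8 * N)) * D m := by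
    intro m hm
    rw [Finset.mem_Icc] at hm
    have hm2 : (m:ℝ) ≤ 2 * M := (Nat.le_floor_iff (by positivity)).mp hm.2
    rw [norm_mul]
    have h0 := H0 c m N M L hN hM hm2 hL (b m) (hb m).1 (hb m).2.1
    have h8 := H8 c m N M L hN hM hm2 hL (b m) (hb m).1 (hb m).2.1
    rw [← hu] at h0 h8
    rw [pow_zero, one_mul] at h0
    have hDm := hD0 m
    change _ ≤ C0 * (N * D m) at h0
    change _ ≤ C8 * (u ^ 8 * (N * D m)) at h8
    set S := ‖∑ n ∈ Finset.Icc 1 ⌊2 * N⌋₊, (V (n / N) * kloos m ((n:ℤ) ^ 2) c) *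
        (besselJ ν (4 * Real.pi * n * Real.sqrt m / c) : ℂ)‖
    have hS : S ≤ (C0 + C8) * ((min 1 u) ^ 8 * (N * D m)) := by
      rcases le_total 1 u with h | h
      · rw [min_eq_left h]
        have : 0 ≤ C8 * (N * D m) := by positivity
        linarith
      · rw [min_eq_right h]
        have : 0 ≤ C0 * (u ^ 8 * (N * D m)) := by positivity
        linarith
    calc ‖W (m / M)‖ * S ≤ B * ((C0 + C8) * ((min 1 u) ^ 8 * (N * D m))) :=
          mul_le_mul (hWB _) hS (norm_nonneg _) hB
      _ = _ := by ring
  have hμ0 : 0 < min 1 u := lt_min one_pos hu0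
  refine (norm_sum_le _ _).trans ((Finset.sum_le_sum hm).trans ?_)
  rw [← Finset.mul_sum]
  calc _ ≤ B * ((C0 + C8) * ((min 1 u) ^ 8 * N)) * (C1 * Z * E) := by gcongr
    _ = _ := by ring

open scoped FourierTransform ContDiff

lemma caseN_total (V W : ℝ → ℂ) (hV : ContDiff ℝ ∞ V) (hVs : Function.support V ⊆ Set.Icc 1 2)
    (hW : ContDiff ℝ ∞ W) (hWs : Function.support W ⊆ Set.Icc 1 2) (ν : ℕ) (hν : 8 ≤ ν) :
    ∃ C : ℝ, 0 ≤ C ∧ ∀ (q : ℕ), 2 ≤ q → ∀ (N M : ℝ), 1 ≤ N → 1 ≤ M → M ≤ N → ∀ n : ℕ,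
    ∑ b ∈ Finset.range n, ‖Tsum V W ν N M ((b + 1) * q)‖ / (((b + 1) * q : ℕ) : ℝ) ≤
      C * (N ^ ((3:ℝ)/2) * M ^ ((5:ℝ)/4)) / q := by
  obtain ⟨C, hC, H⟩ := caseN_c V W hV hVs hW hWs ν hν
  obtain ⟨C1, hC1, H1⟩ := sumS1 (1/32) (by norm_num)
  obtain ⟨Ct, hCt, Ht⟩ := tau_bound (1/64) (by norm_num)
  refine ⟨C * 16 * (Ct ^ 2 * C1) + C * 16 * 8, by positivity, ?_⟩
  intro q hq N M hN hM hMN n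
  have hN0 : 0 < N := by linarith
  have hM0 : 0 < M := by linarith
  have hsM : 0 < Real.sqrt M := Real.sqrt_pos.mpr hM0
  set X := N * Real.sqrt M with hX
  have hX0 : 0 < X := by positivity
  have hqr : (1:ℝ) ≤ q := by exact_mod_cast (by omega : 1 ≤ q)
  set A1 := N * Real.sqrt M ^ ((3:ℝ) + 2 * (1 / 32)) with hA1
  set A2 := N * Real.sqrt M ^ ((1:ℝ) + 1 / 32) with hA2
  have hpt : ∀ b ∈ Finset.range n,
      ‖Tsum V W ν N M ((b + 1) * q)‖ / (((b + 1) * q : ℕ) : ℝ) ≤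
      C * 16 * (Ct ^ 2 * A1 * X ^ ((1:ℝ)/32)) *
        (1 / (q * ((b:ℝ) + 1)) * (X / (q * ((b:ℝ) + 1))) ^ ((1:ℝ)/32)) +
      C * 16 * A2 * ((min 1 (X / (q * ((b:ℝ) + 1)))) ^ 4 / Real.sqrt (q * ((b:ℝ) + 1))) := by
    intro b _
    have hcast : (((b + 1) * q : ℕ) : ℝ) = q * ((b:ℝ) + 1) := by push_cast; ring
    have hc0' : (b + 1) * q ≠ 0 := by positivity
    haveI : NeZero ((b + 1) * q) := ⟨hc0'⟩
    have h := H ((b + 1) * q) N M _ hN hM rfl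
    have ht := Ht ((b + 1) * q) hc0'
    set τ := ((((b + 1) * q).divisors.card : ℕ) : ℝ) with hτ
    rw [hcast] at h ht ⊢
    rw [← hX] at h
    set c : ℝ := q * ((b:ℝ) + 1) with hc
    have hc0 : 0 < c := by positivity
    set u := X / c with hu
    have hu0 : 0 < u := by positivity
    have e1 : Real.sqrt M + c / N = Real.sqrt M * (1 + 1 / u) := by
      rw [hu, hX]; field_simp
    rw [e1, Real.mul_rpow (by positivity) (by positivity),
      Real.mul_rpow (by positivity) (by positivity)] at h
    have t1 := mu_T1 u ((3:ℝ) + 2 * (1 / 32)) hu0 (by norm_num)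
    have t1' := mu_T1 u ((1:ℝ) + 1 / 32) hu0 (by norm_num)
    have t3 := mu_T3 u (1/32) hu0 (by norm_num) (by norm_num)
    have t2 := mu_T2 X c (1/32) hX0 hc0 (by norm_num) (by norm_num)
    rw [← hu] at t2
    have hμ0 : 0 < min 1 u := lt_min one_pos hu0
    have hμ1 : min 1 u ≤ 1 := min_le_left _ _
    set μ := min 1 u with hμ
    have ht2 : τ ^ 2 ≤ Ct ^ 2 * c ^ ((1:ℝ)/32) := by
      calc τ ^ 2 ≤ (Ct * c ^ ((1:ℝ)/64)) ^ 2 := by gcongr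
        _ = _ := by
          rw [mul_pow, ← Real.rpow_natCast (c ^ ((1:ℝ)/64)), ← Real.rpow_mul hc0.le]; norm_num
    have t4 : μ ^ 4 * c ^ ((1:ℝ)/32) ≤ u ^ ((1:ℝ)/32) * X ^ ((1:ℝ)/32) := by
      have : μ ^ 4 ≤ μ * μ := by
        rw [← sq]; exact pow_le_pow_of_le_one hμ0.le hμ1 (by norm_num)
      calc _ ≤ (μ * μ) * c ^ ((1:ℝ)/32) := by gcongr
        _ = μ * (μ * c ^ ((1:ℝ)/32)) := by ring
        _ ≤ _ := by gcongr
    have hsc : Real.sqrt c * (1 / c) = 1 / Real.sqrt c := by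
      have hs : 0 < Real.sqrt c := Real.sqrt_pos.mpr hc0
      have : c = Real.sqrt c * Real.sqrt c := (Real.mul_self_sqrt hc0.le).symm
      field_simp
      rw [sq]; exact this.symm
    rw [div_eq_mul_one_div]
    calc _ ≤ (C * (N * (μ ^ 8 * (τ ^ 2 * (Real.sqrt M ^ ((3:ℝ) + 2 * (1 / 32)) *
            (1 + 1 / u) ^ ((3:ℝ) + 2 * (1 / 32))) + Real.sqrt c *
            (Real.sqrt M ^ ((1:ℝ) + 1 / 32) * (1 + 1 / u) ^ ((1:ℝ) + 1 / 32)))))) * (1 / c) := by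
            gcongr
      _ = C * A1 * (1 / c) * (τ ^ 2 * (μ ^ 8 * (1 + 1 / u) ^ ((3:ℝ) + 2 * (1 / 32)))) +
            C * A2 * (Real.sqrt c * (1 / c)) * (μ ^ 8 * (1 + 1 / u) ^ ((1:ℝ) + 1 / 32)) := by
            rw [hA1, hA2]; ring
      _ ≤ C * A1 * (1 / c) * ((Ct ^ 2 * c ^ ((1:ℝ)/32)) * (16 * μ ^ 4)) +
            C * A2 * (Real.sqrt c * (1 / c)) * (16 * μ ^ 4) := by gcongr
      _ = C * 16 * (Ct ^ 2 * A1) * (1 / c) * (μ ^ 4 * c ^ ((1:ℝ)/32)) +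
            C * 16 * A2 * (μ ^ 4 / Real.sqrt c) := by rw [hsc]; ring
      _ ≤ C * 16 * (Ct ^ 2 * A1) * (1 / c) * (u ^ ((1:ℝ)/32) * X ^ ((1:ℝ)/32)) +
            C * 16 * A2 * (μ ^ 4 / Real.sqrt c) := by gcongr
      _ = _ := by ring
  refine (Finset.sum_le_sum hpt).trans ?_
  rw [Finset.sum_add_distrib, ← Finset.mul_sum, ← Finset.mul_sum]
  have h1 := H1 q X hqr hX0 n
  have h2 := sumS2 q X hqr hX0 n
  have eX : X = N * M ^ ((1:ℝ)/2) := by rw [hX, Real.sqrt_eq_rpow]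
  have x1 : A1 * X ^ ((1:ℝ)/32) * X ^ ((1:ℝ)/32) ≤ N ^ ((3:ℝ)/2) * M ^ ((5:ℝ)/4) := by
    have e : A1 * X ^ ((1:ℝ)/32) * X ^ ((1:ℝ)/32) = N ^ ((17:ℝ)/16) * M ^ ((25:ℝ)/16) := by
      rw [hA1, eX, Real.mul_rpow hN0.le (by positivity), Real.sqrt_eq_rpow,
        ← Real.rpow_mul hM0.le, ← Real.rpow_mul hM0.le]
      calc _ = (N ^ (1:ℝ) * N ^ ((1:ℝ)/32) * N ^ ((1:ℝ)/32)) *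
            (M ^ ((1:ℝ)/2 * (3 + 2 * (1/32))) * M ^ ((1:ℝ)/2 * (1/32)) *
              M ^ ((1:ℝ)/2 * (1/32))) := by rw [Real.rpow_one]; ring
        _ = _ := by
          rw [← Real.rpow_add hN0, ← Real.rpow_add hN0, ← Real.rpow_add hM0, ← Real.rpow_add hM0]
          norm_num
    rw [e]
    calc _ = N ^ ((17:ℝ)/16) * (M ^ ((5:ℝ)/16) * M ^ ((5:ℝ)/4)) := by
          rw [← Real.rpow_add hM0]; norm_num
      _ ≤ N ^ ((17:ℝ)/16) * (N ^ ((7:ℝ)/16) * M ^ ((5:ℝ)/4)) := by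
          gcongr
          calc M ^ ((5:ℝ)/16) ≤ M ^ ((7:ℝ)/16) :=
                Real.rpow_le_rpow_of_exponent_le hM (by norm_num)
            _ ≤ _ := by gcongr
      _ = _ := by rw [← mul_assoc, ← Real.rpow_add hN0]; norm_num
  have x2 : A2 * Real.sqrt X ≤ N ^ ((3:ℝ)/2) * M ^ ((5:ℝ)/4) := by
    have e : A2 * Real.sqrt X = N ^ ((3:ℝ)/2) * M ^ ((49:ℝ)/64) := by
      rw [hA2, Real.sqrt_eq_rpow X, eX, Real.mul_rpow hN0.le (by positivity), Real.sqrt_eq_rpow,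
        ← Real.rpow_mul hM0.le, ← Real.rpow_mul hM0.le]
      calc _ = (N ^ (1:ℝ) * N ^ ((1:ℝ)/2)) *
            (M ^ ((1:ℝ)/2 * (1 + 1/32)) * M ^ ((1:ℝ)/2 * (1/2))) := by rw [Real.rpow_one]; ring
        _ = _ := by
          rw [← Real.rpow_add hN0, ← Real.rpow_add hM0]
          norm_num
    rw [e]
    gcongr ?_ * ?_
    exact Real.rpow_le_rpow_of_exponent_le hM (by norm_num)
  calc _ ≤ C * 16 * (Ct ^ 2 * A1 * X ^ ((1:ℝ)/32)) * (C1 * X ^ ((1:ℝ)/32) / q) +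
        C * 16 * A2 * (8 * Real.sqrt X / q) := by gcongr
    _ = C * 16 * (Ct ^ 2 * C1) * (A1 * X ^ ((1:ℝ)/32) * X ^ ((1:ℝ)/32)) / q +
        C * 16 * 8 * (A2 * Real.sqrt X) / q := by ring
    _ ≤ C * 16 * (Ct ^ 2 * C1) * (N ^ ((3:ℝ)/2) * M ^ ((5:ℝ)/4)) / q +
        C * 16 * 8 * (N ^ ((3:ℝ)/2) * M ^ ((5:ℝ)/4)) / q := by gcongr
    _ = _ := by ring

open scoped FourierTransform ContDiff

lemma besselJ_small (ν : ℕ) (hν : 8 ≤ ν) : ∃ K : ℝ, 0 ≤ K ∧ ∀ x : ℝ, |besselJ ν x| ≤ K * |x| ^ 8 := by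
  obtain ⟨K, hK, H⟩ := bessel_transfer 8 ν hν
  refine ⟨K, hK, fun x => ?_⟩
  have h := H Unit Finset.univ (fun _ => 1) (fun _ => x) (|x| ^ 8) (fun σ _ => by
    have e : Complex.exp (-(Complex.I * (x * σ))) = Complex.exp (((-(x * σ) : ℝ) : ℂ) * Complex.I) := by
      congr 1; push_cast; ring
    simp only [Finset.univ_unique, Finset.sum_singleton, one_mul]
    rw [norm_mul, e, Complex.norm_exp_ofReal_mul_I, norm_pow, Complex.norm_real, Real.norm_eq_abs,
      mul_one])
  simpa using h

lemma tsum_pnat_fin (h : ℕ → ℂ) (R : ℕ) (h0 : ∀ n, R < n → h n = 0) :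
    ∑' n : ℕ+, h n = ∑ n ∈ Finset.Icc 1 R, h n := by
  rw [tsum_pnat_eq_tsum_succ (f := h), tsum_eq_sum (s := Finset.range R)]
  · rw [Finset.range_eq_Ico, Finset.sum_Ico_add' h 0 R 1]
    rfl
  · intro b hb
    apply h0
    simp at hb; omega

lemma vanish_of_supp {V : ℝ → ℝ} (hs : Function.support V ⊆ Set.Icc 1 2) (N : ℝ) (hN : 1 ≤ N)
    (n : ℕ) (hn : ⌊2 * N⌋₊ < n) : V ((n:ℝ) / N) = 0 := by
  by_contra h
  have h1 := (hs (Function.mem_support.mpr h)).2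
  rw [div_le_iff₀ (by linarith)] at h1
  exact absurd (Nat.le_floor h1) (by omega)

lemma summable_fin_pnat (f : ℕ → ℝ) (R : ℕ) (h0 : ∀ n, R < n → f n = 0) :
    Summable (fun n : ℕ+ => f n) := by
  have : Summable f := summable_of_ne_finset_zero (s := Finset.range (R + 1)) (fun n hn => by
    apply h0; simp at hn; omega)
  exact this.comp_injective PNat.coe_injective

theorem statement12 (k : ℕ) (hk : Even k) (hk1000 : 1000 < k) (ε : ℝ) (hε : 0 < ε)
    (𝒱 𝒲 : ℝ → ℝ) (h𝒱 : ContDiff ℝ (⊤ : ℕ∞) 𝒱) (h𝒲 : ContDiff ℝ (⊤ : ℕ∞) 𝒲)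
    (h𝒱s : Function.support 𝒱 ⊆ Set.Icc 1 2) (h𝒲s : Function.support 𝒲 ⊆ Set.Icc 1 2) :
    ∃ C : ℝ, ∀ q : ℕ, q.Prime → ∀ N M : ℝ, 1 ≤ N → 1 ≤ M →
      Summable (fun p : ℕ+ × ℕ+ × ℕ+ =>
        ‖(𝒱 ((p.1 : ℝ) / N) : ℂ) * (𝒲 ((p.2.1 : ℝ) / M) : ℂ) *
          (kloos (p.2.1 : ℤ) ((p.1 : ℤ) ^ 2) ((p.2.2 : ℕ) * q) / (((p.2.2 : ℕ) * q : ℕ) : ℂ)) *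
          (besselJ (k - 1)
            (4 * Real.pi * (p.1 : ℝ) * Real.sqrt (p.2.1 : ℝ) / (((p.2.2 : ℕ) * q : ℕ) : ℝ)) : ℂ)‖) ∧
      (N * M) ^ (-(1 : ℝ) / 2) *
          ‖∑' p : ℕ+ × ℕ+ × ℕ+,
              (𝒱 ((p.1 : ℝ) / N) : ℂ) * (𝒲 ((p.2.1 : ℝ) / M) : ℂ) *
                (kloos (p.2.1 : ℤ) ((p.1 : ℤ) ^ 2) ((p.2.2 : ℕ) * q) /
                  (((p.2.2 : ℕ) * q : ℕ) : ℂ)) *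
                (besselJ (k - 1)
                  (4 * Real.pi * (p.1 : ℝ) * Real.sqrt (p.2.1 : ℝ) /
                    (((p.2.2 : ℕ) * q : ℕ) : ℝ)) : ℂ)‖
        ≤ C * (q : ℝ) ^ ε * N * M ^ ((3 : ℝ) / 4) / q := by
  have hν : 8 ≤ k - 1 := by omega
  set ν := k - 1 with hνdef
  set V : ℝ → ℂ := fun t => (𝒱 t : ℂ) with hVdef
  set W : ℝ → ℂ := fun t => (𝒲 t : ℂ) with hWdef
  have hV : ContDiff ℝ ∞ V := Complex.ofRealCLM.contDiff.comp h𝒱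
  have hW : ContDiff ℝ ∞ W := Complex.ofRealCLM.contDiff.comp h𝒲
  have hVs : Function.support V ⊆ Set.Icc 1 2 := fun t ht => h𝒱s (by
    simpa [hVdef] using ht)
  have hWs : Function.support W ⊆ Set.Icc 1 2 := fun t ht => h𝒲s (by
    simpa [hWdef] using ht)
  obtain ⟨CM, hCM, HM⟩ := caseM_total V W hV hVs hW hWs ν hν
  obtain ⟨CN, hCN, HN⟩ := caseN_total V W hV hVs hW hWs ν hν
  obtain ⟨K, hK, HK⟩ := besselJ_small ν hν
  refine ⟨CM + CN, ?_⟩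
  intro q hq N M hN hM
  have hN0 : 0 < N := by linarith
  have hM0 : 0 < M := by linarith
  have hq2 : 2 ≤ q := hq.two_le
  have hqr : (1:ℝ) ≤ q := by exact_mod_cast (by omega : 1 ≤ q)
  set g : ℕ → ℕ → ℕ → ℂ := fun n m c => (𝒱 ((n : ℝ) / N) : ℂ) * (𝒲 ((m : ℝ) / M) : ℂ) *
    (kloos (m : ℤ) ((n : ℤ) ^ 2) (c * q) / ((c * q : ℕ) : ℂ)) *
    (besselJ ν (4 * Real.pi * (n : ℝ) * Real.sqrt (m : ℝ) / ((c * q : ℕ) : ℝ)) : ℂ) with hg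
  have hsummable : Summable (fun p : ℕ+ × ℕ+ × ℕ+ => ‖g p.1 p.2.1 p.2.2‖) := by
    have sA := summable_fin_pnat (fun n => |𝒱 ((n:ℝ) / N)| * (n:ℝ) ^ 8) ⌊2 * N⌋₊ (fun n hn => by
      rw [vanish_of_supp h𝒱s N hN n hn]; simp)
    have sB := summable_fin_pnat (fun n => |𝒲 ((n:ℝ) / M)| * Real.sqrt n ^ 8) ⌊2 * M⌋₊
      (fun n hn => by rw [vanish_of_supp h𝒲s M hM n hn]; simp)
    have sC : Summable (fun c : ℕ+ => K * (4 * Real.pi) ^ 8 * (1 / ((c : ℕ) : ℝ) ^ 8)) :=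
      (((Real.summable_one_div_nat_pow (p := 8)).mpr (by norm_num)).comp_injective
        PNat.coe_injective).mul_left _
    have sBC := sB.mul_of_nonneg sC (fun n => by positivity) (fun n => by positivity)
    have sABC := sA.mul_of_nonneg sBC (fun n => by positivity) (fun n => by positivity)
    refine Summable.of_nonneg_of_le (fun p => norm_nonneg _) (fun p => ?_) sABC
    obtain ⟨n, m, c⟩ := p
    simp only [hg, norm_mul, norm_div, Complex.norm_real, Real.norm_eq_abs, Complex.norm_natCast]
    have hc1 : (1:ℝ) ≤ (c:ℕ) := by exact_mod_cast c.one_le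
    have hcq : ((c:ℕ):ℝ) ≤ (((c:ℕ) * q : ℕ) : ℝ) := by push_cast; nlinarith
    have hcq0 : (0:ℝ) < (((c:ℕ) * q : ℕ) : ℝ) := by linarith
    have k1 : ‖kloos ((m:ℕ) : ℤ) (((n:ℕ) : ℤ) ^ 2) ((c:ℕ) * q)‖ / (((c:ℕ) * q : ℕ) : ℝ) ≤ 1 :=
      (div_le_one hcq0).mpr (kloos_norm_le _ _ _)
    have k2 := HK (4 * Real.pi * ((n:ℕ) : ℝ) * Real.sqrt ((m:ℕ) : ℝ) / (((c:ℕ) * q : ℕ) : ℝ))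
    have k3 : |4 * Real.pi * ((n:ℕ) : ℝ) * Real.sqrt ((m:ℕ) : ℝ) / (((c:ℕ) * q : ℕ) : ℝ)| ≤
        4 * Real.pi * ((n:ℕ) : ℝ) * Real.sqrt ((m:ℕ) : ℝ) / ((c:ℕ) : ℝ) := by
      rw [abs_of_nonneg (by positivity)]
      gcongr
    calc _ ≤ |𝒱 (((n:ℕ):ℝ) / N)| * |𝒲 (((m:ℕ):ℝ) / M)| * 1 *
          (K * (4 * Real.pi * ((n:ℕ) : ℝ) * Real.sqrt ((m:ℕ) : ℝ) / ((c:ℕ) : ℝ)) ^ 8) := by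
          gcongr
          exact k2.trans (by gcongr)
      _ = _ := by rw [div_pow]; ring
  refine ⟨hsummable, ?_⟩
  have hsg : Summable (fun p : ℕ+ × ℕ+ × ℕ+ => g p.1 p.2.1 p.2.2) := hsummable.of_norm
  change (N * M) ^ (-(1 : ℝ) / 2) * ‖∑' p : ℕ+ × ℕ+ × ℕ+, g p.1 p.2.1 p.2.2‖ ≤ _
  set P := CM + CN with hP
  set Y := N ^ ((3:ℝ)/2) * M ^ ((5:ℝ)/4) with hY
  set G : ℕ → ℂ := fun c => Tsum V W ν N M (c * q) / ((c * q : ℕ) : ℂ) with hG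
  have hGsum : ∑' p : ℕ+ × ℕ+ × ℕ+, g p.1 p.2.1 p.2.2 = ∑' b : ℕ, G (b + 1) := by
    let e : ℕ+ × (ℕ+ × ℕ+) ≃ ℕ+ × ℕ+ × ℕ+ :=
      (Equiv.prodComm ℕ+ (ℕ+ × ℕ+)).trans (Equiv.prodAssoc ℕ+ ℕ+ ℕ+)
    have he : ∀ x, (fun p : ℕ+ × ℕ+ × ℕ+ => g p.1 p.2.1 p.2.2) (e x) = g x.2.1 x.2.2 x.1 :=
      fun x => rfl
    have hse : Summable (fun x : ℕ+ × (ℕ+ × ℕ+) => g x.2.1 x.2.2 x.1) :=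
      (e.summable_iff (f := fun p : ℕ+ × ℕ+ × ℕ+ => g p.1 p.2.1 p.2.2)).mpr hsg
    rw [← e.tsum_eq (fun p : ℕ+ × ℕ+ × ℕ+ => g p.1 p.2.1 p.2.2)]
    simp only [he]
    rw [hse.tsum_prod, ← tsum_pnat_eq_tsum_succ (f := G)]
    refine tsum_congr (fun c => ?_)
    have hsc : Summable (fun y : ℕ+ × ℕ+ => g y.1 y.2 c) := hse.prod_factor c
    rw [hsc.tsum_prod]
    have hin : ∀ n : ℕ, ∑' m : ℕ+, g n m c = ∑ m ∈ Finset.Icc 1 ⌊2 * M⌋₊, g n m c := fun n =>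
      tsum_pnat_fin (fun m => g n m c) _ (fun m hm => by
        simp only [hg]; rw [vanish_of_supp h𝒲s M hM m hm]; simp)
    simp only [hin]
    rw [tsum_pnat_fin (fun n => ∑ m ∈ Finset.Icc 1 ⌊2 * M⌋₊, g n m c) ⌊2 * N⌋₊ (fun n hn => by
      refine Finset.sum_eq_zero (fun m _ => ?_)
      simp only [hg]; rw [vanish_of_supp h𝒱s N hN n hn]; simp)]
    simp only [hG, Tsum, Finset.sum_div]
    refine Finset.sum_congr rfl (fun n _ => Finset.sum_congr rfl (fun m _ => ?_))
    simp only [hg, hVdef, hWdef]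
    ring
  have hpart : ∀ n, ∑ b ∈ Finset.range n, ‖G (b + 1)‖ ≤ P * Y / q := by
    intro n
    have e : ∑ b ∈ Finset.range n, ‖G (b + 1)‖ =
        ∑ b ∈ Finset.range n, ‖Tsum V W ν N M ((b + 1) * q)‖ / (((b + 1) * q : ℕ) : ℝ) := by
      refine Finset.sum_congr rfl (fun b _ => ?_)
      simp only [hG, norm_div, Complex.norm_natCast]
    rw [e]
    have hY0 : 0 ≤ Y := by positivity
    rcases le_total N M with h | h
    · refine (HM q hq2 N M hN hM h n).trans ?_
      gcongr
      linarith
    · refine (HN q hq2 N M hN hM h n).trans ?_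
      gcongr
      linarith
  have hGs : Summable (fun b => ‖G (b + 1)‖) :=
    summable_of_sum_range_le (fun _ => norm_nonneg _) hpart
  have hfin : ‖∑' p : ℕ+ × ℕ+ × ℕ+, g p.1 p.2.1 p.2.2‖ ≤ P * Y / q := by
    rw [hGsum]
    exact (norm_tsum_le_tsum_norm hGs).trans
      (Real.tsum_le_of_sum_range_le (fun _ => norm_nonneg _) hpart)
  have hYe : (N * M) ^ (-(1 : ℝ) / 2) * Y = N * M ^ ((3:ℝ)/4) := by
    rw [hY, Real.mul_rpow hN0.le hM0.le]
    calc _ = (N ^ (-(1 : ℝ) / 2) * N ^ ((3:ℝ)/2)) * (M ^ (-(1 : ℝ) / 2) * M ^ ((5:ℝ)/4)) := by ring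
      _ = N ^ (1:ℝ) * M ^ ((3:ℝ)/4) := by
        rw [← Real.rpow_add hN0, ← Real.rpow_add hM0]; norm_num
      _ = _ := by rw [Real.rpow_one]
  have hqe : (1:ℝ) ≤ (q:ℝ) ^ ε := Real.one_le_rpow hqr hε.le
  have hP0 : 0 ≤ P := by positivity
  calc _ ≤ (N * M) ^ (-(1 : ℝ) / 2) * (P * Y / q) := by gcongr
    _ = P * 1 * ((N * M) ^ (-(1 : ℝ) / 2) * Y) / q := by ring
    _ = P * 1 * N * M ^ ((3:ℝ)/4) / q := by rw [hYe]; ring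
    _ ≤ _ := by gcongr
end
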